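/- Every bordered double circulant self-dual binary code of length 92 with minimum weight 16 has automorphism group of order exactly 90, where the automorphism group is the group of coordinate permutations mapping the code onto itself. -/

import Mathlib

/-- The standard inner product on `ι → ZMod 2`. -/
def dot {ι : Type*} [Fintype ι] (x y : ι → ZMod 2) : ZMod 2 := ∑ i, x i * y i

/-- A binary linear code is self-dual if it coincides with its dual. -/
def IsSelfDual {ι : Type*} [Fintype ι] (C : Submodule (ZMod 2) (ι → ZMod 2)) : Prop :=
  ∀ x, x ∈ C ↔ ∀ y ∈ C, dot x y = 0

/-- `C` has minimum (nonzero) weight exactly `d`. -/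
def MinWeightIs {ι : Type*} [Fintype ι] (C : Submodule (ZMod 2) (ι → ZMod 2)) (d : ℕ) : Prop :=
  (∃ x ∈ C, x ≠ 0 ∧ hammingNorm x = d) ∧ ∀ x ∈ C, x ≠ 0 → d ≤ hammingNorm x

/-- `A_i(C)`: the number of codewords of `C` of Hamming weight `i`. -/
noncomputable def weightEnum {ι : Type*} [Fintype ι] (C : Submodule (ZMod 2) (ι → ZMod 2)) (i : ℕ) : ℕ :=
  Set.ncard {x : ι → ZMod 2 | x ∈ C ∧ hammingNorm x = i}

/-- Two codes are equivalent if a coordinate permutation maps one onto the other. -/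
def CodeEquiv {ι : Type*} [Fintype ι] (C C' : Submodule (ZMod 2) (ι → ZMod 2)) : Prop :=
  ∃ σ : Equiv.Perm ι, Submodule.map (LinearMap.funLeft (ZMod 2) (ZMod 2) ⇑σ) C = C'

/-- The order of the automorphism group of a code: the number of coordinate
permutations mapping the code onto itself. -/
noncomputable def autGroupOrder {ι : Type*} [Fintype ι] (C : Submodule (ZMod 2) (ι → ZMod 2)) : ℕ :=
  Nat.card {σ : Equiv.Perm ι // Submodule.map (LinearMap.funLeft (ZMod 2) (ZMod 2) ⇑σ) C = C}

/-- A circulant matrix: each row is the cyclic shift of the previous one. -/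
def IsCirculant {n : ℕ} (R : Matrix (Fin n) (Fin n) (ZMod 2)) : Prop :=
  ∃ v : Fin n → ZMod 2, R = Matrix.circulant v

/-- The pure double circulant code with generator matrix `(I_n | R)`. -/
def pureDCC {n : ℕ} (R : Matrix (Fin n) (Fin n) (ZMod 2)) :
    Submodule (ZMod 2) (Fin n ⊕ Fin n → ZMod 2) :=
  Submodule.span (ZMod 2)
    (Set.range fun i : Fin n =>
      Sum.elim (fun j => if j = i then (1 : ZMod 2) else 0) (R i))

/-- A bordered matrix: first row `(0,1,…,1)`, first column `(0,1,…,1)ᵀ`, and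
lower-right block an `n × n` circulant matrix. -/
def IsBorderMatrix {n : ℕ} (B : Matrix (Fin (n + 1)) (Fin (n + 1)) (ZMod 2)) : Prop :=
  B 0 0 = 0 ∧ (∀ j, j ≠ 0 → B 0 j = 1) ∧ (∀ i, i ≠ 0 → B i 0 = 1) ∧
  ∃ R' : Matrix (Fin n) (Fin n) (ZMod 2), IsCirculant R' ∧
    ∀ i j : Fin n, B i.succ j.succ = R' i j

/-- The bordered double circulant code with generator matrix `(I_{n+1} | B)`. -/
def borderedDCC {n : ℕ} (B : Matrix (Fin (n + 1)) (Fin (n + 1)) (ZMod 2)) :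
    Submodule (ZMod 2) (Fin (n + 1) ⊕ Fin (n + 1) → ZMod 2) :=
  Submodule.span (ZMod 2)
    (Set.range fun i : Fin (n + 1) =>
      Sum.elim (fun j => if j = i then (1 : ZMod 2) else 0) (B i))


set_option maxRecDepth 100000
namespace DC

/-- if-then-else on booleans by the recursor -/
abbrev bi {α : Type} (b : Bool) (t f : α) : α := Bool.rec f t b
def ones (n : ℕ) : ℕ := Nat.sub (Nat.shiftLeft 1 n) 1
def M45 : ℕ := 35184372088831
def bit (a i : ℕ) : Bool := Nat.beq (Nat.land (Nat.shiftRight a i) 1) 1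
def rotN (k b : ℕ) : ℕ := Nat.land (Nat.lor (Nat.shiftLeft b k) (Nat.shiftRight b (Nat.sub 45 k))) M45
/-- product in the group algebra, using the first `i` bits of `a` -/
noncomputable def mulX (a b n : ℕ) : ℕ :=
  Nat.rec 0 (fun i ih => bi (bit a i) (Nat.xor ih (rotN i b)) ih) n
noncomputable def mulN (a b : ℕ) : ℕ := mulX a b 45
noncomputable def muX (m a n : ℕ) : ℕ :=
  Nat.rec 0 (fun i ih => bi (bit a i) (Nat.xor ih (Nat.shiftLeft 1 (Nat.mod (Nat.mul i m) 45))) ih) n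
noncomputable def muN (m a : ℕ) : ℕ := muX m a 45
noncomputable def pcX (a n : ℕ) : ℕ :=
  Nat.rec 0 (fun i ih => Nat.add ih (Nat.land (Nat.shiftRight a i) 1)) n
noncomputable def pc (a : ℕ) : ℕ := pcX a 45

/-! lanes -/
noncomputable def zipS (s : ℕ) (l : List ℕ) : List ℕ → List ℕ :=
  List.rec (fun _ => []) (fun o _ ih l' => List.rec [] (fun q qs _ => Nat.lor o (Nat.shiftLeft q s) :: ih qs) l') l

noncomputable def comb (p c : ℕ × List ℕ) : ℕ × List ℕ :=
  (Nat.add c.1 p.1, Nat.shiftLeft (ones p.1) c.1 ::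
    bi (Nat.beq p.1 0) c.2 (bi (Nat.beq c.1 0) p.2 (zipS c.1 c.2 p.2)))

noncomputable def stepR (m n : ℕ) (l : List (ℕ × List ℕ)) : ℕ → (ℕ × List ℕ) → List (ℕ × List ℕ) :=
  List.rec (fun _ _ => []) (fun c _ ih k p =>
    (bi (Nat.ble (Nat.mul m (Nat.succ n)) (Nat.mul 45 (Nat.succ k))) (comb p c)
      (0, 0 :: c.2)) :: ih (Nat.succ k) c) l

noncomputable def zeroL (n : ℕ) : List ℕ := Nat.rec [] (fun _ ih => 0 :: ih) n

noncomputable def rows (m n : ℕ) : List (ℕ × List ℕ) :=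
  Nat.rec ((1, []) :: List.replicate (Nat.sub m 1) (0, []))
   (fun n ih => stepR m (Nat.succ n) ih 0 (0, zeroL n)) n

noncomputable def lin (z : ℕ) (l : List ℕ) : ℕ → ℕ :=
  List.rec (fun _ => z) (fun x _ ih m => bi (Nat.beq (Nat.land m 1) 0) (ih (Nat.shiftRight m 1))
      (Nat.xor x (ih (Nat.shiftRight m 1)))) l

noncomputable def addB (l : List ℕ) : ℕ → List ℕ :=
  List.rec (fun _ => []) (fun b _ ih c => Nat.xor b c :: ih (Nat.land b c)) l

noncomputable def cntD (z : ℕ) (xs : List ℕ) (r n : ℕ) : List ℕ :=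
  Nat.rec [0,0,0,0,0,0] (fun j ih => addB ih (lin z xs (rotN (Nat.sub 44 j) r))) n

noncomputable def eqP (z : ℕ) (l : List ℕ) : ℕ → ℕ :=
  List.rec (fun _ => z) (fun b _ ih v =>
    Nat.land (bi (Nat.beq (Nat.land v 1) 0) (Nat.xor b z) b) (ih (Nat.shiftRight v 1))) l

noncomputable def ext (f : ℕ) : ℕ → ℕ → List ℕ → List ℕ :=
  Nat.rec (fun off g acc => bi (Nat.beq g 0) acc (off :: acc))
   (fun f ih off g acc => bi (Nat.beq g 0) acc
      (ih off (Nat.land g (ones (Nat.pow 2 f)))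
       (ih (Nat.add off (Nat.pow 2 f)) (Nat.shiftRight g (Nat.pow 2 f)) acc))) f

noncomputable def bt (x t : ℕ) : ℕ := bi (Nat.beq (Nat.land x (Nat.shiftLeft 1 t)) 0) 0 1
noncomputable def dec (t : ℕ) (l : List ℕ) : ℕ → ℕ :=
  List.rec (fun acc => acc) (fun x _ ih acc => ih (Nat.lor (Nat.shiftLeft acc 1) (bt x t))) l

/-- candidates from one row -/
noncomputable def candR (row : ℕ × List ℕ) (r v : ℕ) : List ℕ :=
  (ext 20 0 (eqP (ones row.1) (cntD (ones row.1) (row.2 ++ [ones row.1]) r 45) v) []).map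
    (fun t => dec t (row.2 ++ [ones row.1]) 0)

noncomputable def lastD (l : List (ℕ × List ℕ)) : ℕ × List ℕ → ℕ × List ℕ :=
  List.rec (fun d => d) (fun x _ ih _ => ih x) l

noncomputable def cand (r m : ℕ) : List ℕ := candR (lastD (rows m 44) (0, [])) r (Nat.sub 14 m)

/-! trees -/
inductive Tr where
  | lf : Tr
  | nd : Tr → ℕ → Tr → Tr

noncomputable def Tr.ins (x : ℕ) (t : Tr) : Tr :=
  Tr.rec (.nd .lf x .lf) (fun l y r ihl ihr =>
    bi (Nat.beq x y) (.nd l y r) (bi (Nat.ble x y) (.nd ihl y r) (.nd l y ihr))) t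

noncomputable def Tr.lst (t : Tr) : List ℕ → List ℕ :=
  Tr.rec (fun acc => acc) (fun _ y _ ihl ihr acc => ihl (y :: ihr acc)) t

def idN (a c : ℕ) : ℕ := Nat.lor a (Nat.shiftLeft c 45)
noncomputable def gens (a c n : ℕ) : Tr → Tr :=
  Nat.rec (fun t => t) (fun i ih t => ih
    (bi (bit c i) (Tr.ins (idN (rotN i (muN 44 c)) (rotN i (muN 44 a)))
      (bi (bit a i) (Tr.ins (idN (rotN (Nat.sub 45 i) a) (rotN (Nat.sub 45 i) c)) t) t))
      (bi (bit a i) (Tr.ins (idN (rotN (Nat.sub 45 i) a) (rotN (Nat.sub 45 i) c)) t) t))) n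

noncomputable def cmpl (r a : ℕ) : ℕ := Nat.xor M45 (mulN a r)

noncomputable def build (r : ℕ) (l : List ℕ) : Tr → Tr :=
  List.rec (fun t => t) (fun a _ ih t => ih (bi (bi (Nat.beq (Nat.land (pc a) 1) 1)
      (Nat.beq (Nat.add (pc a) (pc (cmpl r a))) 14) false)
      (gens a (cmpl r a) 45 t) t)) l

/-- `x < head`, strictly increasing, length bounded -/
noncomputable def sortedB (l : List ℕ) : ℕ → ℕ → Bool :=
  List.rec (fun _ _ => true) (fun y _ ih x n =>
    bi (Nat.blt x y) (bi (Nat.ble n 0) false (ih y (Nat.sub n 1))) false) l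

noncomputable def cnt8 (l : List ℕ) : List ℕ → List ℕ :=
  List.rec (fun pl => pl) (fun x _ ih pl => ih (addB pl x)) l

noncomputable def valP (l : List ℕ) (p : ℕ) : ℕ :=
  List.rec 0 (fun b _ ih => Nat.add (Nat.land (Nat.shiftRight b p) 1) (Nat.mul 2 ih)) l

noncomputable def blocks (r : ℕ) : List ℕ :=
  (build r (1 :: (cand r 3 ++ (cand r 5 ++ cand r 7))) Tr.lf).lst []

def idx (y z : ℕ) : ℕ :=
  bi (Nat.ble 45 y)
    (bi (Nat.ble 45 z) (Nat.mod (Nat.sub (Nat.add y 45) z) 45) (Nat.add 45 (Nat.mod (Nat.sub y z) 45)))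
    (bi (Nat.ble 45 z) (Nat.add 45 (Nat.mod (Nat.sub z y) 45)) (Nat.mod (Nat.sub (Nat.add z 45) y) 45))


/-- positions `z < n` with count value `v` -/
noncomputable def zl (pl : List ℕ) (v n : ℕ) : List ℕ :=
  Nat.rec [] (fun z ih => bi (Nat.beq (valP pl z) v) (z :: ih) ih) n

noncomputable def sumL (pl : List ℕ) (y : ℕ) (l : List ℕ) : ℕ :=
  List.rec 0 (fun z _ ih => Nat.add (valP pl (idx y z)) ih) l

noncomputable def f2 (pl : List ℕ) (y : ℕ) (zs : List (List ℕ)) : ℕ :=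
  List.rec 0 (fun l _ ih => Nat.add (sumL pl y l) (Nat.mul 4096 ih)) zs

noncomputable def neAll (x : ℕ) (l : List ℕ) : Bool :=
  List.rec true (fun y _ ih => bi (Nat.beq x y) false ih) l
noncomputable def nodupB (l : List ℕ) : Bool :=
  List.rec true (fun x l ih => bi (neAll x l) ih false) l

noncomputable def f2s (pl : List ℕ) (zs : List (List ℕ)) (n : ℕ) : List ℕ :=
  Nat.rec [] (fun y ih => f2 pl y zs :: ih) n

noncomputable def chk2 (vs : List ℕ) (pl : List ℕ) : Bool :=
  nodupB (f2s pl (vs.map (fun v => zl pl v 90)) 90)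

noncomputable def chk (r : ℕ) (vs : List ℕ) : Bool :=
  bi (sortedB (blocks r) 0 255) (chk2 vs (cnt8 (blocks r) [0,0,0,0,0,0,0,0])) false

end DC

namespace DC
def e3 : ℕ := 30158033218998
def e5 : ℕ := 34049392344030
def e9 : ℕ := 4957484912712
def f15 : ℕ := 5323774432094
def f45 : ℕ := 68870738504
def B3 : List ℕ := [25131694349165, 30158033218998]
def B5 : List ℕ := [19294655661617, 20429635406418, 22699594896020, 27239513875224]
def B9 : List ℕ := [4475507212865, 8951014425730, 17902028851460, 4957484912712, 9914969825424, 19829939650848]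
def B15 : List ℕ := [7405823367921, 14811646735842, 29623293471684, 21295097728376]
def B45 : List ℕ := [77446025217, 154892050434, 309784100868, 619568201736, 1239136403472, 2478272806944, 4956545613888, 9913091227776, 19826182455552, 4407727264256, 8815454528512, 17630909057024]
def L3 : List ℕ := [25131694349165, 30158033218998, 15079016609499]
def P15 : List (ℕ × ℕ) := [(1, 11), (2, 5), (3, 6), (4, 10), (5, 2), (6, 3), (7, 8), (8, 7), (9, 13), (10, 4), (11, 1), (12, 15), (13, 9), (14, 14), (15, 12)]
def goodR : List ℕ := [3088794311081, 15993320350422, 15954050425710, 5018730498854, 30699214386759, 5582554942886, 21627966625607, 26418308351478, 1035232584947, 30962169173908, 7994138114594, 26556154665698, 27159611791536, 32716341300603, 26893316217768, 26999658632910, 15022879740437, 23278595698717, 19250231469570, 27505410524186, 4616558522561, 4377136222856, 5083480599112, 27753748028609, 2674614790525, 14873383949753, 12409089281670, 12143250181887, 28538973363971, 17636162878642, 29443194867195, 5882462210421, 23625513585121, 8492297386588, 10591798870577, 32036990128181, 27901079355705, 16211673860237, 28861006715529, 19279795926100, 20523690785797, 794384170289, 27656159147497, 7592197470958, 20333902456969,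 32478624536408, 35100603338700, 7076490686899, 3151352641779, 18524718788833, 21924081794119, 7174540929436, 28243933156677, 14325796686590, 34676350560091, 25355985519939, 11344955690059, 14071272789566, 25089037234528, 12947263391039, 169996552578, 28821511801645, 18099318825519, 2421628233052, 7044232770611, 27893171292394, 31646865678086, 10275911969072, 22464666590699, 19568818389408, 23425507133764, 21222026644836, 29665074064315, 1878758874427, 3140584254933, 24576078315473, 26293013024965, 14790332742316, 8127657260932, 21643271955625, 12281242373356, 16941424106976, 2158639906900, 34148832508853, 15348081438808, 4824655238659, 30361428122648, 19946399972059, 8335616404504, 23154552847600, 8896167269791, 212547443143, 29728042535128, 15270567449459, 30361530878602, 24802402565829, 29087075845726, 12583020369221, 20685936689137, 13457132537458, 22510109370210, 13440278577903, 34344703493549, 12766095759149, 30092539335717, 15542715233328, 23158316480350, 31228269433594, 10920596733187, 32048238505518, 9512616367246, 15087477495798, 10977319487226, 27897725010816, 14296222438143, 9206785081235, 28210339814692, 34314480912209, 18421812738176, 29137924397934, 10598918721917, 1695000543472, 28736525927229, 24012650659052, 15295173609812, 32762264914368, 22644426106859, 30417203616546, 18790952825195, 25616538134534, 24018892612182,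 11521967660253, 9003865896607, 6284530466946, 4199936230989, 14347372838200, 28272344102352, 1076319129824, 28319367457482, 25373374582747, 34727561440707, 23164369439339, 14849830266807, 25206223587841, 23030092211879, 5322475136563, 10238456870004, 5969129080060, 23734696429331, 8326032068353, 5201347740583, 19575967176316, 14130857517603, 3701317147708, 18461198016261, 1265004560569, 31756378434681, 824724121027, 6510613440288, 31434626385225, 20231470505691, 18222376311495, 15501733634280, 9717544664023, 13190056327025, 33577625641642]
def D0 : List (ℕ × ℕ × ℕ) := [
(584, 584, 888652108234405089224964363229164770416679029923005373124348723306490896142987974853650169869610112811329211952233507032460773618),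
(3, 504, 3669240376628793036933780448223747934153556715914753767395904884990486084325704856688329941310950852905506567297026803331685600634958054527471014656221745515419489634942746124018115653882246608822264427185294497503623444549459763367185659063908402066395386050336523261026528846519159184279450344073544229818604939388360925262),
(3535, 3242, 1301823920975714508529099642358350797213338079272175017542894123839368166408439693673579061507996990793047865891907704949220454541209092886450320518908949366081006188044618483119415996376501670036119203174059064769762966811335900767759768888233971467393618075866033727593443001890876830584376213075996743242107493765299253),
(2904, 1352, 623920959202917203208580453881271180338690975493924022015538179333326993194498326469015264707406213342927220570733965328848386678696641353471674080742349291036918175411289540261662592360176385196074080843359225854260544665409827218380466858593673259495146113572817394579180425849019807804100155518759986789633444730683066263324188242341072855262135398669461691414),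
(3808, 1825, 25517770302447096578204294630462138425295820978851410032913143264425586352908889396696257096358824302890909369109783159694187788485654780614295040785002686407765573308168271442181681270089389825094649773301929527940607416095691172363388583499481432860857529581811687026858853115643233361636405284790846914839628),
(3447, 3522, 30841053752642396386574542248038379483435578339301219078111943675155092655969259304757494546082172480707521455272607412990566685354548708558263770121214009019721524741014105071801929396685004624537273757882765133383952204761936497421171641026102432140830202731845918138785946178842035883624841346612339190388887715620544825884160120960070775478309),
(3848, 1864, 483334364075263535588283656953854968461187323153933662217181430639588888943588799227425812479826127277768524977932801832236474800535468667044810359326841406968346242860987401539063963704172395537560599546818781125054049915556993308768115766760728669158560469684538362782047089499347599957067903728565702786190979554159270611621608914162342042645),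
(2341, 1844, 126141908637846093151423115448617590819921414379510361606632759604877019642363276322860066505614383485430353593429688644817102588118625654999034486985869076314233200379623958607822468661582682189654019932947057960414602851870156975088564346999057230224287101447816208866438297789660228690258214247389410135277685151578977456751643887647766039592442910),
(3655, 1358, 31159883951385792478629902040689308219782653854889049615932405742737117547092356877342854224245773790984578874922293786634095155501600558305629459020318171049467657718220469797811841033433082668244926258945287076501745927062981597417235007998221814481189755146564562604390408260261234705666293058314166493790486700131351111346981213903115833590893907113130),
(1925, 1232, 94575565200386597693656457484217277888425929642741351389419482111783294311544298643727267762943002020836656052250160043483818485869576276288992089488986075863878421451240040811902868391999978291861949777198993278275378610713263418537230006911046106717590098797642276653388781034644225741521898349515560810580251578214692340497057255965183021069846564)]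
def D1 : List (ℕ × ℕ × ℕ) := [
(629, 1175, 117073653613844857875190864377214994253873372106683159784512446291806510373983080767225369427834071995861417637757358681352872893036591498621247182817088280758553260476367361827077175389533067244169371301820380053706252915147776852324000406261965976627870879632257227857710882116485166772037674108981943333915386350247122035),
(2703, 3545, 154520970246844805283413438187502284192912204319174593871781603206024072874740069916160331893535278056081237641298850521317201330569559585110891876116800105403844411665404798345052000472283697216078813398804383241169880237448010255073259233676298616996851189845250487686421230654891975455722158568424757539946826522827304798814103497084520524),
(3250, 2423, 115887951119427283038557756117035589973961890104483302780760956782490554128025139610840158124804906853601479257751710018292381213694859818936414173246804848639758570422960702048775669313866087511025115971641122735658788049067557166472756767016347488085121379683340574071505106362110232859575267612273596322146564179),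
(3969, 3786, 95546010793249406145528244582148471421251022671623113240776849123966646683762153261895901410382625042354016207391546600875405654762517341157615964878436268551850963035023020528908135866325804074705023086599874083765905888406030485475341239534306294588538619935795282983363596363021184587650475036519855792529573358514737668006901974391016469),
(2755, 2625, 7431969281703143947641685983615592720657887862473177258326363706693904049441794929902910444063222083167655419285222112533996036868531920292130868711737303594412316853189001361151214223698984087763129235880562016547396629939161877393350244913879534824063484701284986306770829755694995603744046254377187397406438860876),
(2763, 2814, 95964158750443557658274995480814578095456024775198584339144986506589073454651067240152084945647861883327749612493539161576860628480198837113424855221853198709813350945630716599590877246119063771294382981058011917017630585607548192454835509281188602325637440659127691606205221136845828650221854322548556480520101662125733948),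
(227, 1860, 879429665303186977533483960511130144554574786518560358447595983150412784752629531344317262453049306574744608623420238647097820356815706488276705019772166434514958659772640580080796948009171957841401894439705249774366497145825514045963145500212846997819385178478631057224192894822903221013660691),
(1699, 215, 8008726523391426866645442542549943844651744684532035935478404997548239623390687456129195359912944447826560053918612287606277958731860567645342305055030434357226987809298623579357839290057574979986370523889173219146954672240417197500153822496604891299189100448226497585610742658128848836224936222678455552704763464035903149102),
(1119, 2020, 1959516484993318835437528124815423336959949001319612325588112756755798461058050996492717543533251705561296789311477461751294909148995614195011391433973152725303391611648695847343484523916618210490522376078253517715209319672282891806648808308918346396855667989478081239764493945732882052790391361828101965105340470),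
(3382, 499, 2042789807081298788976808212500282507643809118629250265549541975113040861270911090750349895332736425932360517044610961151974458113203124691394863792758216433131852992944224666738485226831828644685054697632689124547828476196142946048159327828855881946364601539110216154071067405683785450065888605168885500859972665234384367979344926)]
def D2 : List (ℕ × ℕ × ℕ) := [
(1288, 2064, 5507106789715749845978107329546791103950427530336924858946718847378411407311208725488703545729100580359066848800529006734324994979259788615274596578306331224094895268799204882252357500946508669441385505831104820278975783720334647964097971466627185531149659070156810321983550671798604039122570228342261958801436),
(3567, 2769, 15882156620251732393420494726342082046491575344236564369039114761932500086734633080936970354058432301359552819588024140769446808952706142639062943049642205326066305003499357144054777838740500931813061526252326323105668165127610809398975783614615287903569179705846220209177577043962208133279398354793744925164986878242994579641365),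
(1018, 1108, 24069253850390957084781076472996736399067777266131291636554500122932863846293696468374625217539756797731443025367696381164202569997574254177425542686103521847735284691444400374259139065941402659940342720619460822639669285893099878525953550338337832208925535310354756777094886910404887264770962191247757675933756),
(2017, 537, 8026274672815842019754745049644543351701550404031690229063483019553853172990438665782583614116261828928292474418167297496196122625388591439216254612726599778673902939154270563205712219925512461811802793381963469429464933383148081323764358986612641306119405329151609482469600730478012760541355096075418548643570988559423748863280518141505114150),
(1670, 3962, 460895063499372086054509207014159927196158556225405608819296621398124766796856806704173473403101705442381181726567325761225989526291947616979358514851319009243890500011849612548921747057501925899807818297495086826010133505966815766739646522388586425687585845650755272577037629242631413841359287392519847667806036572229),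
(2732, 2494, 38793235497288032319936143733990804225214585676493793771868153621985159422005732630247695182550818145665205305703487754830844890470275494541423715266602904100139179092756362815049658512588953564178036999700918183731593590792834572241624056772781599617801519783749719938666887893349484943848678691472710906365608752709580900009004840769823124690965),
(2527, 1304, 6778648179179610319692342911402674452301707165049997120833564185799126977338766222842872472435753328333598304272559217374982254975730267719578460208130126767203458169607681435811843408111180839118895845639176428740047865128649622416590155043494219345977142678811911742498079966873894442174840878849595328950319033179690573891),
(3544, 1971, 33639844435964749635470977365531644289872484506868599454121476843567925872901991382939123648955993801364097823715336265873618443390232485704751248188856696412222189308495759594455640191555290856028719722327908946390490011933900723685349470870105301118793892604073559485878748559529990316017872988324290995101978227588117),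
(4050, 568, 860262582904702563684828149415567528092420852383152359216335235436535603625595935113210298714564214511817253392542997272830934045428175823972605426569687498187590326457287408840099075509546457448398049418555049324764573350961871147969976703508518140239942061773927566321471375932410417306405493263556614298623339750208140052065879291340925360831516),
(536, 2777, 36083394136378440476374594780683438410552188984050906151484231343608678891849992838556978678790870013940758216403247269154498734805393628505885782285539295140314269113314452756565726638598273495593062149421235740372758856224938713155962588076349897794394882953300815652136695730936747329931907812184280072283482818925071945473604743742493)]
def D3 : List (ℕ × ℕ × ℕ) := [
(3857, 278, 11333455938603596838027844510132288617985717867990230729084415626811836169194106940517162234054950742831438378104916893784081437846551935313290951581090709679516267201935653289056806628516655168856741192246938717556645872392827111649564904706902385774446868921640329407344135921348732938405617529195174019477370094494742043430397872702040981446804701865425925141),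
(3097, 298, 62763821817147947866423697259701226851157319200118345207039427257240176135523969155278116779316337155470111466611925092867837081348387856657533231352277417681599395182622712993942444109069518804077521224736015612233915381227786501012688577057271201145091890137813783267229627728224999477),
(591, 2375, 1550528493797597141239194061909444455338029045605253153953784054832064736766031466864434280505777848633086059679842104171252289067882914759306052315596754303113060500724607678998507119853436368938598693553555235617652734961228100347582184223525996382956803770441914674976625047380133954093844556502015230211169670624654405),
(2782, 324, 1785553417444187734614006170207497538984203758966243787862047649257720583960214105161650879076141568843739293328238511219870460332103794856611989934663622046962328858094919131152205053817754910571722470013204205606611466952554754940675380627596390965265856966944867428324106764150798570739470998415964549087627879750326191669099436869931108888021022),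
(739, 232, 38474408067178690489778032385615760826479015727966496393672277691899931719263320135146764740647613794879812308823868516878829295912850722648992271859354255246472262117510856863477481507290649400772856276359220106582988978231417142428141692961660767353331215737568077948552980631744983359774954586248134403508764143212660131527723168632861),
(1995, 3697, 35946015512134963836790546309453448616550188820680956668970908487873383191710732506077058210937975416764884323239729074364996634061402038396741421711561385791613774781776490623721724351595942209227142090373600413632247925992125430866073559348178549904473169141494579389511656869772662404949902416314035650941937682267168664304191445810824851284998398399815457847088329597990),
(646, 1370, 211490601150727636674160599151660252443722260279833655408183826674447912143330656459189505650415175130433316901275480122283223497423445369965841352728455493533151004054185296453076961378195435860447886103867143351379701287106350211535120980987043258277633358616049807294766011231358042615901355686000322163930187874755747441989479375894),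
(2173, 3316, 30144734413370994490158301260953002948936836385708604885505635660937897484139855847963982157146608999383769143997005266852779155982600872450108058813463871431257005249298705043350593314396777934404995137154693133592215256885375968913261289090006295014562651279176222936109178132903375453708091643823381876892886469881926342087701),
(1133, 873, 31493845340623014200030979594902812946316432427435378446464707511979889612248238676654565803105474591742124878343169634550990446035325444425299662085397772111444421338186060256847939680718075893962664178419595420291690008884234738038336784599395575490992810595289517376909405350055654974754215274259854040174646146949634933491093931432997),
(1871, 701, 390054610249809415498157115158054039915293274933974873792716957585056441351353573322344902236041447756336990828200410914336996219715587263561780513016523954199031457326893630690758848311743529985567236237294621460615284164096955851473525900363161497896013944406999956626764327027158441202477557068264527021535718631587)]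
def D4 : List (ℕ × ℕ × ℕ) := [
(3353, 3327, 7400038574609742387365953243972867829600360918321041715931389378698866251128677363844155065793020369460229348430261438226011879953102502439237903890458316197013668366706288042273354817453687610260516535689811089939342864934748249783845850742586905142675912613446743837013849301613801647077257721294750962649935866265511289760335204388),
(1881, 2003, 996882680146899321967804284771317973504283858661269437057972547774272475904007019562389580979363602455526374898356868764200292188955668921095803852574640681825214872460445267475738575933517650961031791445903853202844359317447363434017474757792808622882408580074319889299953777467040355098625598945686208085003395),
(726, 3364, 68874155706303476359225372966176577953478279460745562368450078076405864980041648705237761248679192018400798642255805559613804504804800653623772737988826289106246849033254101109369098687204502163088329449269845263557853810542198624015251662212936710410620318567895178929771225386541884856862599040022204283852171295970764693913805845),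
(3433, 3978, 15695261290264062453762867970712315124631647334451835218100987088560745013754682683382701352653899826997404624097019453323822365809044697350920993158064498347289709589286413694825957293149947432054849562269237162226564542601915417090773645706339393883477692868772311269385897900412210763232002864),
(2799, 2056, 138935170891278051393348977428713915273742523043667894217345626782236656217543803387145386164144795959776219079655855786121965986821603893306924884540434495491618650129170580403225962118453526159667833902981052911837530043531266388519952111498239253619482066186590788729837764742181750319162708604442360746871827),
(1365, 1302, 389100334319823541395573817167130454735693573721523981806323050256772451577150660085218833085699103142327035888946041132128349687418723075028799818032962841548959733304972143564415388268620155803673433923537129390474341031162213756216143320422612392869789688698192359679889308529492035368881573797782481084131217062948),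
(1154, 256, 45505111965207986506563139890336821194665286087247271413824422237648294413258142245047237154639865676949259222307173046049829873495823133769715943205501774352798593783003397398172997758542923521370479054181024164883432392748441093567170889780),
(1744, 2142, 1097655353023085763145936987279791032070910726412966455218651108424756222919873485408522465556264633233128067639396922709572812169171842351869235020595318646225286938905121024544602445871031716919170311252675488131774647413060941222813386334377943579445180405329646673521486016812732893131907185077028942963249473532563056037610317187990620),
(1062, 1653, 82681619481942429016537872226747101269899802901004931184096541977097226759110000114960836062057947210987674820833353236119453553249505273149017256938682565527585555161316772482320582203286543603596270523400196327525914631909217722180206509566345123969656163042268463850615645351855349072714197491528179584297003364545338389),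
(493, 1967, 28396570497596615904505727506226494469951077303466746311339471477747254048056797500888489556910638580331830602870202848139138056766798157311597126642926257895968239222029305802342568504664561888762265061749451253841672911548590911347611670000511347592367476331475214979873650515810309496551798881159012517690390)]
def D5 : List (ℕ × ℕ × ℕ) := [
(515, 3934, 572001806929640241459595495379854148233066332012885515149188800195747600374313296441885919830785964077624567661982540362272276777145896514961929821877427069384414026195378472251823517775002990399254579443019665897483455027469444684547411739548735129544240451085827875430366437726832594940637506029295081019769763743573414428509838590910135872782533816036179989548),
(3239, 3604, 1882182087084925353734542995092935858412867738584019604339207523490385454150162427799556448134582017903229503615160205943543671584972506980553235303668336274062992214772531697278747241485524234654242548627987632132994586177331353645348827732816560222798311717621869355171532656576222798339879099258574442886347549669099253146258453),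
(3457, 2127, 1144432845149526548082264852864374113477082172923745600747567826600085666930588483189283199109117607533671401111054900314271770244736526790861049284760752112049631408582901140149771395495498646504980835059628743935696199760711302931168743478141738654431311694648108610148289613771853401102413698120441534915832531370319902),
(2987, 3160, 1924369650093320010854852878051144680045441982741920923197639815588063176188972531750181846143899673094171089224981062360594288486328419380873692948469359956040957816565092728237800878045640386111785234206681737315923628285665362905529844169834682785777353697074244475002787515421282336426751880417554051105947163820268601171031266),
(3090, 1454, 101396390837674842833077991502880996223701605975417359810036490568857818100567916884634756638314713803603504734806378995509987245676209199866203832635237642071830344956409713666497422060083781282399431813289771395139480138397995866148367385043336070138558371457672546445672301944607778656302719302910430126549326892),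
(1448, 4067, 3684700843386729813801608703406561389467570500247091825908069899460871078906276369287851957166985360886669245988914608718483644950769580447153972887458742097135924794525531647029749911638311582491895636436676648348139690302975327695148394641755431361767135243498859870444340755006733228421630530873902083999194092654689676324),
(1990, 766, 41462094386169704044606579426696165900236893545759777725462056561289389899552104256117269229992102304016875621581264471209497105613698415773788968888428526241262624309449302378172179082949826951007761452321284035045084979247520476391350781440940795269473532015878315973626033683251599902088500696983277185137764807921382467323419500440981314887717),
(3839, 1808, 505776111486951850179900455953773727800619742788444514701848039721503515637757475115396343274979246962637054316855489428953213882290725562331708604584779565041652676567668368373785278497356834528519260525450227527717232387371200876791353662393524884400909328933180709312209229618746560996975420166494884606910418634146780257805076809781),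
(981, 740, 1652289674631678223971112044141806958436124380601632368134730575552104013050763422223449207331561827565324878175291075546590255220427631356926770613993771380022733661261664932751901795039039155697831166549647179748090027319166612851963092811819177539440966495096902922640117416356648740752671847895757987),
(1456, 2439, 6767913778892485179534297478467117914611517698140600450853755576228109515964402035993050715774230670468788911145622221519704464332035437603396299988520893621479390738093131271420990921472882635245874673892274004420503214076832031825158562554196896681862026249285555925248904498780178122670401786713458307912033181254215538709)]
def D6 : List (ℕ × ℕ × ℕ) := [
(2495, 3964, 1178101205822051974197567893423600188871436068765154446570859891670827969740716310209061581605229437498775644326545507193980487966526965178568349095197162724024548087254088853361854290009322138572783133296738478327130368365235666073035112431317883390249780018762524993767839923243429481707839965417719049964376666421333153882271773),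
(1087, 2639, 137170527561293951447557941243703853484492626572005709843428778686674830055765401110387593163358592551608979683002266157659011492997162278923306693923625258474514299106541543540727101352339481544257618218698906932641298126618193040220498699985738324401050697797413670396932144696689833147191557320843974174667667850329001636714846261),
(1233, 3149, 792199514268527045842572157612120919722638860809150363247116775276351589237686526937864517443753311067906918299807511172167560232932533615405802291403463286927663401946832852845360827586722093707271649839749979255048410135290962886053504604306532944533208856131602227689511919936571987903087429477505603907712145623101516),
(550, 3907, 552252226748930692325779148014644913522461443103218432376917385287943670872785047304276112646795413223102071293780837099796974674134615515375340936622083821460826411616952034191533480800140680105128175068065458596618323779283508640494857050530879452769654168179043049277509185270166728861511798836360452063681936151421310244074),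
(596, 986, 32673005235441726828575037729341030485198302531344520288830621286461752544107773004271163918062194714810531034169550565111386174772766670466210136583972577790387396918381047338985334623579869064132992426723919284913000817773981606587532811378379883226658488472149054637578584188190348515426076995823101906452881529573579314312222),
(2408, 2276, 114061429730665477295361748690526462806561542474602481816121608708807883168880277846843899517461551104908965966081035429641811448837221383360189802415032410648567942546576228239296313089105937905408764628723901790265732194184303262281977359592335122892505665010919449746101572505080623165276597014415364829131907029064455648613087301870949397),
(891, 2502, 128139769140904941633030961556543373061578862591364444162782949863269409643328240360895152517850382818273220685088104137582768730536227153716132383906121325765903558631438900789328926180785783533396953110554828790292259829129971316394304230217994487059607410166001729669995873863339773999975905308322894290980455445),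
(3631, 1475, 1347570787822732017914990098694122471325179099086385755852746978663546724900758629729745365520075919238437589495284843308007587146984846985890404856786090673929041751745587741167566437523442153196357120949774725517745106620381744642345341630007447471694268845261138484390162366069082065992053072658598267207962645),
(1098, 1972, 6768913879617477240326709290747272969127466005065354009438347381740892136762158792524290747770874762990088384273976393426407071655417666913758800608064847145892353031552973824019169442914077784255850663228044756209729652055467667646901436706210331649451056808362596404001533101660681051175788995202733375472691595052632984637),
(3894, 353, 9485647625193642201117658216914646774657476794959401967068354830404411182313695318044340688007338405042476051757687113498676101390159434056360971044285341318901154122721620197272160905605558119034109869578429735133426861048044547267839604658898741331850179093843333635181694065672760771035476739705372077222726122726805131996119045142)]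
def D7 : List (ℕ × ℕ × ℕ) := [
(1120, 2026, 521416919210776128203038586571014706346751163215837408468460552018737610416694244059726984407266144706310551874706577941191750151582171362403512265182624331843464913896232730934292848035705937635340840692148677493405005212599217430732877391404962671837312621373342984179704378885260744479762882238281176637841775280885090733903055445020),
(2870, 1856, 76397144774819157156806997828663258719094109060453041611369538948013224331040688170151870063277102995719714930022484441947269719841494508323140523942910414099499278176982353147287491858147791310645266816949666925077409064195373420382909428376015165161387100303590082002162622734384723177446481179453005545964269010976768592),
(1713, 630, 6465486661752606389685854030846551695133980619266367322450533074834207973207965295994999142371943781346604501132792171049936968988563920855659165897456443931195964469459602427806400119346680821797096115203125546041433641616209461502156057198885455125240764731977089981304575190845937535696807032007288812281571518557),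
(1668, 1661, 25108428746440454357559719160793330436938817591380301538499057592837007684071069958931821141608149662910671518427620594116186231362507122910448491188386272626239412082778896633167833784046652327236201846447554748146138408962034542146469134501363049201908180704064266191518355517212965500923424765759525068405753234969309039164998923840498022037541),
(3110, 749, 522957059953826674301758364409009293532731702022487067269227066344038635603900985540474156784729836810745537837040354406089538265600104068886336024364634708112897606822920174784631798436150393579507714707265836647928067513670741368502910635203175569260217831435265716708106473286634820626230112028791779621758559862821),
(1103, 3181, 339017952617233605206686081559650947791355592327631154416502658740026656994992289973076089615391828043023663291560692843707858562319633271389425475870651863060356391314960764824159375043686639856009729524690275258560911252544484914300515633592309573050503715728516378260555670977556179748547335043489398851612),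
(2071, 2472, 464542131709642444406880421485265034601244592006567650914274639069440516527474915741864533074362264461042543520627922311260772601148198714938996037160174704276381570617928486080308451789401006949370715279697866474202100095997513842378974606931640182868253271148427246054241389842582701795572457956140996050794592612412),
(296, 3180, 2362690533831843260203190750100987317584820612318171533951291511379146061354244595941727739117033738547668275133445054319353328662496110352192333268447642439119912292801250434180087546623226786945050410518061526855622395665608742593771656867638391530250511025143000739601872307508284569867387926641211099018375076113773522533993731365345317),
(1948, 2177, 1433854530308788534022042415016467771669088101506263805611436717227265788612914075523217197571001099155061418019419400202863129765261587515352931246629588380340076124573567856144412524940159277159758711580051300244811309508670532385721121576037812702026250858799535958304988507270591717099398189315602754876948556),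
(1865, 1235, 398567560117862559207058737812845974655109602337287249399630908527124670758511232935585923575306110263214643399380091068001262493891159080719406096916702164024408016963292649018286662852534898380591888218667176148801086717476502617097409729648512985307367162548024810458933229440130416225149941954457766682653)]
def D8 : List (ℕ × ℕ × ℕ) := [
(1671, 1391, 14128942803403197619054228901041916750306705387592627548591980793577081860565018787117427696066454081977740761817255388894487564001990025902298567507910150910984568771068308191923009273710277678584702843012381308875970382886295294550647705618681756064197270720065699806675889702962306420801228416602107951467546),
(489, 371, 428040453575465610418356924898107453464113480830014047456524121013142744146585415850132574191743780986590621272435283967723577401029160577897758950152283769996952811789306842616180655911143524626819217713388253478595285979916637801274713173783271554687729532387336663418061930362864568484759607589799576232988),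
(3863, 3135, 38625617838611047072777168845344301064513256038194613618762151478621076495394827792739766345054913678757899551975370261665316061192746122801861778880439432219329268292974165222508504582505393471070804776978902143227605471677638087667193209702155801873700374292202908662515865553637168784626656156139416245586944880961611007713390051604515),
(1927, 2539, 7166490279902035563256560778909285204953939057529900453097066547830778791400971213978241141230347165556562941836481236388252817998327551532863703109481737671172767171826046179472004396685345795343653954624894261248962580845606506862505036157143462482763239344066943585884876685351960699466962252955057050731813902988024495141),
(1279, 1923, 8156730406858259266935747730931394205900835150503898780336644267923021148045152688687424773791387185420054864739556185316419895338514632431326742711996956495044100110732279851481428188557017083823317384607886992401940697241767394000153393101112650773062557281512877726870835391583229265638756798658187049168313477112359687908316941334),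
(1823, 3510, 4815368301095356669683852836935678859441104888000109093850677817764930033615076307293133081796369838189432465549059304593631460039732395716314608723825887951793780609466561341383202085264320454946109132089298710308025627919945389931910284339835736311088420717662458920568064865592526343416261105371983976591839614675910501916603072581),
(2061, 112, 2046764497223999756263890692917132355182035501467650456558955664350230631620658910304888324027983407626744715189515999983755420757012798396692489317949152543294835097564498327584322364387529031062414193191103435312937960636199181442216558576700535020772550657001124533969615889783627897906069521091355619225921243239981261588719774656363993802091612),
(2523, 1433, 147226090116749977091123240664191959935322100555944842282737844304224578424230023577325917209824476046560888170619492581239999609548212388947696868030219389439967744361747035978005797966430087231953902116164123263042832351595921806114006218779836425268108921829215705356607128051132046225161381900552286550403559235142342329392216186068074832),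
(204, 820, 140444661569749078933451403750850276350900777569361284341107828332510600295704927373117344012258637819013984936391005293668466884858575712855412894902540000915916573887522855896341616743483143767180908006503616230244754825644282060140656118185486731574996504414240945703656437263842613233979340142113102004381322088960140402833637195269876781),
(1266, 1380, 6714751641976245406728984055523280950374798112612063513671286347542327408684492956131263924538704476005116324956266562151420301991219236825325649758441948067321571564586910296662737767455180070761288650678957750010574456423397928374484109438718744374883926149698023979617952789617584950611908883803628335432264811186637455411)]
def D9 : List (ℕ × ℕ × ℕ) := [
(2054, 2718, 126767690012275368597073456878999487474787535938003548153555746703357115538749924074906650852650415008535714240481001905021325149065054533416367859207327087919569766272902256916648179706260182629741548821413335041144031617045318482641923802479179126589386623481774600012845222472228871488250387459662259387598195744268769586920504358),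
(3644, 2136, 3984541293985520255495054080332066308740050898848422672231756389419568999465724131881186629274319807941666209442658559540504354367682771351598657608811361211479602864298912041866762595713526867303130470474151756777824156694377056838212818528584491413420719580369442004981315484700),
(3540, 1412, 157253778337200391028500697278455674134215063142567876089834145388869016111711173066179217275084030598126982946968264965247707755163924309761129423241675144364629818288740845206996400052575566108729914074650424261580235968298189895923088106443767619158542128365076666835419309180811087110828808959792410419777939103981475696807298874861898288159689547901635614),
(2286, 3834, 89382755943794492589544619599978671477364428890336746446004771929175648728195288082633185505002764235367520203216642420701361155566444390826218745200011150920757078491722998436590234082648270615421699409102661214853267854328075578437778787245448335209531420721828329405827798616437702131993400571899218929850816563),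
(3960, 1487, 9159370948270627046113280507197568561524691776960662089753421155782675459249087129518342250162559233479240986818015796529974476124329075271954937467795647531040752636490389584845453063200392134412598387181704663176989309060092914472269355795068804622407500594781017828108023687336588022919327332553276588101219353985916878889750801820926939163),
(1171, 87, 802962136220715304386580115488533013954766385822921172325128927732564214654509236430364289123852826084354430865480419715449351047510385481606901979907622624719223048173122156713987334918591431360046140449518620321767842020505668655262341874107314884212488107752663058602704010381692400151084141717778666708151350902738086768106754294131387190351933),
(2500, 971, 2254076202231498378120590489217788786307997599069615690812082895536008950863968332115216382764369355706735563512775598545265919355852801278660119979926289219705472962912195659144942490374489769609030941185729580683994051396669310305484392165135819102318607228941484109017900063834557845872295774932040689420355992457906134480312496657473589),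
(3694, 713, 699189855853433025795064245074630637322695117268613333813311153208425302034881246005014998530282046637221515831610201620235873098380866544978876887954393343458714214507772452248540667704715501367351760768193820522253096709545956469436818160550910194673179559357756760200868444048568590194891102896604852401355562256070684190216324731705820028361988905004),
(3658, 3015, 124428920419025002528625899809910872395008661050765066283579518473756597208641945224521322654921468504604957275582759945997248928814304927965494431485023398526143883791874409691189221102209796205612163902141578139580671690667360656330213445659002531725843594352024257486528955480215553360588903053347641299718069185680052262),
(3068, 1406, 522106335824321442868868610918791717391014823414241941921578604864390953152375636925489045624319826509386967163186527929471790529978125431936451841382000685688236199823278203391757318964517197496519720991561461125875542608280938605099128937286590071208893383956633146129580259897320936319974270544984248920821470411224807588675114451280)]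
def D10 : List (ℕ × ℕ × ℕ) := [
(2525, 2910, 283701978972547580548601950350968213554411542688207396074279105609374071477914055772095322940059419167287861664657725855068208872569483137688572719339386727664649376397176909306829363152991011587878955924885052879479506488413271048924768796200719559253066136364956468310050739605791473099996796430896921130037),
(2898, 3646, 133337582087357545463720094954388810914347224667866479256451782960536030535956521423174222967940372487411271964480543341030469473221749865037155139317641364678410062704025990985555079249952968499611973042899832335547183118229541025275081822025054387483730358965311502280938022072724005994562902310351841711238198894677126690600281157),
(578, 2390, 120971441753602606684964210166753708075873842809962940147398668355839887834651421575356301391397839907866679852696316143124443759541151179449376017278072585312300396172757132698244776916176831678087799930727370207303796736358609786871985023237338523529755023855260201842320979317724856158405635089050966533465507181323125891),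
(1703, 2921, 6822640517750849567567691394609371021591223269243370140827021640289617801437070005038856139242825120493692151984117999232453986336774469096975298156584095290214341048926696740760036204458421296734361897635857678412489867233552608272849798432310698332870945602718141602891662403689124343339159548777649265419873120916636511452714249262),
(3190, 2480, 2053336971945786177888799458203310616032244581828652726287540276628238485781042628276891233137816672245763680246914550744767387755546200724871707208585307333013635092335113104856298967340495539973480556352294022738469305229168279442048607504679516519684953615052859492437420904821894392814766417394089274578695540937471020),
(347, 939, 1616876573373866609361470276512026965005465658830339204175338523581886320184359508269868804396784973716020085135730981859495367837088012926047210280974917012713750855756459412136624782814856212920201435704346518447601181031011203503722580252967271008578149773736890203370406475391348136743821395),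
(2021, 3541, 8580947739494871309560187638975592290601717415375491460379325215327355194885115305617823537217855773889509383268318503961635314443497251258882900255935842123353374198409138083280268689427656763406697147289107231866357179354775560623964718031594544693368286695318926954744968371039679177552031676072407664827082732497680027676),
(2962, 3732, 1750254153606822761191231162573553771109904598695008216521808400751494441231148996547242120354080173725703303691977293346010664081501881590165716805686903529896934272377978961084333592753039975339575576676759504813714352036299304034976223294804332760544831396373778818596906531758611986084869031700126830343762973),
(396, 3168, 10392095528265238459603668931539568808692036832898864611073949908644477010026825242503797534973624013173443853403392993209174383311911479661872477237061679352509137385088130565130291965502580046225308931379014705627748772933710398340765931691638358375118572761590273097286646393647594409541999830778031147514120337188216907768406066405895220600134115350),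
(161, 3938, 19483323954910508790944879534431295173909219161027288534627819530562621270786387019246056270956423046749363343952568328574075255823145802743097584887906078490762115162786099151217877269216124625960590676485160169122509106308025630723118677762650403067377334970314526411490479746885313309341416961244578087915279419882342421)]
def D11 : List (ℕ × ℕ × ℕ) := [
(364, 1657, 38050249487037117584016083531345588591275878864960737346055118283257100259482357798106651993605904776750590871086278695636556360615651910428474849272512361510509769108582784616204458486233199619768961458747504281937266885465927885524527737359098518768249803850822369420401166702686458026842772366754933351585746379336586278),
(73, 512, 2621570667058574986290613832711481812136818883627824993109650776185352764984176768944425292554335059629316844040421727239726680170),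
(40, 21, 28880540781665779456903444614038379088202891649411328928065297200416456686134239337878556454610036367319847540423572996713575300361712549248253124902325461603636034552217875839072912011314127810508755687363804677712735147722943188291322097899383981578835369580984011958113405167974983564839518227819584459729106278413173132485443342505006),
(650, 2188, 24244386405317675535041481104455921470328970585050075575199989316452910396287378898743342237225741841022971300390986450311264657106401764903819944839493234987033841486844071335205094664622886871570532515545198318719608885724584437512036161117832020123478077227204119871248914076811226818361216544616860511357090482357714399220932848397404),
(3905, 920, 162439666195657062383032641021273351816311317364071935086366083248547932494246686358830539801189103797004892304729024370124324515311928576608906896788294901185891885073345162600324602511603455985363735811657063812641223908057721969815426863306309871671897468462902880757905252947518814119969561720408534969458263141116765628099275822347806556964064277),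
(2317, 931, 133664191461323838854157032648504492091748780877879245696583956775155541801543183427740371402589841634387841379165907996728109638922689660765114750162763904469950402711991363631440598434964987925719705866174628411949144077383616956124044899211908483610625381995285987426173985382206123873122933109045805976830061599226774251152877409538946166186738016),
(3277, 2199, 2050288709561531760165424357840153963062876555468475205412732842385237213931662290679744136641849165468473447779198159445632988135065556930219647710074477714977630970262706373464218301559733966015674285873272008722501742574549393666240583545288728764086287962509329334788899825613278177427517994865707130933834284428433469),
(2244, 3495, 321002574101808547876607938191578972983744932239242012509197992204286782010885080448811702485415713740932597738246932979586659473191276369099712039397032726037984079876243263303161306952271681958425229509266639730045419534835176416580353791391217028236914189979972787675948340868301257793797763347889934301436329686864382640051794485301),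
(1142, 905, 497715963194642559464554631769778786518844948902617305068270794024399759903581048375756271500385694367022283323647429850722337749519953311556695504599238939068405296152553883131985201478057154623059743211243446523812876327204381542165863382983281011216371851763457289691429433337936166484835525729349289566167889281741273375797),
(1273, 2446, 35769365233167938384713429905814548079379917984676243890011140648944425444669141531874081213287646982356922043821122754704608874522270612390326653209189467166573390723880667311841040784159815581039435533977297555560805788962910693947542811935172696255294645331016299180200384382159729475040647581023638618990999128486288629333199501244523501587478)]
def D12 : List (ℕ × ℕ × ℕ) := [
(3201, 2710, 91817604172209984375957752180119430042902013156238772167463476366959000041734696780239349250864775728578200888308484938779892199546992295964525263026215958720501907380793398433475422018659503355152562099137176856544162323184603284751138663849733819886295404655030483585465251328383810269662851115642554515),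
(3773, 3354, 36778608596909290861709950453266304857003274834138210414749837851319918694005691332464881152713062966088886056786728021584222806703453618402564750225844019632606931692055258339426029907747814567933469163977558878906614943422747127382889664344569754027023834779833447531516638835891089646983574217863129033050769535216560807911405119230021),
(1050, 1719, 113619156508598383319050544962664048895509534755601023231360969364458819510508879826960974370635642126617309621043843721006940240403949678285889586881431203699078029691807677857393190029610128335254127049737613180984167671274828105029038900798104044428897793763966650059316502745709361339401510729519013795685603536823703327440002149),
(2594, 2247, 575927994781373711925669171550353113548855413434599295233882845509226199815678185839755918320226267601414502073515641254533560132143889053837112732299949247103932619482107610046977546577217563411110350321598935063511679419318067879647414699250532211323174104545736631662513664092904243145399574302155637568589616392661341551111142967317),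
(3882, 2569, 8374643408952996950631534242303784018327778541815481559940352139929259336597283538936206161001950187484680141166694264141211399809595779635848159443948681108365559340966865166663532745452842928774475683737734095993559762019127730948781677652870812910221959472209116617880658303857743554277074456303905059489373160382514018325),
(1805, 1451, 92069900294971371798930706509925005275528256211650574236008987939090985678028394299856545846780603612960638869318096911628042302315512432269653817673792263691712662853064709314536590826980233892118105473329566444086474974523229061812822081169457792917685217369447706263576838081560377456668318150923028817252411579628987468),
(2774, 3562, 16284225578457966252965581451636143555936653891796600480640751926661235287145928729744109485367743221062979655431050811107396104672886838616748613779943979188961317912687569015720156801861505295693479681828887470233010650433170708188848751036288713196302986890102242273098478754237498),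
(2251, 1793, 603974842075800427591768731798200165155939614914383031922884598456438070211546968899798930062340004445567775160382325960305023037460630270995843184901923100520006944237993593970911860527519842622081511648454140622450921660568209323006771986170779602649172541303145485306458266349345157159538905936600898411167108411430668423071291373528824366188),
(395, 2249, 477266307189023141664376006413918275813153051059515300368734247824853713027206132367708625073759267000578830781086282128809799125231375748515313778715099017793827741549758144525049512898074420318624477906950700417105611101503745008886527416964427885147371280021040618798353096392439590539313636763737946553352142842772037854375922177053),
(780, 926, 6556780213992772232153944260298440389006550618336859557248159129600952875606642953191436947321570285608136085621025281419554449313497769176613554238379999388654853628492950652893581006562618432164980734992489638100959861787334933600625579975212005173065147337549558240480047504345698633618998499721267567901143750006880417821)]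
def D13 : List (ℕ × ℕ × ℕ) := [
(834, 82, 238248043292542481934892728606563588937230410577957007476697231420502432560510735119753057505675619141681556884875913217254834029273525383995763881997413458268523208432645722075460752561401590075142163381227645757526468887424834765638197191146945848019938332100985504159263616659963198374943075620212235898910),
(945, 450, 5907852099285375469236375511828571082238286049109610296784231390447309731606013431742066311527273528731206515619804888006564727247988578974173398440999011552733784476351387603662477705724869613258057134069485732214668655408585012304626045193806214727928040136270153673598184775306542993586782653758128305899046555270491613221),
(323, 1846, 2363789342949493818329595066158817116067207670178510619444067301821390883046988485230888158349414658121076302376945561149470762028207079762728384362435602092467856202598150060236438324999746362399411055110797693832515719070319664027853154857964334081537239408395512919021238890287915280606531638487492739789938279344154439897363836974600229),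
(2460, 1054, 519202079972842087791878429553209312339828879998362927405448108092230173119744540169661555708688744014352639959102818462701635754916100335374758390289030914351671516001305987032061479703490737278410151850885560925456595876059364773712482934385310303352166751325984301329383688777907306163154060570262285963897253442011191598133411726435),
(2842, 2023, 4471242283800670987246885436471136836653833949074200273856146628459058148140054726267691254581023335189299230218514718602478468440109956265729224674255819805198928066222092418756408825860889322755588115732533192140539958039919868059895632398981732607036019068167455161580850346899064540332619336810),
(2351, 11, 113659962952783042245666021838446954101414015275865199538821824212333157405711182256059674174268058500909007266245187737206353279681901626663439582327919866286952888530363359891205500076227857083277568896291864143204565421415656545769165209096764730076499401527637381533220108221722611706666774226482165954526615588437047765604593534550288405),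
(741, 1210, 136571059760938740042856705728835048277001550906343214445101237307931372156081900928558034565823056875414193726680049478650767894783194891767871820198565895591354124611650917557418711418311449186432566323350574547259172508882239982377425016492323532328364158882077275390683872197159568093000149797491170626797748752280162573570646941081381296420968908511589406),
(3157, 3993, 8817791978613740818950095104749868184349998837770129251169702469116154914632200780762237853186111277010258194781687903252016534212934591221528454254704879783600211194685038801347622908466676543497486147216622763027252752865465138655115918910518805956256558506357209841093769322898164106686838242060796669549692447657583531132),
(1078, 885, 25473174973727240939299426503523722200998628608776880150102271259148361052412044907138951160455712396854417996140823927122893865605266366917089978881392877723228113351706182875585804573373724616654832118611296167160710129782935028611260476365836312570015069465973817520943499759728509869029782301268290719582238),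
(1468, 4059, 96315380245062717807005433421587520428292768434176026109476771493901388575679989698930196575486690632994780911331595960297904211282878108659174260570778328579673697889114802621899767165181932211948491400395082126913190208951792003504102457136488487798381862430040184900544589985412353841106567651266772314405739425097615730001132652)]
def D14 : List (ℕ × ℕ × ℕ) := [
(3923, 86, 3880716927461775255436391641649213311230520786771079564391483882698914156761907450960980609317175333721990651028504613595464035408136836702587123697385919608435330826393908146637317285270743394645614751679028671031648386127224002789322164805769878970309145358357338858896352231338253573851284943003955812302949189285865988140),
(3030, 867, 476192369024139130708245033870550288620638142370205885920595798362444299323963428524501596970925496570649085849864804742031637845342251812106858145434286903955693486056664336223248835584646852735404710588501183838133833714345342356583945906035428227376732168234644678325309472979583896386421351886449635168889316850254029041060485206046),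
(3549, 1711, 568854630581633674817542347782029988175187280187613750573584995342085255978694813508492191710400887796828331561532085864260617715635655237059495454774249596854115985097516441302953806123523934674020755349909439751694426482081481861882982821139563311440348065076791617726146502283069405161315203640389197298478791785548880449216310267074367895859692923933),
(2435, 1792, 2003838252865077761311913820659818057266063942369482039655821643718762220700914214868393065288807260447903535893404225297383061115867751971300958598782665094173620558937938971412987375492821384744021840267052429169396562289751239091320565175922483782352088501738557945400721288115227560043222560988495617435938246770248781),
(4080, 2145, 94992462142120901223677195956588432987009818126521354537545554205082854346623370337737154203604718243618166685507059861562993074056019720358575019447334464866901684952661983567914756133839499062177148646409295932311410059547191119778734860421937496165003649674191626002003207662608289814519956372321734740996798517),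
(3120, 4064, 1500153107085443510678597365744842067241444630037877324160840478337505636897840108195556565536903119903455139991762117354440781193240069063118057234129645705675574913105213014851525737795314114404168015185448702565601022133610204858378594275244396264066492717483460318977249984294601463154865911548300823692854033722556691255113232055352349),
(433, 1964, 74235982384903771573216160357059051123871738644391178256572254699803028181274280490969738029897956236670778841004284756051563388426643246569860219354049309547972767192303686603981118437046481888839300336945265578391745712935080516625697797295560849007098059620073767537042797219123689120260171450983982108),
(2971, 647, 121126906312055942387542828978224601440769152105812885888213550036825200216075152596400243079274359938576648486370173527454697074086515977802722118783171120891218124078242714085606045015514202711466663171271358652872809271675958542836580674081549073942815905903394452696321025712503644575918051422350630518129031075668690965),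
(2511, 1561, 438027300275117488701254949789325028641506724694748704917916550357353011906376444969422730872199030200191243901436468266482295319435421681084958080804460568809493790841380962981615482240105586114522748654324348564967302889630447223421514802834246318728647642477491730258369553776441685753516660172885259364409676486961498597797519301738392266781),
(2441, 3920, 79759073534945915951901147322581748869502080141642115473669588285897953168824705449318875052963859576897426575871596742184824589626440660364705967817683131640525536088334802999061154560161093854598244131585666271618022048253303000890544408715498761263973921086893198433964719770286458592099016624724425438841399385238827171)]
def D15 : List (ℕ × ℕ × ℕ) := [
(850, 2215, 168939731431096223091429003893878644022466158993628947052912736700725727887357002392127736116744718419960121085450329777237338495830055977943384724678353994754158536352696452887947057930080853125248205746465296857417871566418157736425544041521688570201952411938697598582637972840068942719046229743145118087341808172459154882416359846776758271758425576219983895591082044),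
(2016, 553, 242644399798334192860755597453400059590521167744796128177438520798389190662482583753200050205326313951376890249854532455012034442524493960291827048378791962633151316716218623119249549539909584526605455420679506105357303432067389502368792837145643538052371911979130110277349156437364998459087861301780623015084850154526),
(3523, 244, 130964238641499765211211536422202982931817112719658893421120122307307368110712134206650449282928569843342078709718118706706804448323718612321898206042787718554216685423845667131019781898141780256602642382944656253675522805247275905605035481532827976121667913937720577618490184846456417729932489333779970400304122235380127813),
(1284, 3668, 39686514265369368553235000422042491586947592884381880309945783260789717915126645791417491855599483902439637504381793573949190395357566143708228216793770045882076370739907747691461183929174110019443202458882975722197779218641056403786739827630110311266278024997893262253153329674279713490797022615119186811714917979950922803580143223142458240354419),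
(2771, 600, 28405321708793864073792811719613254436549661465497215987585524494594397989701384532218897903982378941087385912510957782083262680067866296763627148011182194882830231236808058523359940458850982463104075038575985635148280757882783478367276527382515793208286855119262328120536672919871210488087478082907037272843292),
(3738, 1477, 1649611232471734835223459088321696603578714466069993185043551229821409722752926207436222607100960818132516346726433483604751284124474822536278857872371845299517466710927769193557988331314680314540805956122925902205151650816569008786250158279149741658284495928913958507035584998293552550063109592546749507),
(3171, 1093, 529787159136011373519676932283307189357186589780937972139163088711992255324502215802741022464215885540455234207754139962253222467022498419855256153167932570583440634231184446875258547822301640428965985765087382721129432932845574500350850139337204417618449578007835542613823169111546486808270473719585903388128099398767377192090418675849466424364),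
(859, 2100, 3884792084870411130167096543083737044560119408632083447019628066366245233948573003649703101344582934691022383287014241873225049037049632721849194946042802959929712377905281404176283139001631433679474034423316613621117103627761897350124348676225269592251856092709918450822493163039709392453777937418776222748),
(1223, 2546, 488440592654313924011153719836948495269733391598658126083582095338541329172102696691228934624522158908434259555076004295074636793358409585376397336364498081665628487085801381047293063212809647025750267216183147549694242906214240383952686885209520800657256948141487363329955498923175109458293850950377784109286615426094),
(452, 2284, 577274170445410435460412815112663075129391650584245261359739408780338781329319008070274589465691099981449808030751959448840887952122845956514203817050366351055223096810258015294766204914486566245514111229441388175615740545730237152743651616559998445940405736806505632540257649313063018934589994953858236726320554676850993778599610351968)]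
def D16 : List (ℕ × ℕ × ℕ) := [
(3020, 3204, 316927702047865203752008724112918683816000438708348032086921246692046331069483548896890779576088418157382705427421020972792689437871801712607628071426244910857931501601381396166002379967377220471928229906425911623210092400926705785893398606725589231001083767322551013816839988052645778837977749939878104818094837564601595880518233416561254358052),
(1326, 1776, 425263755112354902270347670106965060105447986741718496800334339252404343447257750686666620186261353047478218555969728609801643190284888804831175139316693611210906648023745511398821773575271006587782451746767212422486239621711926250586234220229171237519512529679792723680641173106285813998151375861535622592160809701421),
(2304, 146, 260648989450998383762805839655660369647835733686617536596265454785189418164677044432382359072130785722660831139897911787347332580515508155531220296109579215895429272670908156886369822028583426214538177854202503855920353324610752451093290307665127740095272073447476),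
(3034, 2196, 23238001853271733825550196913559598248440053262641758051321210678694302970413812531622399856060028616750642886964265860105285961297510376422050637472293029476600283658641345407765510441157863906380813319796042560154798157993515056772865982960212101900573248992225263862323318940210465448829525914431308310321174),
(2785, 3167, 5525185235775728942519379068994208463283975721795123296867263999883756028382988065831405157941233536842825528755991040966742901923952553197936856482950931925821670154235108739248670822120370297176964226464579697643025944997441169139845014403150187174979036293419180019706137223265661917859594797794494231097908596119428155475),
(1251, 1783, 435109824271232219462560451330001002489641477430423735494453648441256988685479357153423880000585426600746733556105841900191154621859545576096861280314554850587310508310757596975449905978516346939950846065178134732972996956810602489463682760473138405412764675507536669232725485141213982231625315172824747096778151355006500043176696893477),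
(1953, 1100, 19520118107351411527651984088514523344648189201204214441850090073470884364357399945233991007951885841653505519347782591920519737922404237751222085165809303827910348060427049439948540064976825068197714869504214728228774260092422097119478389776114350731512643263624734335429955721333513345103560547193588686001481509596307),
(1987, 3550, 158007293051294379457312972279785915531595954972513505249434490175257171938948975928449345608679332887219634313352135565435467806785734923743889678646223664314167085447567051122654416138562032917673603767305951600806500271533062720394498931298176640981694344040291997770085414193315806430110721739069215687701565484109),
(1681, 3095, 1673766530368843592184519312150879616642385838216278165388923658607312385258654425369501017258096399986413855212914595190229348066746431405562686577163350329180819418668837845715213729008728847240518913555759342521320815678504582315573243917185644997022860964799008947858823463743155958959192390886362926934854820495139388731245246950939676),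
(2418, 1963, 4832213965316922363446123132692933343209278117485674403728335198117610367952887169054874994152647059322629420877771023345494889623369760209934139551838222398008799422725980324384290627583632891464602034908064708607303191370680287809215944184385883004135236118641980021935641525834900023663580148201938749892505956428687080373521232924)]
def D17 : List (ℕ × ℕ × ℕ) := [
(2033, 2897, 3410843612246525754977024048435106614386423389640098253115087872837709227955745975722498947892907298596488771210340556479497055982874625481560921652377474849024164178570266015649692928535184167211632867646184778828641071794120961557095082739222294625632500046810295685538731480500306064836614075792460043315087554668),
(116, 1478, 1827489206947092563319205679640159807100792267486152000091601879867605924866179257848323100834327091080404206345177336129501665182568733017927901566895095954849371068514788039835357635248615326982478424682625256414633664424015117412733253149443210187490700399538470817685294282529664350023675865805938757334019618627952704878592336),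
(268, 4035, 95826000474211230130316386336898690048107268997237652918787486053003586530953330503819762157305291120401298392102606115821386511840423239626382404070010610428048794024370871955141720169340892763068033565421038917677726236499407106963444537322574002610950606028505171958706794847318238768550347333218835322314941648096610495978826892),
(554, 2037, 110424550475946690561404833380675237944283663739244281142965524547826906882463610788695794150744390165593986412257620564432319318135882066776437815334062799291727864150876647216207979623375840126022698025944566735422582263305786267271821219517195399640688566542570882275966364116500297050760524897154216085169709868843349447175113318192976933),
(2297, 2668, 92328194206520772369644471867108509321620979312392483944489268043424773484588926021114391221207990593901577346323623218116595100653374276751111546608054318072933005001242203575530211722777937915821023399106792880127177865717804860461369144182813265691166782150557034181907261127619549831108705195712241785254526995),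
(3058, 2238, 1563012137799781687154440563706370917349339269496316412832252714552586894656617566815559286299752219638138546370487527537759464241277575488944860113417055734510801377213406019967801752820499908211856711359243932583108619210586959070350779321752072416245642279765077784091744128406421934761139261),
(2970, 586, 325710925715013164388068748160104944621859886912714471495590647345622204023192785412505703999162129802231194946596856013777427608333865478191211588452897405893401354611981253620093973940211712107681407458038791603061859705857306889435777571839755560301256125335048280648502186274995855898653),
(2980, 3600, 1261190781731772220072850913404525734913976408437650506033537754467324227593122844156148757833612960747508413529342492919526073597535597208556485172338123868429660393019805970673513911965106506262803540554020653171845346344765990455409992221814924536437542042725298446143066817991431364758623107898656096),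
(577, 513, 888652108233065421014286950865955259860118300826424379037044152862864631951467687457446817732381111124103135074673726805757741162),
(64, 520, 2621568766522664603700142026976330851413985345793975862725555046343148517875721587553835685163283111682821821000767067201277773930)]
end DC

namespace DC
noncomputable def phi (bs : List ℕ) : ℕ → ℕ :=
  List.rec (fun _ => 0) (fun b _ ih n => bi (Nat.beq (Nat.land n 1) 0) (ih (Nat.shiftRight n 1))
    (Nat.xor b (ih (Nat.shiftRight n 1)))) bs

noncomputable def allB {α : Type} (f : α → Bool) (l : List α) : Bool :=
  List.rec true (fun x _ ih => bi (f x) ih false) l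
noncomputable def allN (f : ℕ → Bool) (n : ℕ) : Bool :=
  Nat.rec true (fun x ih => bi (f x) ih false) n
noncomputable def memB (x : ℕ) (l : List ℕ) : Bool :=
  List.rec false (fun y _ ih => bi (Nat.beq x y) true ih) l

/-- every rotation of `f` is in the span of the systematic basis `bs` -/
noncomputable def idealB (bs : List ℕ) (f d : ℕ) : Bool :=
  allN (fun k => Nat.beq (phi bs (Nat.land (rotN k f) (ones d))) (rotN k f)) 45

noncomputable def lows : List ℕ :=
  L3.flatMap (fun p => P15.map (fun q =>
    Nat.xor (Nat.xor (Nat.xor (Nat.xor e5 e9) p) (phi B15 q.1)) (muN 44 (phi B15 q.2))))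

/-- decode `k` positions from `w`, accumulating the mask and the product with `r` -/
noncomputable def witA (r s t k : ℕ) : ℕ → ℕ → ℕ → Bool :=
  Nat.rec (fun _ a c => bi (Nat.beq a 0) false
      (Nat.blt (Nat.add t (pc (bi (Nat.beq s 0) c (Nat.xor c M45)))) 16))
   (fun _ ih w a c => bi (Nat.blt (Nat.land w 63) 45)
     (ih (Nat.shiftRight w 6) (Nat.xor a (Nat.shiftLeft 1 (Nat.land w 63)))
      (Nat.xor c (rotN (Nat.land w 63) r))) false) k

noncomputable def witB (r s k w : ℕ) : Bool :=
  witA r s (Nat.add s (Nat.add (Nat.succ k) (Nat.land (Nat.succ k) 1))) k w 1 r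

noncomputable def wgo (b : ℕ) (l : List ℕ) : ℕ → Bool :=
  List.rec (fun _ => true) (fun x _ ih w =>
    bi (Nat.beq (Nat.land w 7) 0)
     (bi (memB (Nat.xor x b) goodR) (ih (Nat.shiftRight w 4)) false)
     (bi (witB (Nat.xor x b) (Nat.land (Nat.shiftRight w 3) 1) (Nat.sub (Nat.land w 7) 1) (Nat.shiftRight w 4))
       (ih (Nat.shiftRight w (Nat.add 4 (Nat.mul 6 (Nat.sub (Nat.land w 7) 1))))) false)) l

noncomputable def wchk (d : ℕ × ℕ × ℕ) : Bool :=
  bi (Nat.beq (mulN (phi B45 d.1) (phi B45 d.2.1)) f45)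
   (wgo (Nat.xor (phi B45 d.1) (muN 44 (phi B45 d.2.1))) lows d.2.2) false

/-- bitmap of the keys of `mu_2^k x`, `k < n` -/
noncomputable def orb (n : ℕ) : ℕ → ℕ → ℕ :=
  Nat.rec (fun _ acc => acc) (fun _ ih x acc =>
    ih (muN 2 x) (bi (Nat.beq (phi B45 (Nat.land x 4095)) x)
      (Nat.lor acc (Nat.shiftLeft 1 (Nat.land x 4095))) acc)) n

noncomputable def cov (l : List (ℕ × ℕ × ℕ)) : ℕ → ℕ :=
  List.rec (fun acc => acc) (fun d _ ih acc =>
    ih (orb 12 (phi B45 d.2.1) (orb 12 (phi B45 d.1) acc))) l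

def DD : List (ℕ × ℕ × ℕ) := D0 ++ (D1 ++ (D2 ++ (D3 ++ (D4 ++ (D5 ++ (D6 ++ (D7 ++ (D8 ++ (D9 ++ (D10 ++ (D11 ++ (D12 ++ (D13 ++ (D14 ++ (D15 ++ (D16 ++ D17))))))))))))))))

end DC

namespace DC
open AddMonoidAlgebra

abbrev A := AddMonoidAlgebra (ZMod 2) (ZMod 45)
noncomputable def X (k : ZMod 45) : A := AddMonoidAlgebra.single k 1
noncomputable def fromFn (f : ZMod 45 → ZMod 2) : A :=
  AddMonoidAlgebra.ofCoeff (Finsupp.equivFunOnFinite.symm f)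
@[simp] theorem coeff_fromFn (f : ZMod 45 → ZMod 2) (i : ZMod 45) : (fromFn f).coeff i = f i := rfl
theorem A_ext {x y : A} (h : ∀ i, x.coeff i = y.coeff i) : x = y :=
  AddMonoidAlgebra.coeff_injective (Finsupp.ext h)
theorem X_coeff (k i : ZMod 45) : (X k).coeff i = if k = i then 1 else 0 := by
  simp [X, Finsupp.single_apply]
theorem coeff_mulA (x y : A) (j : ZMod 45) : (x * y).coeff j = ∑ i, x.coeff i * y.coeff (j - i) := by
  rw [AddMonoidAlgebra.coeff_mul_apply_left, Finsupp.sum_fintype]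
  · refine Finset.sum_congr rfl fun i _ => ?_
    rw [show -i + j = j - i by ring]
  · simp
theorem X_mul_coeff (k j : ZMod 45) (x : A) : (X k * x).coeff j = x.coeff (j - k) := by
  rw [coeff_mulA]; simp [X_coeff]
theorem X_add (i j : ZMod 45) : X (i + j) = X i * X j := by
  apply A_ext; intro k; rw [X_mul_coeff, X_coeff, X_coeff]; congr 1; rw [eq_sub_iff_add_eq, add_comm]
theorem X_zero : X 0 = 1 := rfl
theorem eq_sum_X (x : A) : x = ∑ i, x.coeff i • X i := by
  apply A_ext; intro k
  simp [AddMonoidAlgebra.coeff_sum, X_coeff]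
theorem A_two (x : A) : x + x = 0 := by
  apply A_ext; intro i; simp [CharTwo.add_self_eq_zero]

noncomputable def mu (u : ZMod 45) : A →+* A :=
  AddMonoidAlgebra.mapDomainRingHom (ZMod 2) (AddMonoidHom.mulLeft u)
theorem mu_X (u i : ZMod 45) : mu u (X i) = X (u * i) := by
  simp [mu, X]
theorem z2 : ∀ c : ZMod 2, c = 0 ∨ c = 1 := by decide
theorem smul_eq (c : ZMod 2) (x : A) : c • x = if c = 1 then x else 0 := by
  rcases z2 c with rfl | rfl
  · simp
  · simp
theorem mu_smul (u : ZMod 45) (c : ZMod 2) (x : A) : mu u (c • x) = c • mu u x := by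
  rw [smul_eq, smul_eq]; split_ifs <;> simp
theorem mu_mu (u v : ZMod 45) (x : A) : mu u (mu v x) = mu (u * v) x := by
  rw [eq_sum_X x]; simp only [map_sum, mu_smul, mu_X, mul_assoc]
theorem mu_one (x : A) : mu 1 x = x := by
  rw [eq_sum_X x]; simp only [map_sum, mu_smul, mu_X, one_mul]
theorem mu_coeff (u v : ZMod 45) (h : u * v = 1) (x : A) (i : ZMod 45) :
    (mu u x).coeff i = x.coeff (v * i) := by
  conv_lhs => rw [eq_sum_X x]
  simp only [map_sum, mu_smul, mu_X, AddMonoidAlgebra.coeff_sum, Finsupp.finsetSum_apply,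
    AddMonoidAlgebra.coeff_smul, Finsupp.smul_apply, X_coeff]
  rw [Finset.sum_eq_single (v * i)]
  · rw [← mul_assoc, h]; simp
  · intro b _ hb
    rw [if_neg, smul_zero]
    rintro rfl; apply hb; rw [← mul_assoc, mul_comm v u, h, one_mul]
  · simp
noncomputable abbrev st : A →+* A := mu (-1)
theorem st_coeff (x : A) (i : ZMod 45) : (st x).coeff i = x.coeff (-i) := by
  rw [mu_coeff (-1) (-1) (by ring)]; simp
theorem st_st (x : A) : st (st x) = x := by
  rw [mu_mu]; rw [show (-1 : ZMod 45) * -1 = 1 by ring, mu_one]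

noncomputable def J : A := fromFn fun _ => 1
noncomputable def eps (x : A) : ZMod 2 := ∑ i, x.coeff i
theorem J_mul (x : A) : J * x = eps x • J := by
  apply A_ext; intro j
  rw [coeff_mulA, AddMonoidAlgebra.coeff_smul, Finsupp.smul_apply]
  simp only [J, coeff_fromFn, one_mul, smul_eq_mul, mul_one, eps]
  exact Fintype.sum_equiv (Equiv.subLeft j) _ _ (fun _ => rfl)
theorem eps_add (x y : A) : eps (x + y) = eps x + eps y := by simp [eps, Finset.sum_add_distrib]
theorem eps_mul (x y : A) : eps (x * y) = eps x * eps y := by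
  have h : ∀ i : ZMod 45, ∑ j, y.coeff (j - i) = eps y := fun i =>
    Equiv.sum_comp (Equiv.subRight i) (fun k => y.coeff k)
  calc eps (x * y) = ∑ j, ∑ i, x.coeff i * y.coeff (j - i) := by simp only [eps, coeff_mulA]
    _ = ∑ i, ∑ j, x.coeff i * y.coeff (j - i) := Finset.sum_comm
    _ = ∑ i, x.coeff i * eps y := Finset.sum_congr rfl fun i _ => by rw [← Finset.mul_sum, h]
    _ = eps x * eps y := by rw [← Finset.sum_mul]; rfl
theorem eps_J : eps J = 1 := by
  simp only [eps, J, coeff_fromFn, Finset.sum_const, Finset.card_univ, ZMod.card]; rfl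
theorem eps_X (k : ZMod 45) : eps (X k) = 1 := by simp [eps, X_coeff]

/-! masks -/
noncomputable def toA (n : ℕ) : A := fromFn fun i => if n.testBit i.val then 1 else 0
theorem toA_coeff (n : ℕ) (i : ZMod 45) : (toA n).coeff i = if n.testBit i.val then 1 else 0 := rfl
theorem toA_coeff' (n i : ℕ) (h : i < 45) : (toA n).coeff (i : ZMod 45) = if n.testBit i then 1 else 0 := by
  rw [toA_coeff, ZMod.val_natCast, Nat.mod_eq_of_lt h]
theorem toA_xor (a b : ℕ) : toA (a ^^^ b) = toA a + toA b := by
  apply A_ext; intro i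
  rw [AddMonoidAlgebra.coeff_add, Finsupp.add_apply, toA_coeff, toA_coeff, toA_coeff, Nat.testBit_xor]
  cases a.testBit i.val <;> cases b.testBit i.val <;> decide
theorem toA_zero : toA 0 = 0 := by apply A_ext; intro i; simp [toA_coeff]
theorem toA_inj {a b : ℕ} (ha : a < 2^45) (hb : b < 2^45) (h : toA a = toA b) : a = b := by
  apply Nat.eq_of_testBit_eq; intro i
  by_cases hi : i < 45
  · have := congrArg (fun x : A => x.coeff (i : ZMod 45)) h
    simp only [toA_coeff' _ _ hi] at this
    cases h1 : a.testBit i <;> cases h2 : b.testBit i <;> simp_all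
  · rw [Nat.testBit_lt_two_pow (lt_of_lt_of_le ha (Nat.pow_le_pow_right (by norm_num) (by omega))),
      Nat.testBit_lt_two_pow (lt_of_lt_of_le hb (Nat.pow_le_pow_right (by norm_num) (by omega)))]
theorem toA_surj (x : A) : ∃ n < 2^45, toA n = x := by
  refine ⟨Nat.ofBits (n := 45) fun i => decide (x.coeff ((i.val : ℕ) : ZMod 45) = 1), Nat.ofBits_lt_two_pow _, ?_⟩
  apply A_ext; intro i
  rw [toA_coeff, Nat.testBit_ofBits_lt _ _ (ZMod.val_lt i)]
  simp only [ZMod.natCast_val, ZMod.cast_id', id_eq, decide_eq_true_eq]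
  generalize x.coeff i = c
  rcases z2 c with rfl | rfl <;> decide
theorem lt45 {n : ℕ} (h : ∀ i, 45 ≤ i → n.testBit i = false) : n < 2^45 :=
  Nat.lt_pow_two_of_testBit n h
theorem M45_eq : M45 = 2^45 - 1 := by norm_num [M45]
theorem and_M45 (n : ℕ) : n &&& M45 = n % 2^45 := by rw [M45_eq, Nat.and_two_pow_sub_one_eq_mod]
theorem rotN_eq (k b : ℕ) : rotN k b = ((b <<< k) ||| (b >>> (45 - k))) % 2^45 := by
  rw [← and_M45]; rfl
theorem rotN_lt (k b : ℕ) : rotN k b < 2^45 := by rw [rotN_eq]; exact Nat.mod_lt _ (by norm_num)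
theorem rotN_testBit {k b i : ℕ} (hk : k ≤ 45) (hb : b < 2^45) (hi : i < 45) :
    (rotN k b).testBit i = b.testBit ((i + 45 - k) % 45) := by
  rw [rotN_eq, Nat.testBit_mod_two_pow, Nat.testBit_or, Nat.testBit_shiftLeft, Nat.testBit_shiftRight]
  simp only [hi, decide_true, Bool.true_and]
  by_cases h : k ≤ i
  · have : b.testBit (45 - k + i) = false :=
      Nat.testBit_lt_two_pow (lt_of_lt_of_le hb (Nat.pow_le_pow_right (by norm_num) (by omega)))
    rw [this, show (i + 45 - k) % 45 = i - k by omega]; simp [h]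
  · rw [show (i + 45 - k) % 45 = 45 - k + i by omega]; simp [h]
theorem val_sub_nat (i : ZMod 45) (k : ℕ) (hk : k ≤ 45) : (i - (k : ZMod 45)).val = (i.val + 45 - k) % 45 := by
  have : i - (k : ZMod 45) = ((i.val + 45 - k : ℕ) : ZMod 45) := by
    rw [Nat.cast_sub (by omega), Nat.cast_add]
    rw [show ((45 : ℕ) : ZMod 45) = 0 from rfl]; simp
  rw [this, ZMod.val_natCast]
theorem toA_rotN {k b : ℕ} (hk : k ≤ 45) (hb : b < 2^45) : toA (rotN k b) = X (k : ZMod 45) * toA b := by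
  apply A_ext; intro i
  rw [X_mul_coeff, toA_coeff, toA_coeff, rotN_testBit hk hb (ZMod.val_lt i), val_sub_nat i k hk]
theorem bit_eq (a i : ℕ) : bit a i = a.testBit i := by
  unfold bit Nat.testBit
  change Nat.beq ((a >>> i) &&& 1) 1 = _
  rw [Nat.and_comm 1, Nat.and_one_is_mod]
  rcases Nat.mod_two_eq_zero_or_one (a >>> i) with h | h <;> rw [h] <;> rfl
theorem toA_one_shift {i : ℕ} (hi : i < 45) : toA (1 <<< i) = X (i : ZMod 45) := by
  apply A_ext; intro j
  rw [toA_coeff, X_coeff, Nat.one_shiftLeft, Nat.testBit_two_pow]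
  congr 1
  simp only [decide_eq_true_eq]
  apply propext
  constructor
  · intro h; rw [h]; simp
  · rintro rfl; rw [ZMod.val_natCast, Nat.mod_eq_of_lt hi]
/-- partial expansion of a mask -/
theorem toA_eq_sum (a : ℕ) : toA a = ∑ i ∈ Finset.range 45, if a.testBit i then X (i : ZMod 45) else 0 := by
  conv_lhs => rw [eq_sum_X (toA a)]
  rw [← Fin.sum_univ_eq_sum_range (fun i => if a.testBit i then X (i : ZMod 45) else 0) 45]
  refine Finset.sum_congr rfl fun i _ => ?_
  rw [toA_coeff, smul_eq]
  change (if (if a.testBit i.val then (1 : ZMod 2) else 0) = 1 then X i else 0) = if a.testBit i.val then X ((i.val : ℕ) : ZMod 45) else 0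
  rw [show ((i.val : ℕ) : ZMod 45) = i by simp]
  cases a.testBit i.val <;> simp
theorem mulX_succ (a b n : ℕ) : mulX a b (n+1) = bi (bit a n) (mulX a b n ^^^ rotN n b) (mulX a b n) := rfl
theorem bi_eq {α : Type} (b : Bool) (t f : α) : bi b t f = if b then t else f := by cases b <;> rfl
theorem mulX_lt (a b n : ℕ) : mulX a b n < 2^45 := by
  induction n with
  | zero => exact Nat.two_pow_pos 45
  | succ n ih => rw [mulX_succ, bi_eq]; split_ifs; exacts [Nat.xor_lt_two_pow ih (rotN_lt _ _), ih]
theorem mulN_lt (a b : ℕ) : mulN a b < 2^45 := mulX_lt a b 45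
theorem toA_mulN (a b : ℕ) (hb : b < 2^45) : toA (mulN a b) = toA a * toA b := by
  have : ∀ n ≤ 45, toA (mulX a b n) = (∑ i ∈ Finset.range n, if a.testBit i then X (i : ZMod 45) else 0) * toA b := by
    intro n
    induction n with
    | zero => intro _; rw [show mulX a b 0 = 0 from rfl, toA_zero]; simp
    | succ n ih =>
      intro hn
      rw [mulX_succ, bi_eq, bit_eq, Finset.sum_range_succ, add_mul, ← ih (by omega)]
      split_ifs
      · rw [toA_xor, toA_rotN (by omega) hb]
      · simp
  rw [mulN, this 45 le_rfl, toA_eq_sum a]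
theorem muX_succ (m a n : ℕ) : muX m a (n+1) = bi (bit a n) (muX m a n ^^^ (1 <<< (n * m % 45))) (muX m a n) := rfl
theorem muX_lt (m a n : ℕ) : muX m a n < 2^45 := by
  induction n with
  | zero => exact Nat.two_pow_pos 45
  | succ n ih =>
    rw [muX_succ, bi_eq]; split_ifs
    · refine Nat.xor_lt_two_pow ih ?_
      rw [Nat.one_shiftLeft]; exact Nat.pow_lt_pow_right (by norm_num) (Nat.mod_lt _ (by norm_num))
    · exact ih
theorem muN_lt (m a : ℕ) : muN m a < 2^45 := muX_lt m a 45
theorem toA_muN (m a : ℕ) : toA (muN m a) = mu (m : ZMod 45) (toA a) := by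
  have : ∀ n ≤ 45, toA (muX m a n) = mu (m : ZMod 45) (∑ i ∈ Finset.range n, if a.testBit i then X (i : ZMod 45) else 0) := by
    intro n
    induction n with
    | zero => intro _; rw [show muX m a 0 = 0 from rfl, toA_zero]; simp
    | succ n ih =>
      intro hn
      rw [muX_succ, bi_eq, bit_eq, Finset.sum_range_succ, map_add, ← ih (by omega)]
      split_ifs
      · rw [toA_xor, toA_one_shift (Nat.mod_lt _ (by norm_num)), mu_X]
        congr 2
        rw [ZMod.natCast_mod, Nat.cast_mul, mul_comm]
      · simp
  rw [muN, this 45 le_rfl, toA_eq_sum a]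
theorem toA_muN44 (a : ℕ) : toA (muN 44 a) = st (toA a) := by
  rw [toA_muN]; rfl
/-- weight -/
noncomputable def wt (x : A) : ℕ := (Finset.univ.filter fun i => x.coeff i ≠ 0).card
theorem pc_eq (a : ℕ) : pc a = wt (toA a) := by
  have : ∀ n, pcX a n = ((Finset.range n).filter fun i => a.testBit i).card := by
    intro n
    induction n with
    | zero => rfl
    | succ n ih =>
      rw [show pcX a (n+1) = pcX a n + ((a >>> n) &&& 1) from rfl, ih, Finset.range_add_one, Finset.filter_insert,
        Nat.and_one_is_mod]
      have h2 := Nat.testBit_eq_decide_div_mod_eq (x := a) (i := n)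
      rw [Nat.shiftRight_eq_div_pow]
      by_cases h : a.testBit n
      · rw [if_pos h, Finset.card_insert_of_notMem (by simp)]
        simp [h] at h2; omega
      · rw [if_neg h]
        simp [h] at h2; omega
  rw [pc, this, wt]
  symm
  refine Finset.card_bij (fun i _ => i.val) ?_ ?_ ?_
  · intro i hi
    simp only [toA_coeff] at hi
    simp only [Finset.mem_filter, Finset.mem_range]
    exact ⟨ZMod.val_lt i, by by_contra h; simp [h] at hi⟩
  · intro i _ j _ h; exact ZMod.val_injective 45 h
  · intro i hi
    simp only [Finset.mem_filter, Finset.mem_range] at hi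
    refine ⟨(i : ZMod 45), ?_, ?_⟩
    · simp [toA_coeff' _ _ hi.1, hi.2]
    · rw [ZMod.val_natCast, Nat.mod_eq_of_lt hi.1]
end DC

namespace DC

theorem allN_spec {f : ℕ → Bool} {n : ℕ} (h : allN f n = true) : ∀ k < n, f k = true := by
  induction n with
  | zero => intro k hk; omega
  | succ n ih =>
    have h' : bi (f n) (allN f n) false = true := h
    rw [bi_eq] at h'
    split_ifs at h' with h1
    intro k hk
    rcases Nat.lt_succ_iff_lt_or_eq.mp hk with h2 | rfl
    exacts [ih h' k h2, h1]
theorem allB_spec {α : Type} {f : α → Bool} {l : List α} (h : allB f l = true) : ∀ x ∈ l, f x = true := by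
  induction l with
  | nil => intro x hx; simp at hx
  | cons a l ih =>
    have h' : bi (f a) (allB f l) false = true := h
    rw [bi_eq] at h'
    split_ifs at h' with h1
    intro x hx
    rcases List.mem_cons.mp hx with rfl | h2
    exacts [h1, ih h' x h2]
theorem memB_spec {x : ℕ} {l : List ℕ} (h : memB x l = true) : x ∈ l := by
  induction l with
  | nil => exact absurd h (by simp [memB])
  | cons a l ih =>
    have h' : bi (Nat.beq x a) true (memB x l) = true := h
    rw [bi_eq] at h'
    split_ifs at h' with h1
    · rw [Nat.eq_of_beq_eq_true h1]; simp
    · exact List.mem_cons_of_mem _ (ih h')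

theorem phi_cons (b : ℕ) (bs : List ℕ) (n : ℕ) : phi (b :: bs) n =
    if n % 2 = 0 then phi bs (n / 2) else b ^^^ phi bs (n / 2) := by
  change bi (Nat.beq (n &&& 1) 0) (phi bs (n >>> 1)) (b ^^^ phi bs (n >>> 1)) = _
  rw [bi_eq, Nat.and_one_is_mod, Nat.shiftRight_one]
  rcases Nat.mod_two_eq_zero_or_one n with h | h <;> rw [h] <;> rfl
theorem phi_zero (bs : List ℕ) : phi bs 0 = 0 := by
  induction bs with
  | nil => rfl
  | cons b bs ih => rw [phi_cons]; simp [ih]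
theorem phi_xor (bs : List ℕ) (n m : ℕ) : phi bs (n ^^^ m) = phi bs n ^^^ phi bs m := by
  induction bs generalizing n m with
  | nil => rw [show phi [] (n ^^^ m) = 0 from rfl, show phi [] n = 0 from rfl, show phi [] m = 0 from rfl]; rfl
  | cons b bs ih =>
    rw [phi_cons, phi_cons, phi_cons, Nat.xor_div_two, ih, Nat.xor_mod_two_eq]
    rcases Nat.mod_two_eq_zero_or_one n with h | h <;> rcases Nat.mod_two_eq_zero_or_one m with h' | h'
    · have : (n + m) % 2 = 0 := by omega
      simp [h, h', this]
    · have : (n + m) % 2 = 1 := by omega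
      simp [h, h', this]; ac_rfl
    · have : (n + m) % 2 = 1 := by omega
      simp [h, h', this]; ac_rfl
    · have : (n + m) % 2 = 0 := by omega
      simp only [h, h', this]
      simp only [if_true, one_ne_zero, if_false]
      rw [show (b ^^^ phi bs (n / 2)) ^^^ (b ^^^ phi bs (m / 2)) = (b ^^^ b) ^^^ (phi bs (n / 2) ^^^ phi bs (m / 2)) by ac_rfl]
      simp
theorem phi_lt {bs : List ℕ} (h : ∀ b ∈ bs, b < 2^45) (n : ℕ) : phi bs n < 2^45 := by
  induction bs generalizing n with
  | nil => exact Nat.two_pow_pos 45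
  | cons b bs ih =>
    have h1 := ih (fun c hc => h c (List.mem_cons_of_mem _ hc)) (n / 2)
    rw [phi_cons]; split_ifs
    · exact h1
    · exact Nat.xor_lt_two_pow (h b (by simp)) h1
theorem phi_absorb {bs : List ℕ} {e : A} (h : ∀ b ∈ bs, e * toA b = toA b) (n : ℕ) :
    e * toA (phi bs n) = toA (phi bs n) := by
  induction bs generalizing n with
  | nil => rw [show phi [] n = 0 from rfl, toA_zero, mul_zero]
  | cons b bs ih =>
    have h1 := ih (fun c hc => h c (List.mem_cons_of_mem _ hc)) (n / 2)
    rw [phi_cons]; split_ifs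
    · exact h1
    · rw [toA_xor, mul_add, h1, h b (by simp)]

theorem ideal_lemma {bs : List ℕ} {f d : ℕ} (hf : f < 2^45) (h : idealB bs f d = true) (a : A) :
    ∃ n < 2^d, toA f * a = toA (phi bs n) := by
  have key : ∀ k : ZMod 45, ∃ n < 2^d, toA f * X k = toA (phi bs n) := by
    intro k
    have := Nat.eq_of_beq_eq_true (allN_spec h k.val (ZMod.val_lt k))
    refine ⟨Nat.land (rotN k.val f) (ones d), ?_, ?_⟩
    · change (rotN k.val f &&& ((1 <<< d) - 1)) < 2^d
      rw [Nat.one_shiftLeft, Nat.and_two_pow_sub_one_eq_mod]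
      exact Nat.mod_lt _ (Nat.two_pow_pos d)
    · rw [mul_comm, show X k = X ((k.val : ℕ) : ZMod 45) by simp, ← toA_rotN (ZMod.val_lt k).le hf, this]
  rw [eq_sum_X a, Finset.mul_sum]
  refine Finset.sum_induction _ (fun x => ∃ n < 2^d, x = toA (phi bs n)) ?_ ?_ ?_
  · rintro x y ⟨n, hn, rfl⟩ ⟨m, hm, rfl⟩
    exact ⟨n ^^^ m, Nat.xor_lt_two_pow hn hm, by rw [phi_xor, toA_xor]⟩
  · exact ⟨0, Nat.two_pow_pos d, by rw [phi_zero, toA_zero]⟩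
  · intro i _
    rw [smul_eq]
    split_ifs
    · exact key i
    · exact ⟨0, Nat.two_pow_pos d, by rw [phi_zero, toA_zero, mul_zero]⟩

/-! computational checks -/
theorem ck_one : 1 = M45 ^^^ (e3 ^^^ (e5 ^^^ (e9 ^^^ (f15 ^^^ (muN 44 f15 ^^^ (f45 ^^^ muN 44 f45)))))) := by
  decide +kernel
theorem ck_lt : e3 < 2^45 ∧ e5 < 2^45 ∧ e9 < 2^45 ∧ f15 < 2^45 ∧ f45 < 2^45 := by decide +kernel
theorem ck_st : muN 44 e3 = e3 ∧ muN 44 e5 = e5 ∧ muN 44 e9 = e9 := by decide +kernel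
theorem ck_mu2 : muN 2 e5 = e5 ∧ muN 2 e9 = e9 ∧ muN 2 f45 = f45 := by decide +kernel
theorem ck_id : mulN e3 e3 = e3 ∧ mulN e5 e5 = e5 ∧ mulN e9 e9 = e9 ∧ mulN f15 f15 = f15 ∧ mulN f45 f45 = f45 := by
  decide +kernel
theorem ck_J : mulN e3 M45 = 0 ∧ mulN e5 M45 = 0 ∧ mulN e9 M45 = 0 ∧ mulN f15 M45 = 0 ∧ mulN f45 M45 = 0 := by
  decide +kernel
theorem ck_i3 : idealB B3 e3 2 = true := by decide +kernel
theorem ck_i5 : idealB B5 e5 4 = true := by decide +kernel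
theorem ck_i9 : idealB B9 e9 6 = true := by decide +kernel
theorem ck_i15 : idealB B15 f15 4 = true := by decide +kernel
theorem ck_i45 : idealB B45 f45 12 = true := by decide +kernel
theorem ck_abs : ∀ b ∈ B45, mulN f45 b = b := by decide +kernel
theorem ck_blt : (∀ b ∈ B3, b < 2^45) ∧ (∀ b ∈ B5, b < 2^45) ∧ (∀ b ∈ B9, b < 2^45) ∧ (∀ b ∈ B15, b < 2^45) ∧ (∀ b ∈ B45, b < 2^45) ∧
  (∀ b ∈ L3, b < 2^45) := by
  decide +kernel
theorem ck_3 : ∀ n < 4, mulN (phi B3 n) (muN 44 (phi B3 n)) = e3 → phi B3 n ∈ L3 := by decide +kernel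
theorem ck_5 : ∀ n < 16, mulN (phi B5 n) (muN 44 (phi B5 n)) = e5 → ∃ k < 5, phi B5 n = rotN (9 * k) e5 := by decide +kernel
theorem ck_9 : ∀ n < 64, mulN (phi B9 n) (muN 44 (phi B9 n)) = e9 → ∃ k < 9, phi B9 n = rotN k e9 := by decide +kernel
theorem ck_rot : ∀ k < 5, rotN (9 * k) e9 = e9 := by decide +kernel
theorem ck_15 : ∀ n < 16, ∀ m < 16, mulN (phi B15 n) (phi B15 m) = f15 → P15.contains (n, m) = true := by decide +kernel
theorem ck_cov : cov DD 0 = 2 ^ 4096 - 2 := by decide +kernel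

theorem orb_spec (n : ℕ) : ∀ x acc t, (orb n x acc).testBit t = true →
    acc.testBit t = true ∨ ∃ k < n, toA (phi B45 t) = mu (2 ^ k) (toA x) := by
  induction n with
  | zero => intro x acc t h; exact Or.inl h
  | succ n ih =>
    intro x acc t h
    have h' : (orb n (muN 2 x) (bi (Nat.beq (phi B45 (x &&& 4095)) x) (acc ||| (1 <<< (x &&& 4095))) acc)).testBit t = true := h
    rcases ih _ _ _ h' with h1 | ⟨k, hk, h1⟩
    · rw [bi_eq] at h1
      split_ifs at h1 with h2
      · rw [Nat.testBit_or, Bool.or_eq_true] at h1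
        rcases h1 with h1 | h1
        · exact Or.inl h1
        · rw [Nat.one_shiftLeft, Nat.testBit_two_pow] at h1
          refine Or.inr ⟨0, by omega, ?_⟩
          rw [← of_decide_eq_true h1, Nat.eq_of_beq_eq_true h2, pow_zero, mu_one]
      · exact Or.inl h1
    · refine Or.inr ⟨k + 1, by omega, ?_⟩
      rw [h1, toA_muN, mu_mu, pow_succ]; rfl
theorem cov_spec (l : List (ℕ × ℕ × ℕ)) : ∀ acc t, (cov l acc).testBit t = true →
    acc.testBit t = true ∨ ∃ d ∈ l, ∃ k < 12, toA (phi B45 t) = mu (2 ^ k) (toA (phi B45 d.1)) ∨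
      toA (phi B45 t) = mu (2 ^ k) (toA (phi B45 d.2.1)) := by
  induction l with
  | nil => intro acc t h; exact Or.inl h
  | cons d l ih =>
    intro acc t h
    have h' : (cov l (orb 12 (phi B45 d.2.1) (orb 12 (phi B45 d.1) acc))).testBit t = true := h
    rcases ih _ _ h' with h1 | ⟨d', hd, k, hk, h1⟩
    · rcases orb_spec _ _ _ _ h1 with h1 | ⟨k, hk, h1⟩
      · rcases orb_spec _ _ _ _ h1 with h1 | ⟨k, hk, h1⟩
        · exact Or.inl h1
        · exact Or.inr ⟨d, by simp, k, hk, Or.inl h1⟩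
      · exact Or.inr ⟨d, by simp, k, hk, Or.inr h1⟩
    · exact Or.inr ⟨d', List.mem_cons_of_mem _ hd, k, hk, h1⟩

def Wit (r : A) : Prop := ∃ a : A, ∃ s : ZMod 2, a ≠ 0 ∧ s.val + wt a + (eps a).val + wt (a * r + s • J) < 16

theorem wt_add_X (a : A) (p : ZMod 45) : wt (a + X p) ≤ wt a + 1 := by
  unfold wt
  refine le_trans (Finset.card_le_card (t := insert p (Finset.univ.filter fun i => a.coeff i ≠ 0)) ?_) (Finset.card_insert_le _ _)
  intro i hi
  simp only [Finset.mem_filter, Finset.mem_univ, true_and, AddMonoidAlgebra.coeff_add, Finsupp.add_apply, X_coeff,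
    Finset.mem_insert] at hi ⊢
  by_cases h : p = i
  · exact Or.inl h.symm
  · right; simpa [h] using hi
theorem J_eq : J = toA M45 := by
  apply A_ext; intro i
  rw [toA_coeff, M45_eq, Nat.testBit_two_pow_sub_one]
  simp [J, ZMod.val_lt i]
theorem val_cast2 (k : ℕ) : ((k : ZMod 2)).val = k % 2 := ZMod.val_natCast 2 k

theorem witA_spec {r s t : ℕ} (hr : r < 2^45) (k : ℕ) : ∀ w a c K, a < 2^45 → toA c = toA a * toA r →
    wt (toA a) ≤ K → eps (toA a) = K → t = s + ((K + k) + (K + k) % 2) →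
    witA r s t k w a c = true → Wit (toA r) := by
  induction k with
  | zero =>
    intro w a c K ha hc hw he ht h
    have h' : bi (Nat.beq a 0) false (Nat.blt (t + pc (bi (Nat.beq s 0) c (c ^^^ M45))) 16) = true := h
    rw [bi_eq] at h'
    split_ifs at h' with h1
    have h2 : t + pc (bi (Nat.beq s 0) c (c ^^^ M45)) < 16 := by
      simpa [Nat.blt_eq] using h'
    have ha0 : toA a ≠ 0 := by
      intro h0; apply h1
      rw [toA_inj ha (b := 0) (by norm_num) (by rw [h0, toA_zero])]; rfl
    rw [bi_eq] at h2
    have hv : (eps (toA a)).val = K % 2 := by rw [he, val_cast2]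
    split_ifs at h2 with h3
    · refine ⟨toA a, 0, ha0, ?_⟩
      rw [pc_eq, hc] at h2
      simp only [zero_smul, add_zero, ZMod.val_zero, hv]; omega
    · refine ⟨toA a, 1, ha0, ?_⟩
      rw [pc_eq, toA_xor, ← J_eq, hc] at h2
      have : s ≠ 0 := by rintro rfl; exact h3 rfl
      have h5 : (1 : ZMod 2).val = 1 := rfl
      simp only [one_smul, hv, h5]; omega
  | succ k ih =>
    intro w a c K ha hc hw he ht h
    have h' : bi (Nat.blt (w &&& 63) 45) (witA r s t k (w >>> 6) (a ^^^ (1 <<< (w &&& 63))) (c ^^^ (rotN (w &&& 63) r))) false = true := h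
    rw [bi_eq] at h'
    split_ifs at h' with h1
    have h2 : w &&& 63 < 45 := by simpa [Nat.blt_eq] using h1
    refine ih _ _ _ (K + 1) ?_ ?_ ?_ ?_ ?_ h'
    · refine Nat.xor_lt_two_pow ha ?_
      rw [Nat.one_shiftLeft]; exact Nat.pow_lt_pow_right (by norm_num) h2
    · rw [toA_xor, toA_xor, toA_one_shift h2, toA_rotN h2.le hr, hc, add_mul]
    · rw [toA_xor, toA_one_shift h2]; exact (wt_add_X _ _).trans (by omega)
    · rw [toA_xor, toA_one_shift h2, eps_add, eps_X, he]; push_cast; rfl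
    · rw [ht]; congr 1; omega
theorem toA_one : toA 1 = 1 := by
  rw [show (1:ℕ) = 1 <<< 0 from rfl, toA_one_shift (by norm_num), Nat.cast_zero, X_zero]
theorem eps_one : eps 1 = 1 := eps_X 0
theorem wt_one : wt 1 ≤ 1 := by rw [← toA_one, ← pc_eq]; decide +kernel
theorem witB_spec {r s k w : ℕ} (hr : r < 2^45) (h : witB r s k w = true) : Wit (toA r) := by
  refine witA_spec hr k w 1 r 1 (by norm_num) (by rw [toA_one, one_mul]) (by rw [toA_one]; exact wt_one)
    (by rw [toA_one, eps_one]; rfl) ?_ h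
  change s + (k + 1 + ((k + 1) &&& 1)) = _
  rw [Nat.and_one_is_mod, add_comm 1 k]
theorem wgo_spec {b : ℕ} (hb : b < 2^45) (l : List ℕ) : (∀ x ∈ l, x < 2^45) → ∀ w, wgo b l w = true →
    ∀ x ∈ l, Wit (toA (x ^^^ b)) ∨ x ^^^ b ∈ goodR := by
  induction l with
  | nil => intro _ w _ x hx; simp at hx
  | cons y l ih =>
    intro hl w h
    have h' : bi (Nat.beq (w &&& 7) 0)
     (bi (memB (y ^^^ b) goodR) (wgo b l (w >>> 4)) false)
     (bi (witB (y ^^^ b) ((w >>> 3) &&& 1) ((w &&& 7) - 1) (w >>> 4))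
       (wgo b l (w >>> (4 + 6 * ((w &&& 7) - 1)))) false) = true := h
    have hl' : ∀ x ∈ l, x < 2^45 := fun x hx => hl x (List.mem_cons_of_mem _ hx)
    rw [bi_eq, bi_eq, bi_eq] at h'
    intro x hx
    split_ifs at h' with h1 h2 h3
    · rcases List.mem_cons.mp hx with rfl | hx
      · exact Or.inr (memB_spec h2)
      · exact ih hl' _ h' x hx
    · rcases List.mem_cons.mp hx with rfl | hx
      · exact Or.inl (witB_spec (Nat.xor_lt_two_pow (hl _ (by simp)) hb) h3)
      · exact ih hl' _ h' x hx

theorem wc0 : allB wchk D0 = true := by decide +kernel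
theorem wc1 : allB wchk D1 = true := by decide +kernel
theorem wc2 : allB wchk D2 = true := by decide +kernel
theorem wc3 : allB wchk D3 = true := by decide +kernel
theorem wc4 : allB wchk D4 = true := by decide +kernel
theorem wc5 : allB wchk D5 = true := by decide +kernel
theorem wc6 : allB wchk D6 = true := by decide +kernel
theorem wc7 : allB wchk D7 = true := by decide +kernel
theorem wc8 : allB wchk D8 = true := by decide +kernel
theorem wc9 : allB wchk D9 = true := by decide +kernel
theorem wc10 : allB wchk D10 = true := by decide +kernel
theorem wc11 : allB wchk D11 = true := by decide +kernel
theorem wc12 : allB wchk D12 = true := by decide +kernel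
theorem wc13 : allB wchk D13 = true := by decide +kernel
theorem wc14 : allB wchk D14 = true := by decide +kernel
theorem wc15 : allB wchk D15 = true := by decide +kernel
theorem wc16 : allB wchk D16 = true := by decide +kernel
theorem wc17 : allB wchk D17 = true := by decide +kernel

theorem wchk_all : ∀ d ∈ DD, wchk d = true := by
  intro d hd
  simp only [DD, List.mem_append] at hd
  rcases hd with h | h | h | h | h | h | h | h | h | h | h | h | h | h | h | h | h | h
  · exact allB_spec wc0 d h
  · exact allB_spec wc1 d h
  · exact allB_spec wc2 d h
  · exact allB_spec wc3 d h
  · exact allB_spec wc4 d h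
  · exact allB_spec wc5 d h
  · exact allB_spec wc6 d h
  · exact allB_spec wc7 d h
  · exact allB_spec wc8 d h
  · exact allB_spec wc9 d h
  · exact allB_spec wc10 d h
  · exact allB_spec wc11 d h
  · exact allB_spec wc12 d h
  · exact allB_spec wc13 d h
  · exact allB_spec wc14 d h
  · exact allB_spec wc15 d h
  · exact allB_spec wc16 d h
  · exact allB_spec wc17 d h

end DC

namespace DC

theorem mu_J (u v : ZMod 45) (h : u * v = 1) : mu u J = J := by
  apply A_ext; intro i; rw [mu_coeff u v h]; rfl
theorem st_J : st J = J := mu_J _ (-1) (by decide)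
theorem mu_comm (u v : ZMod 45) (x : A) : mu u (mu v x) = mu v (mu u x) := by
  rw [mu_mu, mu_mu, mul_comm]
theorem X_neg (k : ZMod 45) : X k * X (-k) = 1 := by rw [← X_add, add_neg_cancel, X_zero]

def Hr (r : A) : Prop := r * st r = 1 + J ∧ J * r = 0
theorem Hr_X {r : A} (h : Hr r) (k : ZMod 45) : Hr (X k * r) := by
  refine ⟨?_, ?_⟩
  · rw [map_mul, mu_X, neg_one_mul, show X k * r * (X (-k) * st r) = (X k * X (-k)) * (r * st r) by ring, X_neg, h.1, one_mul]
  · rw [mul_left_comm, h.2, mul_zero]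
theorem Hr_mu {r : A} (h : Hr r) {u v : ZMod 45} (huv : u * v = 1) : Hr (mu u r) := by
  refine ⟨?_, ?_⟩
  · rw [mu_comm, ← map_mul, h.1, map_add, map_one, mu_J u v huv]
  · have : mu u J * mu u r = 0 := by rw [← map_mul, h.2, map_zero]
    rwa [mu_J u v huv] at this

theorem E_mul {e : ℕ} (he : e < 2^45) (h : mulN e e = e) : toA e * toA e = toA e := by
  rw [← toA_mulN _ _ he, h]
theorem E_J {e : ℕ} (h : mulN e M45 = 0) : toA e * J = 0 := by
  rw [J_eq, ← toA_mulN _ _ (by norm_num [M45]), h, toA_zero]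

theorem e_norm {e p : ℕ} (he : e < 2^45) (_hp : p < 2^45) (h2 : mulN e e = e) (hs : muN 44 e = e) (hJ : mulN e M45 = 0)
    {r : A} (hr : Hr r) (h : toA e * r = toA p) : mulN p (muN 44 p) = e := by
  apply toA_inj (mulN_lt _ _) he
  rw [toA_mulN _ _ (muN_lt _ _), toA_muN44, ← h, map_mul, ← toA_muN44 e, hs,
    show toA e * r * (toA e * st r) = (toA e * toA e) * (r * st r) by ring, hr.1, mul_add, E_mul he h2, E_J hJ]
  simp
theorem f_norm {e p q : ℕ} (he : e < 2^45) (hp : q < 2^45) (h2 : mulN e e = e) (hJ : mulN e M45 = 0)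
    {r : A} (hr : Hr r) (h : toA e * r = toA p) (h' : toA e * st r = toA q) : mulN p q = e := by
  apply toA_inj (mulN_lt _ _) he
  rw [toA_mulN _ _ hp, ← h, ← h', 
    show toA e * r * (toA e * st r) = (toA e * toA e) * (r * st r) by ring, hr.1, mul_add, E_mul he h2, E_J hJ]
  simp

theorem mu2_fix {e : ℕ} (h : muN 2 e = e) (j : ℕ) : mu (2 ^ j) (toA e) = toA e := by
  induction j with
  | zero => rw [pow_zero, mu_one]
  | succ j ih => rw [pow_succ, ← mu_mu, show mu 2 (toA e) = toA e by
                  have := toA_muN 2 e; rw [h] at this; exact this.symm, ih]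
theorem two12 : (2 : ZMod 45) ^ 12 = 1 := by decide
theorem pow_inv12 {k : ℕ} (hk : k < 12) : (2 : ZMod 45) ^ (12 - k) * 2 ^ k = 1 := by
  rw [← pow_add, show 12 - k + k = 12 by omega, two12]

theorem A_cancel {x y : A} (h : x + y = 0) : x = y := by
  have := A_two y
  exact add_right_cancel (h.trans this.symm)

theorem xor_mem_lows {p : ℕ} (hp : p ∈ L3) {n m : ℕ} (h : (n, m) ∈ P15) :
    (((e5 ^^^ e9) ^^^ p) ^^^ phi B15 n) ^^^ muN 44 (phi B15 m) ∈ lows := by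
  refine List.mem_flatMap.mpr ⟨p, hp, List.mem_map.mpr ⟨(n, m), h, rfl⟩⟩
theorem lows_lt : ∀ x ∈ lows, x < 2^45 := by
  intro x hx
  obtain ⟨p, hp, hx⟩ := List.mem_flatMap.mp hx
  obtain ⟨q, hq, rfl⟩ := List.mem_map.mp hx
  refine Nat.xor_lt_two_pow (Nat.xor_lt_two_pow (Nat.xor_lt_two_pow (Nat.xor_lt_two_pow ck_lt.2.1 ck_lt.2.2.1) ?_) ?_) (muN_lt _ _)
  · exact ck_blt.2.2.2.2.2 p hp
  · exact phi_lt ck_blt.2.2.2.1 _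

theorem one_decomp : (1 : A) = J + (toA e3 + (toA e5 + (toA e9 + (toA f15 + (st (toA f15) + (toA f45 + st (toA f45))))))) := by
  have h := congrArg toA ck_one
  simpa only [toA_xor, toA_muN44, toA_one, ← J_eq] using h

/-- the final case -/
theorem fin_case {r : A} (hr : Hr r) (h9 : toA e9 * r = toA e9) (h5 : toA e5 * r = toA e5)
    {d : ℕ × ℕ × ℕ} (hd : d ∈ DD) (h45 : toA f45 * r = toA (phi B45 d.1)) :
    Wit r ∨ ∃ n ∈ goodR, r = toA n := by
  have hw := wchk_all d hd
  have hw' : bi (Nat.beq (mulN (phi B45 d.1) (phi B45 d.2.1)) f45)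
   (wgo (Nat.xor (phi B45 d.1) (muN 44 (phi B45 d.2.1))) lows d.2.2) false = true := hw
  rw [bi_eq] at hw'
  split_ifs at hw' with h1
  have hm := Nat.eq_of_beq_eq_true h1
  have plt := fun n => phi_lt ck_blt.2.2.2.2.1 n
  have h45' : toA f45 * st r = toA (phi B45 d.2.1) := by
    have ab : toA f45 * toA (phi B45 d.2.1) = toA (phi B45 d.2.1) := phi_absorb (fun b hb => by
      rw [← toA_mulN _ _ (ck_blt.2.2.2.2.1 b hb), ck_abs b hb]) _
    have hm2 : toA (phi B45 d.1) * toA (phi B45 d.2.1) = toA f45 := by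
      rw [← toA_mulN _ _ (plt _), hm]
    rw [← h45] at hm2
    calc toA f45 * st r = (toA f45 * r * toA (phi B45 d.2.1)) * st r := by rw [hm2]
      _ = (toA f45 * (r * st r)) * toA (phi B45 d.2.1) := by ring
      _ = toA f45 * toA (phi B45 d.2.1) := by
          rw [hr.1, mul_add, E_J ck_J.2.2.2.2, mul_one, add_zero]
      _ = _ := ab
  obtain ⟨n3, hn3, h3⟩ := ideal_lemma ck_lt.1 ck_i3 r
  obtain ⟨n, hn, h15⟩ := ideal_lemma ck_lt.2.2.2.1 ck_i15 r
  obtain ⟨m, hmm, h15'⟩ := ideal_lemma ck_lt.2.2.2.1 ck_i15 (st r)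
  have c3 := ck_3 n3 hn3 (e_norm ck_lt.1 (phi_lt ck_blt.1 _) ck_id.1 ck_st.1 ck_J.1 hr h3)
  have c15 := ck_15 n hn m hmm (f_norm ck_lt.2.2.2.1 (phi_lt ck_blt.2.2.2.1 _) ck_id.2.2.2.1 ck_J.2.2.2.1 hr h15 h15')
  have c15' : (n, m) ∈ P15 := List.contains_iff_mem.mp c15
  have hx := xor_mem_lows c3 c15'
  have hfin := wgo_spec (b := phi B45 d.1 ^^^ muN 44 (phi B45 d.2.1)) (Nat.xor_lt_two_pow (plt _) (muN_lt _ _)) lows lows_lt _ hw' _ hx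
  have hreq : r = toA (((((e5 ^^^ e9) ^^^ phi B3 n3) ^^^ phi B15 n) ^^^ muN 44 (phi B15 m)) ^^^ (phi B45 d.1 ^^^ muN 44 (phi B45 d.2.1))) := by
    simp only [toA_xor, toA_muN44]
    rw [← h3, ← h15, ← h15', ← h45, ← h45', map_mul, map_mul, st_st]
    calc r = 1 * r := (one_mul r).symm
      _ = J * r + (toA e3 * r + (toA e5 * r + (toA e9 * r + (toA f15 * r + (st (toA f15) * r + (toA f45 * r + st (toA f45) * r)))))) := by
        rw [one_decomp]; ring
      _ = _ := by rw [hr.2, h5, h9]; ring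
  rcases hfin with h | h
  · left; rwa [← hreq] at h
  · right; exact ⟨_, h, hreq⟩

theorem f45_ne : toA f45 ≠ 0 := by
  intro h
  exact absurd (toA_inj ck_lt.2.2.2.2 (b := 0) (by norm_num) (by rw [h, toA_zero])) (by decide +kernel)

theorem pw (k : ℕ) : (2 ^ (k + 1) - 2 : ℕ) = (2 ^ k - 1) * 2 ^ 1 := by
  rw [Nat.sub_mul, ← pow_add, one_mul, pow_one]

theorem classify (P : A → Prop) (hX : ∀ k r, P (X k * r) → P r)
    (hmu : ∀ u v, u * v = 1 → ∀ r, P (mu u r) → P r) (hbad : ∀ r, Wit r → P r)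
    (hgood : ∀ n ∈ goodR, P (toA n)) : ∀ r, Hr r → P r := by
  have hfin : ∀ r, Hr r → toA e9 * r = toA e9 → toA e5 * r = toA e5 → ∀ d ∈ DD, toA f45 * r = toA (phi B45 d.1) → P r := by
    intro r hr h9 h5 d hd h
    rcases fin_case hr h9 h5 hd h with h | ⟨n, hn, rfl⟩
    exacts [hbad _ h, hgood n hn]
  have hfin2 : ∀ r, Hr r → toA e9 * r = toA e9 → toA e5 * r = toA e5 → ∀ d ∈ DD, ∀ k < 12,
      toA f45 * r = mu (2 ^ k) (toA (phi B45 d.1)) → P r := by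
    intro r hr h9 h5 d hd k hk h
    have hi := pow_inv12 hk
    apply hmu _ _ hi
    refine hfin _ (Hr_mu hr hi) ?_ ?_ d hd ?_
    · rw [← mu2_fix ck_mu2.2.1 (12 - k), ← map_mul, h9]
    · rw [← mu2_fix ck_mu2.1 (12 - k), ← map_mul, h5]
    · rw [← mu2_fix ck_mu2.2.2 (12 - k), ← map_mul, h, mu_mu, hi, mu_one]
  have hst : ∀ e, muN 44 e = e → st (toA e) = toA e := fun e h => by rw [← toA_muN44, h]
  have h3 : ∀ r, Hr r → toA e9 * r = toA e9 → toA e5 * r = toA e5 → P r := by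
    intro r hr h9 h5
    obtain ⟨n, hn, h45⟩ := ideal_lemma ck_lt.2.2.2.2 ck_i45 r
    have hn0 : n ≠ 0 := by
      rintro rfl
      rw [phi_zero, toA_zero] at h45
      have : toA f45 * (r * st r) = 0 := by rw [← mul_assoc, h45, zero_mul]
      rw [hr.1, mul_add, E_J ck_J.2.2.2.2, mul_one, add_zero] at this
      exact f45_ne this
    have hb : (cov DD 0).testBit n = true := by
      rw [ck_cov, show (2 ^ 4096 - 2 : ℕ) = (2^4095 - 1) * 2 ^ 1 from pw 4095, Nat.testBit_mul_two_pow,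
        Nat.testBit_two_pow_sub_one]
      simp; omega
    rcases cov_spec DD 0 n hb with h | ⟨d, hd, k, hk, h | h⟩
    · simp at h
    · exact hfin2 r hr h9 h5 d hd k hk (h45.trans h)
    · apply hmu (-1) (-1) (by decide)
      have hr' : Hr (st r) := Hr_mu hr (u := -1) (v := -1) (by decide)
      refine hfin2 (st r) hr' ?_ ?_ d hd k hk ?_
      · rw [← hst _ ck_st.2.2, ← map_mul, h9]
      · rw [← hst _ ck_st.2.1, ← map_mul, h5]
      · have hw := wchk_all d hd
        have hw' : bi (Nat.beq (mulN (phi B45 d.1) (phi B45 d.2.1)) f45)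
          (wgo (Nat.xor (phi B45 d.1) (muN 44 (phi B45 d.2.1))) lows d.2.2) false = true := hw
        rw [bi_eq] at hw'
        split_ifs at hw' with h1
        have hm := Nat.eq_of_beq_eq_true h1
        have plt := fun n => phi_lt ck_blt.2.2.2.2.1 n
        have ab : toA f45 * toA (phi B45 d.1) = toA (phi B45 d.1) := phi_absorb (fun b hb => by
          rw [← toA_mulN _ _ (ck_blt.2.2.2.2.1 b hb), ck_abs b hb]) _
        have hm2 : toA (phi B45 d.1) * toA (phi B45 d.2.1) = toA f45 := by
          rw [← toA_mulN _ _ (plt _), hm]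
        have hm3 := congrArg (mu (2 ^ k)) hm2
        have ab3 := congrArg (mu (2 ^ k)) ab
        rw [map_mul, mu2_fix ck_mu2.2.2, ← h, ← h45] at hm3
        rw [map_mul, mu2_fix ck_mu2.2.2] at ab3
        calc toA f45 * st r = (mu (2^k) (toA (phi B45 d.1)) * (toA f45 * r)) * st r := by rw [hm3]
          _ = (toA f45 * (r * st r)) * mu (2^k) (toA (phi B45 d.1)) := by ring
          _ = toA f45 * mu (2^k) (toA (phi B45 d.1)) := by
              rw [hr.1, mul_add, E_J ck_J.2.2.2.2, mul_one, add_zero]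
          _ = _ := ab3
  have h2 : ∀ r, Hr r → toA e9 * r = toA e9 → P r := by
    intro r hr h9
    obtain ⟨n, hn, h5⟩ := ideal_lemma ck_lt.2.1 ck_i5 r
    obtain ⟨k, hk, h⟩ := ck_5 n hn (e_norm ck_lt.2.1 (phi_lt ck_blt.2.1 _) ck_id.2.1 ck_st.2.1 ck_J.2.1 hr h5)
    apply hX (-((9 * k : ℕ) : ZMod 45))
    have hk' := congrArg toA (ck_rot k hk)
    rw [h, toA_rotN (by omega) ck_lt.2.1] at h5
    rw [toA_rotN (by omega) ck_lt.2.2.1] at hk'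
    refine h3 _ (Hr_X hr _) ?_ ?_
    · rw [mul_left_comm, h9]
      nth_rw 1 [← hk']
      rw [← mul_assoc, mul_comm (X _), X_neg, one_mul]
    · rw [mul_left_comm, h5, ← mul_assoc, mul_comm (X _), X_neg, one_mul]
  intro r hr
  obtain ⟨n, hn, h9⟩ := ideal_lemma ck_lt.2.2.1 ck_i9 r
  obtain ⟨k, hk, h⟩ := ck_9 n hn (e_norm ck_lt.2.2.1 (phi_lt ck_blt.2.2.1 _) ck_id.2.2.1 ck_st.2.2 ck_J.2.2.1 hr h9)
  apply hX (-((k : ℕ) : ZMod 45))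
  rw [h, toA_rotN (by omega) ck_lt.2.2.1] at h9
  refine h2 _ (Hr_X hr _) ?_
  rw [mul_left_comm, h9, ← mul_assoc, mul_comm (X _), X_neg, one_mul]

end DC

namespace DC

/-! lanes -/
theorem ones_eq (n : ℕ) : ones n = 2 ^ n - 1 := by
  change (1 <<< n) - 1 = _; rw [Nat.one_shiftLeft]
theorem ones_tb (n t : ℕ) : (ones n).testBit t = decide (t < n) := by rw [ones_eq, Nat.testBit_two_pow_sub_one]

def WF (n : ℕ) (row : ℕ × List ℕ) : Prop := row.2.length = n ∧ (row.1 ≠ 0 → ∀ x ∈ row.2, x < 2 ^ row.1)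
def Rep (row : ℕ × List ℕ) (bs : List Bool) : Prop := ∃ t < row.1, row.2.map (fun x => x.testBit t) = bs

theorem zipS_cons (s o q : ℕ) (l l' : List ℕ) : zipS s (o :: l) (q :: l') = (o ||| (q <<< s)) :: zipS s l l' := rfl
theorem zipS_len (s : ℕ) (l : List ℕ) : ∀ l' : List ℕ, l.length = l'.length → (zipS s l l').length = l.length := by
  induction l with
  | nil => intro l' h; rfl
  | cons o l ih =>
    intro l' h
    match l', h with
    | q :: l', h => rw [zipS_cons]; simp only [List.length_cons] at h ⊢; rw [ih l' (by omega)]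
theorem zipS_left (s t : ℕ) (ht : t < s) (l : List ℕ) : ∀ l' : List ℕ, l.length = l'.length →
    (zipS s l l').map (fun x => x.testBit t) = l.map (fun x => x.testBit t) := by
  induction l with
  | nil => intro l' h; rfl
  | cons o l ih =>
    intro l' h
    match l', h with
    | q :: l', h =>
      rw [zipS_cons, List.map_cons, List.map_cons, ih l' (by simpa using h), Nat.testBit_or, Nat.testBit_shiftLeft]
      simp [show ¬ s ≤ t by omega]
theorem zipS_right (s t : ℕ) (l : List ℕ) : (∀ x ∈ l, x < 2 ^ s) → ∀ l' : List ℕ, l.length = l'.length →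
    (zipS s l l').map (fun x => x.testBit (s + t)) = l'.map (fun x => x.testBit t) := by
  induction l with
  | nil => intro _ l' h; rw [List.length_eq_zero_iff.mp h.symm]; rfl
  | cons o l ih =>
    intro hl l' h
    match l', h with
    | q :: l', h =>
      rw [zipS_cons, List.map_cons, List.map_cons, ih (fun x hx => hl x (List.mem_cons_of_mem _ hx)) l' (by simpa using h),
        Nat.testBit_or, Nat.testBit_shiftLeft,
        Nat.testBit_lt_two_pow ((hl o (by simp)).trans_le (Nat.pow_le_pow_right (by norm_num) (Nat.le_add_right s t)))]
      simp
theorem zipS_lt (s u : ℕ) (l : List ℕ) : (∀ x ∈ l, x < 2 ^ s) → ∀ l' : List ℕ, (∀ x ∈ l', x < 2 ^ u) → l.length = l'.length →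
    ∀ x ∈ zipS s l l', x < 2 ^ (s + u) := by
  induction l with
  | nil => intro _ l' _ h x hx; exact absurd hx (List.not_mem_nil)
  | cons o l ih =>
    intro hl l' hl' h
    match l', h, hl' with
    | q :: l', h, hl' =>
      rw [zipS_cons]
      intro x hx
      rcases List.mem_cons.mp hx with rfl | hx
      · refine Nat.or_lt_two_pow ((hl o (by simp)).trans_le (Nat.pow_le_pow_right (by norm_num) (Nat.le_add_right s u))) ?_
        rw [Nat.shiftLeft_eq, pow_add, mul_comm]
        exact Nat.mul_lt_mul_of_pos_left (hl' q (by simp)) (Nat.two_pow_pos s)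
      · exact ih (fun x hx => hl x (List.mem_cons_of_mem _ hx)) l' (fun x hx => hl' x (List.mem_cons_of_mem _ hx)) (by simpa using h) x hx

theorem comb_fst (p c : ℕ × List ℕ) : (comb p c).1 = c.1 + p.1 := rfl
theorem comb_snd (p c : ℕ × List ℕ) : (comb p c).2 = ((ones p.1) <<< c.1) ::
    (if p.1 = 0 then c.2 else if c.1 = 0 then p.2 else zipS c.1 c.2 p.2) := by
  change _ :: bi (Nat.beq p.1 0) c.2 (bi (Nat.beq c.1 0) p.2 (zipS c.1 c.2 p.2)) = _
  rw [bi_eq, bi_eq]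
  simp only [Nat.beq_eq]
  rfl
theorem comb_WF {n : ℕ} {p c : ℕ × List ℕ} (hp : WF n p) (hc : WF n c) : WF (n+1) (comb p c) := by
  refine ⟨?_, ?_⟩
  · rw [comb_snd, List.length_cons]
    split_ifs
    · rw [hc.1]
    · rw [hp.1]
    · rw [zipS_len _ _ _ (by rw [hc.1, hp.1]), hc.1]
  · rw [comb_fst, comb_snd]
    intro h0 x hx
    rcases List.mem_cons.mp hx with rfl | hx
    · rw [Nat.shiftLeft_eq, pow_add, mul_comm, ones_eq]
      have := Nat.two_pow_pos p.1
      exact Nat.mul_lt_mul_of_pos_left (by omega) (Nat.two_pow_pos _)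
    · split_ifs at hx with h1 h2
      · rw [h1, add_zero]; exact hc.2 (by omega) x hx
      · rw [h2, zero_add]; exact hp.2 h1 x hx
      · exact zipS_lt _ _ _ (hc.2 h2) _ (hp.2 h1) (by rw [hc.1, hp.1]) x hx
theorem comb_left {n : ℕ} {p c : ℕ × List ℕ} (hp : WF n p) (hc : WF n c) {bs : List Bool} (h : Rep c bs) :
    Rep (comb p c) (false :: bs) := by
  obtain ⟨t, ht, h⟩ := h
  refine ⟨t, by rw [comb_fst]; omega, ?_⟩
  rw [comb_snd, List.map_cons, Nat.testBit_shiftLeft]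
  congr 1
  · simp [show ¬ c.1 ≤ t by omega]
  · split_ifs with h1 h2
    · exact h
    · omega
    · rw [zipS_left _ _ ht _ _ (by rw [hc.1, hp.1]), h]
theorem comb_right {n : ℕ} {p c : ℕ × List ℕ} (hp : WF n p) (hc : WF n c) {bs : List Bool} (h : Rep p bs) :
    Rep (comb p c) (true :: bs) := by
  obtain ⟨t, ht, h⟩ := h
  refine ⟨c.1 + t, by rw [comb_fst]; omega, ?_⟩
  rw [comb_snd, List.map_cons, Nat.testBit_shiftLeft, Nat.add_sub_cancel_left, ones_tb]
  congr 1
  · simp [ht]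
  · split_ifs with h1 h2
    · omega
    · rw [h2, zero_add]; exact h
    · rw [zipS_right _ _ _ (hc.2 h2) _ (by rw [hc.1, hp.1]), h]

theorem stepR_cons (m n k : ℕ) (c p : ℕ × List ℕ) (l : List (ℕ × List ℕ)) : stepR m n (c :: l) k p =
    (if m * (n + 1) ≤ 45 * (k + 1) then comb p c else (0, 0 :: c.2)) :: stepR m n l (k + 1) c := by
  change bi (Nat.ble (m * (n+1)) (45 * (k + 1))) (comb p c) (0, 0 :: c.2) :: stepR m n l (k + 1) c = _
  rw [bi_eq]; simp only [Nat.ble_eq]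
theorem stepR_len (m n : ℕ) (l : List (ℕ × List ℕ)) : ∀ k p, (stepR m n l k p).length = l.length := by
  induction l with
  | nil => intro k p; rfl
  | cons c l ih => intro k p; rw [stepR_cons, List.length_cons, List.length_cons, ih]
theorem stepR_get (m n : ℕ) (l : List (ℕ × List ℕ)) : ∀ k p i q c, (p :: l)[i]? = some q → l[i]? = some c →
    (stepR m n l k p)[i]? = some (if m * (n + 1) ≤ 45 * (k + i + 1) then comb q c else (0, 0 :: c.2)) := by
  induction l with
  | nil => intro k p i q c _ h; simp at h
  | cons x l ih =>
    intro k p i q c h1 h2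
    rw [stepR_cons]
    cases i with
    | zero => simp only [List.getElem?_cons_zero, Option.some.injEq] at h1 h2 ⊢; subst h1 h2; rfl
    | succ i =>
      simp only [List.getElem?_cons_succ] at h1 h2 ⊢
      rw [ih (k+1) x i q c h1 h2]
      rw [show k + 1 + i + 1 = k + (i + 1) + 1 by omega]

def dl (a : ℕ → Bool) : ℕ → List Bool
  | 0 => []
  | n + 1 => a (n + 1) :: dl a n

theorem rows_succ (m n : ℕ) : rows m (n+1) = stepR m (n+1) (rows m n) 0 (0, zeroL n) := rfl
theorem zeroL_len (n : ℕ) : (zeroL n).length = n := by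
  induction n with
  | zero => rfl
  | succ n ih => exact congrArg Nat.succ ih
theorem rows_len (m n : ℕ) (hm : 0 < m) : (rows m n).length = m := by
  induction n with
  | zero => change ((1, []) :: List.replicate (m - 1) ((0 : ℕ), ([] : List ℕ))).length = m; simp; omega
  | succ n ih => rw [rows_succ, stepR_len, ih]

theorem rows_spec (m : ℕ) (hm : 0 < m) (n : ℕ) : ∀ k < m, ∃ row, (rows m n)[k]? = some row ∧ WF n row ∧
    ∀ a : ℕ → Bool, a 0 = true → Nat.count (fun i => a i = true) (n + 1) = k + 1 →
      (∀ L ≤ n + 1, m * L ≤ 45 * Nat.count (fun i => a i = true) L) → Rep row (dl a n) := by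
  induction n with
  | zero =>
    intro k hk
    have h0 : rows m 0 = (1, []) :: List.replicate (m - 1) ((0 : ℕ), ([] : List ℕ)) := rfl
    rw [h0]
    cases k with
    | zero => exact ⟨_, rfl, ⟨rfl, by simp⟩, fun a _ _ _ => ⟨0, by simp, rfl⟩⟩
    | succ k =>
      refine ⟨(0, []), ?_, ⟨rfl, by simp⟩, ?_⟩
      · rw [List.getElem?_cons_succ, List.getElem?_replicate, if_pos (by omega)]
      · intro a ha hc
        simp [Nat.count_succ, ha] at hc
  | succ n ih =>
    intro k hk
    obtain ⟨c, hc, wc, sc⟩ := ih k hk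
    have hq : ∃ q, ((0, zeroL n) :: rows m n)[k]? = some q ∧ WF n q ∧ ∀ a : ℕ → Bool, a 0 = true → Nat.count (fun i => a i = true) (n + 1) = k →
      (∀ L ≤ n + 1, m * L ≤ 45 * Nat.count (fun i => a i = true) L) → Rep q (dl a n) := by
      cases k with
      | zero =>
        refine ⟨_, rfl, ⟨zeroL_len n, by simp⟩, ?_⟩
        intro a ha h
        rw [Nat.count_succ'] at h
        simp [ha] at h
      | succ k =>
        obtain ⟨q, h1, h2, h3⟩ := ih k (by omega)
        exact ⟨q, by rw [List.getElem?_cons_succ]; exact h1, h2, h3⟩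
    obtain ⟨q, hq, wq, sq⟩ := hq
    refine ⟨_, by rw [rows_succ]; exact stepR_get m (n+1) _ 0 _ k q c hq hc, ?_, ?_⟩
    · split_ifs
      · exact comb_WF wq wc
      · exact ⟨by simp [wc.1], by simp⟩
    · intro a ha hcnt hL
      have h1 := hL (n + 1 + 1) le_rfl
      rw [hcnt] at h1
      rw [if_pos (by rw [zero_add]; exact h1)]
      have hL' : ∀ L ≤ n + 1, m * L ≤ 45 * Nat.count (fun i => a i = true) L := fun L h => hL L (by omega)
      rw [Nat.count_succ] at hcnt
      change Rep _ (a (n+1) :: dl a n)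
      by_cases hb : a (n+1) = true
      · rw [hb]
        rw [if_pos hb] at hcnt
        exact comb_right wq wc (sq a ha (by omega) hL')
      · rw [if_neg hb] at hcnt
        rw [Bool.not_eq_true] at hb
        rw [hb]
        exact comb_left wq wc (sc a ha (by omega) hL')

theorem lastD_eq (l : List (ℕ × List ℕ)) : ∀ d, lastD l d = l.getLast?.getD d := by
  induction l with
  | nil => intro d; rfl
  | cons x l ih =>
    intro d
    change lastD l x = _
    rw [ih, List.getLast?_cons]; rfl
theorem lastD_spec (m n : ℕ) (hm : 0 < m) : WF n (lastD (rows m n) (0, [])) ∧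
    ∀ a : ℕ → Bool, a 0 = true → Nat.count (fun i => a i = true) (n + 1) = m →
      (∀ L ≤ n + 1, m * L ≤ 45 * Nat.count (fun i => a i = true) L) → Rep (lastD (rows m n) (0, [])) (dl a n) := by
  obtain ⟨row, h, w, s⟩ := rows_spec m hm n (m - 1) (by omega)
  have : lastD (rows m n) (0, []) = row := by
    rw [lastD_eq, List.getLast?_eq_getElem?, rows_len m n hm, h]; rfl
  rw [this]
  refine ⟨w, fun a ha hc hL => s a ha (by omega) hL⟩

/-! linear forms and counters -/
def b2 (b : Bool) : ZMod 2 := if b then 1 else 0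
theorem b2_xor (a b : Bool) : b2 (a ^^ b) = b2 a + b2 b := by cases a <;> cases b <;> decide
theorem b2_inj {a b : Bool} (h : b2 a = b2 b) : a = b := by revert h; cases a <;> cases b <;> decide
theorem lin_cons (z x : ℕ) (l : List ℕ) (m : ℕ) : lin z (x :: l) m =
    if m.testBit 0 then x ^^^ lin z l (m >>> 1) else lin z l (m >>> 1) := by
  change bi (Nat.beq (m &&& 1) 0) (lin z l (m >>> 1)) (x ^^^ lin z l (m >>> 1)) = _
  rw [bi_eq, Nat.and_one_is_mod, Nat.testBit_zero]
  rcases Nat.mod_two_eq_zero_or_one m with h | h <;> rw [h] <;> rfl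
theorem lin_spec (z t : ℕ) (l : List ℕ) : ∀ m, b2 ((lin z l m).testBit t) =
    b2 (z.testBit t) + ∑ i ∈ Finset.range l.length, b2 (m.testBit i) * b2 ((l.getD i 0).testBit t) := by
  induction l with
  | nil => intro m; change b2 (z.testBit t) = _; simp
  | cons x l ih =>
    intro m
    rw [lin_cons, List.length_cons, Finset.sum_range_succ']
    have h : ∀ i, (m >>> 1).testBit i = m.testBit (i + 1) := fun i => by rw [Nat.testBit_shiftRight, add_comm]
    simp only [List.getD_cons_succ, List.getD_cons_zero]
    have ih' := ih (m >>> 1)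
    simp only [h] at ih'
    split_ifs with h1
    · rw [Nat.testBit_xor, b2_xor, ih', h1, show b2 true = 1 from rfl]; ring
    · rw [ih']; rw [Bool.not_eq_true] at h1; rw [h1, show b2 false = 0 from rfl]; ring

theorem tb_nat (b t : ℕ) : (b >>> t) &&& 1 = (b.testBit t).toNat := by
  rw [Nat.and_one_is_mod, Nat.testBit_eq_decide_div_mod_eq, Nat.shiftRight_eq_div_pow]
  rcases Nat.mod_two_eq_zero_or_one (b / 2 ^ t) with h | h <;> simp [h]
theorem valP_cons (b : ℕ) (l : List ℕ) (p : ℕ) : valP (b :: l) p = (b.testBit p).toNat + 2 * valP l p := by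
  change ((b >>> p) &&& 1) + 2 * valP l p = _
  rw [tb_nat]
theorem valP_lt (l : List ℕ) (p : ℕ) : valP l p < 2 ^ l.length := by
  induction l with
  | nil => exact Nat.one_pos
  | cons b l ih =>
    rw [valP_cons, List.length_cons, pow_succ]
    have := Bool.toNat_lt (b.testBit p)
    omega
theorem addB_len (l : List ℕ) : ∀ c, (addB l c).length = l.length := by
  induction l with
  | nil => intro c; rfl
  | cons b l ih => intro c; exact congrArg Nat.succ (ih _)
theorem addB_spec (l : List ℕ) (p : ℕ) : ∀ c, ∃ e, valP (addB l c) p + 2 ^ l.length * e = valP l p + (c.testBit p).toNat := by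
  induction l with
  | nil => intro c; exact ⟨(c.testBit p).toNat, by change 0 + 1 * _ = 0 + _; omega⟩
  | cons b l ih =>
    intro c
    obtain ⟨e, he⟩ := ih (b &&& c)
    refine ⟨e, ?_⟩
    change valP ((b ^^^ c) :: addB l (b &&& c)) p + _ = _
    rw [valP_cons, valP_cons, List.length_cons, pow_succ]
    rw [Nat.testBit_and] at he
    rw [Nat.testBit_xor]
    rw [show 2 ^ l.length * 2 * e = 2 * (2 ^ l.length * e) by ring]
    revert he
    cases b.testBit p <;> cases c.testBit p <;> simp <;> omega
theorem addB_exact (l : List ℕ) (p c : ℕ) (h : valP l p + 1 < 2 ^ l.length) :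
    valP (addB l c) p = valP l p + (c.testBit p).toNat := by
  obtain ⟨e, he⟩ := addB_spec l p c
  have := Bool.toNat_lt (c.testBit p)
  cases e with
  | zero => simpa using he
  | succ e =>
    rw [mul_add, mul_one] at he
    omega

theorem eqP_cons (z b : ℕ) (l : List ℕ) (v : ℕ) : eqP z (b :: l) v =
    (if v % 2 = 0 then b ^^^ z else b) &&& eqP z l (v / 2) := by
  change bi (Nat.beq (v &&& 1) 0) (b ^^^ z) b &&& eqP z l (v >>> 1) = _
  rw [bi_eq, Nat.and_one_is_mod, Nat.shiftRight_one]
  rcases Nat.mod_two_eq_zero_or_one v with h | h <;> rw [h] <;> rfl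
theorem eqP_spec (z t : ℕ) (hz : z.testBit t = true) (l : List ℕ) : ∀ v, valP l t = v → (eqP z l v).testBit t = true := by
  induction l with
  | nil => intro v _; exact hz
  | cons b l ih =>
    intro v hv
    rw [valP_cons] at hv
    rw [eqP_cons, Nat.testBit_and, ih (v / 2) (by have := Bool.toNat_lt (b.testBit t); omega), Bool.and_true]
    cases hb : b.testBit t <;> rw [hb] at hv <;> simp only [Bool.toNat_false, Bool.toNat_true] at hv
    · rw [if_pos (by omega), Nat.testBit_xor, hb, hz]; rfl
    · rw [if_neg (by omega), hb]

theorem ext_succ (f off g : ℕ) (acc : List ℕ) : ext (f + 1) off g acc = if g = 0 then acc else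
    ext f off (g &&& ones (2 ^ f)) (ext f (off + 2 ^ f) (g >>> 2 ^ f) acc) := by
  change bi (Nat.beq g 0) acc (ext f off (g &&& ones (2 ^ f)) (ext f (off + 2 ^ f) (g >>> 2 ^ f) acc)) = _
  rw [bi_eq]; simp only [Nat.beq_eq]
theorem ext_zero (off g : ℕ) (acc : List ℕ) : ext 0 off g acc = if g = 0 then acc else off :: acc := by
  change bi (Nat.beq g 0) acc (off :: acc) = _
  rw [bi_eq]; simp only [Nat.beq_eq]
theorem ext_acc (f : ℕ) : ∀ off g acc x, x ∈ acc → x ∈ ext f off g acc := by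
  induction f with
  | zero => intro off g acc x hx; rw [ext_zero]; split_ifs <;> simp [hx]
  | succ f ih =>
    intro off g acc x hx
    rw [ext_succ]; split_ifs
    · exact hx
    · exact ih _ _ _ _ (ih _ _ _ _ hx)
theorem ext_spec (f : ℕ) : ∀ off g acc t, t < 2 ^ f → g.testBit t = true → off + t ∈ ext f off g acc := by
  induction f with
  | zero =>
    intro off g acc t ht hg
    have : t = 0 := by simpa using ht
    subst this
    rw [ext_zero, if_neg (by rintro rfl; simp at hg)]; simp
  | succ f ih =>
    intro off g acc t ht hg
    rw [ext_succ, if_neg (by rintro rfl; simp at hg)]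
    rw [pow_succ] at ht
    by_cases h : t < 2 ^ f
    · exact ih _ _ _ _ h (by rw [Nat.testBit_and, hg, ones_tb]; simp [h])
    · refine ext_acc _ _ _ _ _ ?_
      have := ih (off + 2 ^ f) (g >>> 2 ^ f) acc (t - 2 ^ f) (by omega) (by
        rw [Nat.testBit_shiftRight, show 2 ^ f + (t - 2 ^ f) = t by omega, hg])
      rwa [show off + 2 ^ f + (t - 2 ^ f) = off + t by omega] at this

theorem bt_eq (x t : ℕ) : bt x t = (x >>> t) &&& 1 := by
  have h1 : x &&& (1 <<< t) = 0 ↔ x.testBit t = false := by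
    rw [Nat.one_shiftLeft, Nat.and_two_pow]
    cases x.testBit t <;> simp
  have h2 : (x >>> t) &&& 1 = (x.testBit t).toNat := by
    rw [Nat.and_one_is_mod, Nat.testBit_eq_decide_div_mod_eq, Nat.shiftRight_eq_div_pow]
    rcases Nat.mod_two_eq_zero_or_one (x / 2 ^ t) with h | h <;> simp [h]
  rw [h2]
  change bi (Nat.beq (x &&& (1 <<< t)) 0) 0 1 = _
  cases hb : x.testBit t with
  | false => rw [h1.2 hb]; rfl
  | true =>
    have : Nat.beq (x &&& (1 <<< t)) 0 = false := by
      refine Bool.eq_false_iff.2 fun h => ?_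
      rw [h1.1 (Nat.eq_of_beq_eq_true h)] at hb; exact absurd hb (by simp)
    rw [this]; rfl

theorem dec_spec (t : ℕ) (l : List ℕ) : ∀ acc i, (dec t l acc).testBit i =
    if i < l.length then (l.getD (l.length - 1 - i) 0).testBit t else acc.testBit (i - l.length) := by
  induction l with
  | nil => intro acc i; change acc.testBit i = _; simp
  | cons x l ih =>
    intro acc i
    change (dec t l ((acc <<< 1) ||| bt x t)).testBit i = _
    rw [bt_eq]
    rw [ih, List.length_cons]
    rcases lt_trichotomy i l.length with h | h | h
    · rw [if_pos h, if_pos (by omega), show l.length + 1 - 1 - i = (l.length - 1 - i) + 1 by omega, List.getD_cons_succ]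
    · rw [if_neg (by omega), if_pos (by omega), show l.length + 1 - 1 - i = 0 by omega, List.getD_cons_zero,
        show i - l.length = 0 by omega, Nat.testBit_or, Nat.testBit_shiftLeft, tb_nat]
      cases x.testBit t <;> simp
    · rw [if_neg (by omega), if_neg (by omega), Nat.testBit_or, Nat.testBit_shiftLeft, tb_nat]
      rw [show i - l.length - 1 = i - (l.length + 1) by omega]
      obtain ⟨j, hj⟩ : ∃ j, i - l.length = j + 1 := ⟨i - l.length - 1, by omega⟩
      rw [hj]
      cases x.testBit t <;> simp [Nat.testBit_succ]

end DC

namespace DC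

theorem cmpl_lt (r a : ℕ) : cmpl r a < 2^45 := Nat.xor_lt_two_pow (by norm_num [M45]) (mulN_lt _ _)
theorem toA_cmpl {r : ℕ} (hr : r < 2^45) (a : ℕ) : toA (cmpl r a) = J + toA a * toA r := by
  change toA (M45 ^^^ mulN a r) = _
  rw [toA_xor, ← J_eq, toA_mulN _ _ hr]
theorem toA_coeff_b2 (n : ℕ) (i : ZMod 45) : (toA n).coeff i = b2 (n.testBit i.val) := rfl

theorem cmpl_bit {r : ℕ} (hr : r < 2^45) (a : ℕ) {j : ℕ} (hj : j < 45) : b2 ((cmpl r a).testBit j) =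
    1 + ∑ i ∈ Finset.range 45, b2 (a.testBit i) * b2 (r.testBit ((j + 45 - i) % 45)) := by
  have h1 : b2 ((cmpl r a).testBit j) = (toA (cmpl r a)).coeff (j : ZMod 45) := (toA_coeff' _ j hj).symm
  rw [h1, toA_cmpl hr, AddMonoidAlgebra.coeff_add, Finsupp.add_apply, coeff_mulA,
    show J.coeff (j : ZMod 45) = 1 from rfl]
  refine congrArg (fun x : ZMod 2 => 1 + x) ?_
  rw [← Fin.sum_univ_eq_sum_range (fun i => b2 (a.testBit i) * b2 (r.testBit ((j + 45 - i) % 45))) 45]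
  refine Finset.sum_congr rfl fun i _ => ?_
  change (toA a).coeff i * (toA r).coeff ((j : ZMod 45) - i) = b2 (a.testBit i.val) * b2 (r.testBit ((j + 45 - i.val) % 45))
  rw [toA_coeff_b2, toA_coeff_b2]
  have := val_sub_nat (j : ZMod 45) i.val (ZMod.val_lt i).le
  rw [show ((i.val : ℕ) : ZMod 45) = i by simp, ZMod.val_natCast, Nat.mod_eq_of_lt hj] at this
  rw [this]

theorem lane_lin {r a t z : ℕ} (hr : r < 2^45) (hz : z.testBit t = true) {l : List ℕ} (hl : l.length = 45)
    (hb : ∀ i < 45, (l.getD i 0).testBit t = a.testBit (44 - i)) {j : ℕ} (hj : j < 45) :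
    (lin z l (rotN (44 - j) r)).testBit t = (cmpl r a).testBit j := by
  apply b2_inj
  rw [lin_spec, cmpl_bit hr a hj, hz, hl, show b2 true = 1 from rfl, ← Finset.sum_range_reflect]
  refine congrArg (fun x : ZMod 2 => 1 + x) ?_
  refine Finset.sum_congr rfl fun i hi => ?_
  have hi : i < 45 := Finset.mem_range.mp hi
  rw [hb _ (by omega), rotN_testBit (by omega) hr (by omega), mul_comm,
    show 44 - (45 - 1 - i) = i by omega, show 45 - 1 - i + 45 - (44 - j) = j + 45 - i by omega]

theorem pcX_succ (a n : ℕ) : pcX a (n+1) = pcX a n + (a.testBit n).toNat := by rw [← tb_nat]; rfl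
theorem pcX_le (a n : ℕ) : pcX a n ≤ n := by
  induction n with
  | zero => exact le_rfl
  | succ n ih => rw [pcX_succ]; have := Bool.toNat_lt (a.testBit n); omega
theorem pcX_count (a n : ℕ) : pcX a n = Nat.count (fun i => a.testBit i = true) n := by
  induction n with
  | zero => rfl
  | succ n ih => rw [pcX_succ, ih, Nat.count_succ]; cases a.testBit n <;> rfl

theorem lane_cnt {r a t z : ℕ} (hr : r < 2^45) (hz : z.testBit t = true) {l : List ℕ} (hl : l.length = 45)
    (hb : ∀ i < 45, (l.getD i 0).testBit t = a.testBit (44 - i)) (n : ℕ) (hn : n ≤ 45) :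
    (cntD z l r n).length = 6 ∧ valP (cntD z l r n) t = pcX (cmpl r a) n := by
  induction n with
  | zero =>
    refine ⟨rfl, ?_⟩
    change valP [0,0,0,0,0,0] t = 0
    simp only [valP_cons, Nat.zero_testBit]; rfl
  | succ n ih =>
    obtain ⟨h1, h2⟩ := ih (by omega)
    have h3 : cntD z l r (n+1) = addB (cntD z l r n) (lin z l (rotN (44 - n) r)) := rfl
    rw [h3]
    refine ⟨by rw [addB_len, h1], ?_⟩
    have := pcX_le (cmpl r a) n
    rw [addB_exact _ _ _ (by rw [h1, h2]; omega), h2, pcX_succ, lane_lin hr hz hl hb (by omega)]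

theorem dl_len (a : ℕ → Bool) (n : ℕ) : (dl a n).length = n := by
  induction n with
  | zero => rfl
  | succ n ih => exact congrArg Nat.succ ih
theorem dl_getD (a : ℕ → Bool) (n : ℕ) : ∀ i < n, (dl a n).getD i false = a (n - i) := by
  induction n with
  | zero => intro i hi; omega
  | succ n ih =>
    intro i hi
    change (a (n+1) :: dl a n).getD i false = _
    cases i with
    | zero => rfl
    | succ i => rw [List.getD_cons_succ, ih i (by omega)]; congr 1; omega

theorem row_le : (lastD (rows 3 44) (0, [])).1 ≤ 2 ^ 20 ∧ (lastD (rows 5 44) (0, [])).1 ≤ 2 ^ 20 ∧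
    (lastD (rows 7 44) (0, [])).1 ≤ 2 ^ 20 := by decide +kernel

theorem cand_mem {r a m : ℕ} (hr : r < 2^45) (ha : a < 2^45) (hm : 0 < m)
    (hrow : (lastD (rows m 44) (0, [])).1 ≤ 2 ^ 20) (h0 : a.testBit 0 = true) (hpc : pc a = m)
    (hL : ∀ L ≤ 45, m * L ≤ 45 * pcX a L) (hc : pc (cmpl r a) = 14 - m) : a ∈ cand r m := by
  obtain ⟨w, s⟩ := lastD_spec m 44 hm
  obtain ⟨t, ht, h⟩ := s (fun i => a.testBit i) h0 (by rw [← pcX_count]; exact hpc)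
    (fun L h => by rw [← pcX_count]; exact hL L h)
  generalize hrw : lastD (rows m 44) (0, []) = row at *
  have hl : (row.2 ++ [ones row.1]).length = 45 := by simp [w.1]
  have hz : (ones row.1).testBit t = true := by rw [ones_tb]; simp [ht]
  have hb : ∀ i < 45, ((row.2 ++ [ones row.1]).getD i 0).testBit t = a.testBit (44 - i) := by
    intro i hi
    by_cases h44 : i < 44
    · rw [List.getD_append _ _ _ _ (by rw [w.1]; exact h44)]
      have := dl_getD (fun i => a.testBit i) 44 i h44
      rw [← h] at this
      rw [← this]
      have e := List.getD_map (n := i) row.2 0 (fun x : ℕ => x.testBit t)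
      rw [← e]; simp
    · have : i = 44 := by omega
      subst this
      rw [List.getD_append_right _ _ _ _ (by rw [w.1]), w.1]
      simp [hz, h0]
  unfold cand
  rw [hrw]
  unfold candR
  refine List.mem_map.mpr ⟨t, ?_, ?_⟩
  · have := ext_spec 20 0 (eqP (ones row.1) (cntD (ones row.1) (row.2 ++ [ones row.1]) r 45) (14 - m)) [] t (by omega)
      (eqP_spec _ _ hz _ _ ((lane_cnt hr hz hl hb 45 le_rfl).2.trans hc))
    rwa [zero_add] at this
  · apply Nat.eq_of_testBit_eq
    intro i
    rw [dec_spec, hl]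
    split_ifs with hi
    · rw [hb _ (by omega)]; congr 1; omega
    · rw [Nat.zero_testBit]
      exact (Nat.testBit_lt_two_pow (ha.trans_le (Nat.pow_le_pow_right (by norm_num) (by omega)))).symm

theorem cand_lt {r m : ℕ} (hm : 0 < m) : ∀ a ∈ cand r m, a < 2^45 := by
  intro a ha
  obtain ⟨w, _⟩ := lastD_spec m 44 hm
  obtain ⟨t, _, rfl⟩ := List.mem_map.mp ha
  apply lt45
  intro i hi
  rw [dec_spec, if_neg (by simp [w.1]; omega), Nat.zero_testBit]

/-- cycle lemma -/
theorem cycle {a m : ℕ} (ha : a < 2^45) (hpc : pc a = m) : ∃ i < 45, ∀ L ≤ 45, m * L ≤ 45 * pcX (rotN (45 - i) a) L := by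
  let q : ℕ → Prop := fun n => a.testBit (n % 45) = true
  have c45 : ∀ n ≤ 45, Nat.count q n = pcX a n := by
    intro n hn
    rw [pcX_count]
    have : ∀ n ≤ 45, Nat.count q n = Nat.count (fun i => a.testBit i = true) n := by
      intro n
      induction n with
      | zero => intro _; rfl
      | succ n ih =>
        intro hn
        rw [Nat.count_succ, Nat.count_succ, ih (by omega)]
        simp only [q, Nat.mod_eq_of_lt (show n < 45 by omega)]
    exact this n hn
  have hper : ∀ n, Nat.count q (45 + n) = m + Nat.count q n := by
    intro n
    rw [Nat.count_add, c45 45 le_rfl]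
    congr 1
    simp only [q, Nat.add_mod_left]
  obtain ⟨i, hi, hmin⟩ := Finset.exists_min_image (Finset.range 45) (fun n => (45 : ℤ) * Nat.count q n - m * n) ⟨0, by simp⟩
  have hi : i < 45 := Finset.mem_range.mp hi
  refine ⟨i, hi, ?_⟩
  intro L hL
  have h1 : pcX (rotN (45 - i) a) L = Nat.count (fun k => q (i + k)) L := by
    rw [pcX_count]
    have : ∀ n ≤ 45, Nat.count (fun k => (rotN (45 - i) a).testBit k = true) n = Nat.count (fun k => q (i + k)) n := by
      intro n
      induction n with
      | zero => intro _; rfl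
      | succ n ih =>
        intro hn
        rw [Nat.count_succ, Nat.count_succ, ih (by omega)]
        simp only [q]
        rw [rotN_testBit (by omega) ha (by omega), show (n + 45 - (45 - i)) % 45 = (i + n) % 45 by congr 1; omega]
    exact this L hL
  have h2 := Nat.count_add q i L
  rw [← h1] at h2
  by_cases hc : i + L < 45
  · have := hmin (i + L) (Finset.mem_range.mpr hc)
    simp only [h2] at this
    push_cast at this
    zify
    nlinarith
  · have := hmin (i + L - 45) (Finset.mem_range.mpr (by omega))
    have h3 := hper (i + L - 45)
    rw [show 45 + (i + L - 45) = i + L by omega, h2] at h3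
    have h4 : ((i + L - 45 : ℕ) : ℤ) = i + L - 45 := by omega
    rw [h4] at this
    zify at h3 ⊢
    nlinarith

end DC

namespace DC

theorem wt_perm {x y : A} (e : ZMod 45 ≃ ZMod 45) (h : ∀ i, y.coeff i = x.coeff (e i)) : wt y = wt x := by
  unfold wt
  refine Finset.card_equiv e ?_
  intro i; simp [h]
theorem wt_X (k : ZMod 45) (x : A) : wt (X k * x) = wt x :=
  wt_perm (Equiv.subRight k) (fun i => by rw [X_mul_coeff]; rfl)
theorem wt_st (x : A) : wt (st x) = wt x :=
  wt_perm (Equiv.neg _) (fun i => by rw [st_coeff]; rfl)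
theorem eps_wt (x : A) : eps x = (wt x : ZMod 2) := by
  unfold eps wt
  rw [Finset.card_filter, Nat.cast_sum]
  refine Finset.sum_congr rfl fun i _ => ?_
  rcases z2 (x.coeff i) with h | h <;> rw [h] <;> simp
theorem eps_one_iff (x : A) : eps x = 1 ↔ wt x % 2 = 1 := by
  rw [eps_wt, show (1 : ZMod 2) = ((1 : ℕ) : ZMod 2) from rfl, ZMod.natCast_eq_natCast_iff']
theorem J_ne : J ≠ 0 := by
  intro h
  have := eps_J
  rw [h] at this
  simp [eps] at this
theorem Hr_eps {r : A} (h : Hr r) : eps r = 0 := by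
  have h2 := h.2
  rw [J_mul] at h2
  rcases z2 (eps r) with h3 | h3
  · exact h3
  · rw [h3, one_smul] at h2; exact absurd h2 J_ne

def IsB (r a c : A) : Prop := c = J + a * r ∧ eps a = 1 ∧ wt a + wt c = 14
theorem X_mul_J (k : ZMod 45) : X k * J = J := by rw [mul_comm, J_mul, eps_X, one_smul]
theorem IsB_X {r a c : A} (h : IsB r a c) (k : ZMod 45) : IsB r (X k * a) (X k * c) := by
  refine ⟨?_, ?_, ?_⟩
  · rw [h.1, mul_add, X_mul_J, mul_assoc]
  · rw [eps_mul, eps_X, h.2.1, one_mul]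
  · rw [wt_X, wt_X, h.2.2]
theorem IsB_swap {r a c : A} (hr : Hr r) (h : IsB r a c) : IsB r (st c) (st a) := by
  have e0 : ∀ x : A, eps (st x) = eps x := fun x => by rw [eps_wt, wt_st, ← eps_wt]
  refine ⟨?_, ?_, ?_⟩
  · rw [h.1, map_add, map_mul, st_J, add_mul, hr.2, zero_add, mul_assoc, mul_comm (st r), hr.1, mul_add, mul_one,
      mul_comm _ J, J_mul, e0, h.2.1, one_smul, add_comm (st a), ← add_assoc, A_two, zero_add]
  · rw [e0, h.1, eps_add, eps_J, eps_mul, Hr_eps hr, mul_zero, add_zero]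
  · rw [wt_st, wt_st, add_comm, h.2.2]

theorem tb_iff (n : ℕ) (i : ZMod 45) : n.testBit i.val = true ↔ (toA n).coeff i = 1 := by
  rw [toA_coeff]; cases n.testBit i.val <;> simp

/-! trees -/
theorem lst_nd (l r : Tr) (y : ℕ) (acc : List ℕ) : (Tr.nd l y r).lst acc = l.lst (y :: r.lst acc) := rfl
theorem lst_acc (t : Tr) : ∀ acc z, z ∈ t.lst acc ↔ z ∈ t.lst [] ∨ z ∈ acc := by
  induction t with
  | lf => intro acc z; change z ∈ acc ↔ z ∈ [] ∨ z ∈ acc; simp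
  | nd l y r ihl ihr =>
    intro acc z
    rw [lst_nd, lst_nd, ihl, ihl (y :: r.lst []), List.mem_cons, List.mem_cons, ihr acc]
    tauto
theorem mem_nd (l r : Tr) (y z : ℕ) : z ∈ (Tr.nd l y r).lst [] ↔ z ∈ l.lst [] ∨ z = y ∨ z ∈ r.lst [] := by
  rw [lst_nd, lst_acc, List.mem_cons]
theorem ins_nd (x y : ℕ) (l r : Tr) : Tr.ins x (.nd l y r) =
   if Nat.beq x y then .nd l y r else if Nat.ble x y then .nd (l.ins x) y r else .nd l y (r.ins x) := by
  change bi (Nat.beq x y) (Tr.nd l y r) (bi (Nat.ble x y) (Tr.nd (l.ins x) y r) (Tr.nd l y (r.ins x))) = _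
  rw [bi_eq, bi_eq]
theorem mem_ins (x z : ℕ) (t : Tr) : z ∈ (t.ins x).lst [] ↔ z = x ∨ z ∈ t.lst [] := by
  induction t with
  | lf => change z ∈ (Tr.nd .lf x .lf).lst [] ↔ z = x ∨ z ∈ Tr.lst .lf []
          rw [mem_nd]; change z ∈ [] ∨ z = x ∨ z ∈ [] ↔ z = x ∨ z ∈ []; simp
  | nd l y r ihl ihr =>
    rw [ins_nd]
    split_ifs with h1 h2
    · rw [mem_nd, Nat.eq_of_beq_eq_true h1]; tauto
    · rw [mem_nd, mem_nd, ihl]; tauto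
    · rw [mem_nd, mem_nd, ihr]; tauto

def G (a c n z : ℕ) : Prop := ∃ i < n, (a.testBit i = true ∧ z = idN (rotN (45 - i) a) (rotN (45 - i) c)) ∨
  (c.testBit i = true ∧ z = idN (rotN i (muN 44 c)) (rotN i (muN 44 a)))

theorem mem_gens (a c n z : ℕ) : ∀ t : Tr, z ∈ (gens a c n t).lst [] ↔ z ∈ t.lst [] ∨ G a c n z := by
  induction n with
  | zero => intro t; change z ∈ t.lst [] ↔ _; simp [G]
  | succ n ih =>
    intro t
    have hG : G a c (n+1) z ↔ G a c n z ∨ (a.testBit n = true ∧ z = idN (rotN (45 - n) a) (rotN (45 - n) c)) ∨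
        (c.testBit n = true ∧ z = idN (rotN n (muN 44 c)) (rotN n (muN 44 a))) := by
      constructor
      · rintro ⟨i, hi, h⟩
        rcases Nat.lt_succ_iff_lt_or_eq.mp hi with h' | rfl
        · exact Or.inl ⟨i, h', h⟩
        · exact Or.inr h
      · rintro (⟨i, hi, h⟩ | h)
        · exact ⟨i, by omega, h⟩
        · exact ⟨n, by omega, h⟩
    have e : gens a c (n+1) t = gens a c n (bi (bit c n) (Tr.ins (idN (rotN n (muN 44 c)) (rotN n (muN 44 a)))
      (bi (bit a n) (Tr.ins (idN (rotN (45 - n) a) (rotN (45 - n) c)) t) t))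
      (bi (bit a n) (Tr.ins (idN (rotN (45 - n) a) (rotN (45 - n) c)) t) t)) := rfl
    rw [e, ih, hG, bi_eq, bi_eq, bit_eq, bit_eq]
    split_ifs with h1 h2 h2
    · rw [mem_ins, mem_ins]; simp only [h1, h2, true_and]; tauto
    · rw [mem_ins]; simp only [h1, h2, true_and, Bool.false_eq_true, false_and]; tauto
    · rw [mem_ins]; simp only [h1, h2, true_and, Bool.false_eq_true, false_and]; tauto
    · simp only [h1, h2, Bool.false_eq_true, false_and]; tauto

def Val (r a : ℕ) : Prop := pc a % 2 = 1 ∧ pc a + pc (cmpl r a) = 14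

theorem mem_build (r z : ℕ) (l : List ℕ) : ∀ t : Tr, z ∈ (build r l t).lst [] ↔
    z ∈ t.lst [] ∨ ∃ a ∈ l, Val r a ∧ G a (cmpl r a) 45 z := by
  induction l with
  | nil => intro t; change z ∈ t.lst [] ↔ _; simp
  | cons a l ih =>
    intro t
    have e : build r (a :: l) t = build r l (bi (bi (Nat.beq (pc a &&& 1) 1)
      (Nat.beq (pc a + pc (cmpl r a)) 14) false) (gens a (cmpl r a) 45 t) t) := rfl
    have hv : bi (Nat.beq (pc a &&& 1) 1) (Nat.beq (pc a + pc (cmpl r a)) 14) false = true ↔ Val r a := by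
      rw [bi_eq, Nat.and_one_is_mod]
      unfold Val
      split_ifs with h
      · simp only [Nat.beq_eq] at h ⊢; tauto
      · simp only [Nat.beq_eq] at h
        simp [h]
    rw [e, ih, bi_eq, List.exists_mem_cons_iff]
    split_ifs with h1 <;> rw [hv] at h1
    · rw [mem_gens]; simp only [h1, true_and]; tauto
    · simp only [h1, false_and, false_or]

noncomputable def clist (r : ℕ) : List ℕ := 1 :: (cand r 3 ++ (cand r 5 ++ cand r 7))
theorem clist_lt (r : ℕ) : ∀ a ∈ clist r, a < 2^45 := by
  intro a ha
  rcases List.mem_cons.mp ha with rfl | ha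
  · norm_num
  · rcases List.mem_append.mp ha with ha | ha
    · exact cand_lt (by norm_num) a ha
    · rcases List.mem_append.mp ha with ha | ha
      · exact cand_lt (by norm_num) a ha
      · exact cand_lt (by norm_num) a ha

theorem eq_one_of {a : ℕ} (ha : a < 2^45) (h0 : a.testBit 0 = true) (h : pc a = 1) : a = 1 := by
  rw [pc_eq] at h
  unfold wt at h
  obtain ⟨j, hj⟩ := Finset.card_eq_one.mp h
  have h0' : (toA a).coeff 0 = 1 := (tb_iff a 0).mp h0
  have m0 : (0 : ZMod 45) ∈ ({j} : Finset (ZMod 45)) := by rw [← hj]; simp [h0']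
  have : (0 : ZMod 45) = j := by simpa using m0
  subst this
  apply toA_inj ha (by norm_num)
  rw [toA_one, ← X_zero]
  apply A_ext
  intro i
  rw [X_coeff]
  have hi := Finset.ext_iff.mp hj i
  simp only [Finset.mem_filter, Finset.mem_univ, true_and, Finset.mem_singleton] at hi
  split_ifs with h1
  · rw [← h1, h0']
  · by_contra h2; exact h1 (hi.mp h2).symm

theorem core {r a : ℕ} {c : A} (hr : r < 2^45) (ha : a < 2^45) (h : IsB (toA r) (toA a) c) (hw : wt (toA a) ≤ 7) :
    ∃ b ∈ clist r, Val r b ∧ ∃ k : ZMod 45, toA a = X k * toA b := by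
  obtain ⟨i, hi, hL⟩ := cycle ha rfl
  set b := rotN (45 - i) a with hb
  have hbA : toA b = X ((45 - i : ℕ) : ZMod 45) * toA a := toA_rotN (by omega) ha
  have hB := IsB_X h ((45 - i : ℕ) : ZMod 45)
  rw [← hbA] at hB
  have hpb : pc b = pc a := by rw [pc_eq, hbA, wt_X, pc_eq]
  rw [← pc_eq] at hw
  have hodd : pc a % 2 = 1 := by rw [pc_eq]; exact (eps_one_iff _).mp h.2.1
  have hval : Val r b := by
    refine ⟨by rw [hpb, hodd], ?_⟩
    rw [pc_eq, pc_eq, toA_cmpl hr, ← hB.1]; exact hB.2.2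
  have hb0 : b.testBit 0 = true := by
    have := hL 1 (by norm_num)
    rw [pcX_succ] at this
    by_contra hc
    rw [Bool.not_eq_true] at hc
    rw [hc] at this
    change _ ≤ 45 * (0 + 0) at this
    omega
  have hblt : b < 2^45 := rotN_lt _ _
  refine ⟨b, ?_, hval, -((45 - i : ℕ) : ZMod 45), ?_⟩
  · have h4 : pc a = 1 ∨ pc a = 3 ∨ pc a = 5 ∨ pc a = 7 := by omega
    have hc : ∀ m, pc a = m → pc (cmpl r b) = 14 - m := by intro m hm; have := hval.2; omega
    rcases h4 with h4 | h4 | h4 | h4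
    · rw [eq_one_of hblt hb0 (hpb.trans h4)]; simp [clist]
    · refine List.mem_cons_of_mem _ (List.mem_append_left _ ?_)
      exact cand_mem hr hblt (by norm_num) row_le.1 hb0 (hpb.trans h4) (by rw [← h4]; exact hL) (hc _ h4)
    · refine List.mem_cons_of_mem _ (List.mem_append_right _ (List.mem_append_left _ ?_))
      exact cand_mem hr hblt (by norm_num) row_le.2.1 hb0 (hpb.trans h4) (by rw [← h4]; exact hL) (hc _ h4)
    · refine List.mem_cons_of_mem _ (List.mem_append_right _ (List.mem_append_right _ ?_))
      exact cand_mem hr hblt (by norm_num) row_le.2.2 hb0 (hpb.trans h4) (by rw [← h4]; exact hL) (hc _ h4)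
  · rw [hbA, ← mul_assoc, mul_comm (X _) (X _), X_neg, one_mul]

theorem cast_sub45 {i : ℕ} (hi : i ≤ 45) : ((45 - i : ℕ) : ZMod 45) = -(i : ZMod 45) := by
  rw [Nat.cast_sub hi, show ((45 : ℕ) : ZMod 45) = 0 from rfl, zero_sub]

theorem blocks_mem {r : ℕ} (hr : r < 2^45) (hH : Hr (toA r)) (z : ℕ) : z ∈ blocks r ↔
    ∃ a < 2^45, ∃ c < 2^45, z = idN a c ∧ IsB (toA r) (toA a) (toA c) ∧ a.testBit 0 = true := by
  have e : blocks r = (build r (clist r) Tr.lf).lst [] := rfl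
  rw [e, mem_build]
  have hlf : z ∉ Tr.lf.lst [] := by change z ∉ []; simp
  simp only [hlf, false_or]
  constructor
  · rintro ⟨a, ha, hv, i, hi, h⟩
    have halt := clist_lt r a ha
    have hB : IsB (toA r) (toA a) (toA (cmpl r a)) :=
      ⟨toA_cmpl hr a, (eps_one_iff _).mpr (by rw [← pc_eq]; exact hv.1), by rw [← pc_eq, ← pc_eq]; exact hv.2⟩
    rcases h with ⟨hb, rfl⟩ | ⟨hb, rfl⟩
    · refine ⟨_, rotN_lt _ _, _, rotN_lt _ _, rfl, ?_, ?_⟩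
      · rw [toA_rotN (by omega) halt, toA_rotN (by omega) (cmpl_lt _ _)]
        exact IsB_X hB _
      · rw [rotN_testBit (by omega) halt (by norm_num), show (0 + 45 - (45 - i)) % 45 = i by omega, hb]
    · refine ⟨_, rotN_lt _ _, _, rotN_lt _ _, rfl, ?_, ?_⟩
      · rw [toA_rotN (by omega) (muN_lt _ _), toA_rotN (by omega) (muN_lt _ _), toA_muN44, toA_muN44]
        exact IsB_X (IsB_swap hH hB) _
      · refine (tb_iff _ 0).mpr ?_
        rw [toA_rotN (by omega) (muN_lt _ _), toA_muN44, X_mul_coeff, st_coeff, zero_sub, neg_neg, toA_coeff' _ _ hi, hb]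
        rfl
  · rintro ⟨a, ha, c, hc, rfl, hB, h0⟩
    have h0' : (toA a).coeff 0 = 1 := (tb_iff a 0).mp h0
    have hsw := IsB_swap hH hB
    rw [← toA_muN44, ← toA_muN44] at hsw
    have hodd := (eps_one_iff _).mp hB.2.1
    have hodd' := (eps_one_iff _).mp hsw.2.1
    rw [toA_muN44, wt_st] at hodd'
    have h14 := hB.2.2
    by_cases hw : wt (toA a) ≤ 7
    · obtain ⟨b, hb, hv, k, hk⟩ := core hr ha hB hw
      have hbl := clist_lt r b hb
      have hcc : toA c = X k * toA (cmpl r b) := by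
        rw [hB.1, hk, toA_cmpl hr, mul_add, X_mul_J, mul_assoc]
      have hi := ZMod.val_lt (-k)
      refine ⟨b, hb, hv, (-k).val, hi, Or.inl ⟨?_, ?_⟩⟩
      · rw [tb_iff]
        rw [hk, X_mul_coeff, zero_sub] at h0'
        exact h0'
      · have hcast : ((45 - (-k).val : ℕ) : ZMod 45) = k := by rw [cast_sub45 hi.le]; simp
        congr 1
        · apply toA_inj ha (rotN_lt _ _)
          rw [toA_rotN (by omega) hbl, hcast, hk]
        · apply toA_inj hc (rotN_lt _ _)
          rw [toA_rotN (by omega) (cmpl_lt _ _), hcast, hcc]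
    · obtain ⟨b, hb, hv, k, hk⟩ := core hr (muN_lt _ _) hsw (by rw [toA_muN44, wt_st]; omega)
      have hbl := clist_lt r b hb
      have hcc : toA (muN 44 a) = X k * toA (cmpl r b) := by
        rw [hsw.1, hk, toA_cmpl hr, mul_add, X_mul_J, mul_assoc]
      rw [toA_muN44] at hk hcc
      have hk' : toA c = X (-k) * st (toA b) := by
        rw [← st_st (toA c), hk, map_mul, mu_X, neg_one_mul]
      have hcc' : toA a = X (-k) * st (toA (cmpl r b)) := by
        rw [← st_st (toA a), hcc, map_mul, mu_X, neg_one_mul]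
      have hi := ZMod.val_lt (-k)
      refine ⟨b, hb, hv, (-k).val, hi, Or.inr ⟨?_, ?_⟩⟩
      · rw [tb_iff]
        rw [hcc', X_mul_coeff, zero_sub, st_coeff, neg_neg] at h0'
        exact h0'
      · have hcast : (((-k).val : ℕ) : ZMod 45) = -k := by simp
        congr 1
        · apply toA_inj ha (rotN_lt _ _)
          rw [toA_rotN hi.le (muN_lt _ _), hcast, hcc', toA_muN44]
        · apply toA_inj hc (rotN_lt _ _)
          rw [toA_rotN hi.le (muN_lt _ _), hcast, hk', toA_muN44]

/-! sortedness and counting -/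
theorem sortedB_cons (y x n : ℕ) (l : List ℕ) : sortedB (y :: l) x n = true ↔ x < y ∧ 0 < n ∧ sortedB l y (n - 1) = true := by
  change bi (Nat.blt x y) (bi (Nat.ble n 0) false (sortedB l y (n - 1))) false = true ↔ _
  rw [bi_eq, bi_eq]
  have h1 : Nat.blt x y = true ↔ x < y := by simp [Nat.blt_eq]
  have h2 : Nat.ble n 0 = true ↔ n = 0 := by simp
  rw [if_congr h1 rfl rfl, if_congr h2 rfl rfl]
  split_ifs with h3 h4
  · subst h4; simp
  · simp only [h3, true_and, Nat.pos_of_ne_zero h4]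
  · simp [h3]
theorem sortedB_spec (l : List ℕ) : ∀ x n, sortedB l x n = true → l.length ≤ n ∧ (∀ z ∈ l, x < z) ∧ l.Nodup := by
  induction l with
  | nil => intro x n _; simp
  | cons y l ih =>
    intro x n h
    rw [sortedB_cons] at h
    obtain ⟨h1, h2, h3⟩ := ih _ _ h.2.2
    refine ⟨by rw [List.length_cons]; omega, ?_, ?_⟩
    · intro z hz
      rcases List.mem_cons.mp hz with rfl | hz
      · exact h.1
      · exact h.1.trans (h2 z hz)
    · exact List.nodup_cons.mpr ⟨fun hy => lt_irrefl _ (h2 y hy), h3⟩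
theorem cnt8_spec (p : ℕ) (l : List ℕ) : ∀ pl : List ℕ, valP pl p + l.length < 2 ^ pl.length →
    valP (cnt8 l pl) p = valP pl p + (l.filter (fun x => x.testBit p)).length := by
  induction l with
  | nil => intro pl _; rfl
  | cons x l ih =>
    intro pl h
    rw [List.length_cons] at h
    change valP (cnt8 l (addB pl x)) p = _
    have e := addB_exact pl p x (by omega)
    have := Bool.toNat_lt (x.testBit p)
    rw [ih _ (by rw [addB_len, e]; omega), e, List.filter_cons]
    cases x.testBit p
    · simp
    · simp; omega
noncomputable def TT (r : ℕ) (p : ℕ) : ℕ := ((blocks r).toFinset.filter (fun x => x.testBit p = true)).card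
theorem TT_spec {r : ℕ} (h : sortedB (blocks r) 0 255 = true) (p : ℕ) :
    valP (cnt8 (blocks r) [0,0,0,0,0,0,0,0]) p = TT r p := by
  obtain ⟨h1, _, h3⟩ := sortedB_spec _ _ _ h
  have h0 : valP [0,0,0,0,0,0,0,0] p = 0 := by
    simp only [valP_cons, Nat.zero_testBit]; rfl
  rw [cnt8_spec p _ _ (by rw [h0]; simp; omega), h0, zero_add]
  unfold TT
  rw [← List.toFinset_filter, List.toFinset_card_of_nodup (h3.filter _)]

end DC

namespace DC

section gen
variable {ι κ : Type} [Fintype ι] [Fintype κ]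

def Au (C : Submodule (ZMod 2) (ι → ZMod 2)) (σ : Equiv.Perm ι) : Prop := ∀ w, w ∈ C ↔ w ∘ σ ∈ C

theorem Au_iff (C : Submodule (ZMod 2) (ι → ZMod 2)) (σ : Equiv.Perm ι) :
    Submodule.map (LinearMap.funLeft (ZMod 2) (ZMod 2) ⇑σ) C = C ↔ Au C σ := by
  constructor
  · intro h w
    constructor
    · intro hw
      rw [← h]
      exact Submodule.mem_map.mpr ⟨w, hw, rfl⟩
    · intro hw
      rw [← h] at hw
      obtain ⟨u, hu, he⟩ := Submodule.mem_map.mp hw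
      have : u = w := by
        funext i
        have := congrFun he (σ.symm i)
        simpa [LinearMap.funLeft] using this
      rwa [← this]
  · intro h
    ext x
    rw [Submodule.mem_map]
    constructor
    · rintro ⟨w, hw, rfl⟩
      exact (h w).mp hw
    · intro hx
      refine ⟨x ∘ σ.symm, ?_, ?_⟩
      · rw [h]
        convert hx using 1
        funext i; simp
      · funext i; simp [LinearMap.funLeft]
theorem Au_one (C : Submodule (ZMod 2) (ι → ZMod 2)) : Au C 1 := fun w => Iff.rfl
theorem Au_mul {C : Submodule (ZMod 2) (ι → ZMod 2)} {σ τ : Equiv.Perm ι} (h1 : Au C σ) (h2 : Au C τ) : Au C (σ * τ) := by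
  intro w
  rw [h1 w, h2 (w ∘ σ)]; rfl
theorem Au_inv {C : Submodule (ZMod 2) (ι → ZMod 2)} {σ : Equiv.Perm ι} (h1 : Au C σ) : Au C σ⁻¹ := by
  intro w
  rw [h1 (w ∘ (σ⁻¹ : Equiv.Perm ι))]
  have : (w ∘ (σ⁻¹ : Equiv.Perm ι)) ∘ σ = w := by funext i; simp
  rw [this]

theorem dot_comp (π : ι ≃ κ) (x y : κ → ZMod 2) : dot (x ∘ π) (y ∘ π) = dot x y :=
  Equiv.sum_comp π (fun i => x i * y i)
theorem ham_comp (π : ι ≃ κ) (x : κ → ZMod 2) : hammingNorm (x ∘ π) = hammingNorm x := by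
  unfold hammingNorm
  exact Finset.card_equiv π (by intro i; simp)

/-- the final property -/
def PP (C : Submodule (ZMod 2) (ι → ZMod 2)) : Prop := IsSelfDual C → MinWeightIs C 16 → autGroupOrder C = 90

theorem PP_transfer (π : ι ≃ κ) (C : Submodule (ZMod 2) (ι → ZMod 2)) (D : Submodule (ZMod 2) (κ → ZMod 2))
    (h : ∀ w : κ → ZMod 2, w ∈ D ↔ w ∘ π ∈ C) (hD : PP D) : PP C := by
  have h' : ∀ w : ι → ZMod 2, w ∈ C ↔ w ∘ π.symm ∈ D := by
    intro w; rw [h]; convert Iff.rfl using 2; funext i; simp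
  have hcs : ∀ w : κ → ZMod 2, (w ∘ π) ∘ π.symm = w := fun w => by funext i; simp
  have hsc : ∀ w : ι → ZMod 2, (w ∘ π.symm) ∘ π = w := fun w => by funext i; simp
  intro hsd hmin
  have h1 : IsSelfDual D := by
    intro x
    rw [h, hsd]
    constructor
    · intro hx y hy
      rw [← dot_comp π]; exact hx _ ((h y).mp hy)
    · intro hx y hy
      rw [← hsc y, dot_comp]; exact hx _ ((h' y).mp hy)
  have h2 : MinWeightIs D 16 := by
    obtain ⟨⟨x, hx, hx0, hw⟩, hm⟩ := hmin
    refine ⟨⟨x ∘ π.symm, (h' x).mp hx, ?_, by rw [ham_comp, hw]⟩, ?_⟩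
    · intro h0; apply hx0; rw [← hsc x, h0]; rfl
    · intro y hy hy0
      rw [← ham_comp π]
      refine hm _ ((h y).mp hy) ?_
      intro h0; apply hy0; rw [← hcs y, h0]; rfl
  rw [← hD h1 h2]
  unfold autGroupOrder
  refine Nat.card_congr (Equiv.subtypeEquiv (Equiv.permCongr π) ?_)
  intro σ
  rw [Au_iff, Au_iff]
  have e : ∀ w : κ → ZMod 2, (w ∘ (Equiv.permCongr π σ)) ∘ π = (w ∘ π) ∘ σ := by
    intro w; funext i; simp
  constructor
  · intro ha w
    rw [h, h, e]; exact ha _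
  · intro ha w
    have := ha (w ∘ π.symm)
    rw [h, h, e, hsc] at this
    exact this

end gen

/-! the concrete code -/
abbrev Q := Option (ZMod 45) ⊕ Option (ZMod 45)
abbrev W := Q → ZMod 2
noncomputable def La (w : W) : A := fromFn fun i => w (Sum.inl (some i))
noncomputable def Ra (w : W) : A := fromFn fun i => w (Sum.inr (some i))
def mk (s : ZMod 2) (a : A) (t : ZMod 2) (c : A) : W :=
  Sum.elim (fun o => o.elim s a.coeff) (fun o => o.elim t c.coeff)
theorem mk_eta (w : W) : mk (w (Sum.inl none)) (La w) (w (Sum.inr none)) (Ra w) = w := by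
  funext q
  rcases q with (_ | i) | (_ | i) <;> rfl
theorem La_mk (s t a c) : La (mk s a t c) = a := A_ext fun _ => rfl
theorem Ra_mk (s t a c) : Ra (mk s a t c) = c := A_ext fun _ => rfl
theorem La_add (w w' : W) : La (w + w') = La w + La w' := A_ext fun _ => rfl
theorem Ra_add (w w' : W) : Ra (w + w') = Ra w + Ra w' := A_ext fun _ => rfl
theorem La_smul (x : ZMod 2) (w : W) : La (x • w) = x • La w := A_ext fun _ => rfl
theorem Ra_smul (x : ZMod 2) (w : W) : Ra (x • w) = x • Ra w := A_ext fun _ => rfl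
theorem eps_smul (x : ZMod 2) (a : A) : eps (x • a) = x * eps a := by
  rw [smul_eq]; rcases z2 x with h | h <;> rw [h] <;> simp [eps]

def CA (r : A) : Submodule (ZMod 2) W where
  carrier := {w | w (Sum.inr none) = eps (La w) ∧ Ra w = w (Sum.inl none) • J + La w * r}
  add_mem' := by
    rintro x y ⟨h1, h2⟩ ⟨h3, h4⟩
    refine ⟨?_, ?_⟩
    · rw [La_add, eps_add, ← h1, ← h3]; rfl
    · rw [La_add, Ra_add, h2, h4, Pi.add_apply, add_smul, add_mul]; abel
  zero_mem' := by
    have h0 : La (0 : W) = 0 := A_ext fun _ => rfl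
    have h1 : Ra (0 : W) = 0 := A_ext fun _ => rfl
    refine ⟨?_, ?_⟩
    · rw [h0]; simp [eps]
    · rw [h0, h1]; simp
  smul_mem' := by
    rintro x w ⟨h1, h2⟩
    refine ⟨?_, ?_⟩
    · rw [La_smul, eps_smul, ← h1]; rfl
    · rw [La_smul, Ra_smul, h2, Pi.smul_apply, smul_add, smul_eq_mul, mul_smul, smul_mul_assoc]

theorem mem_CA (r : A) (w : W) : w ∈ CA r ↔ w (Sum.inr none) = eps (La w) ∧ Ra w = w (Sum.inl none) • J + La w * r := Iff.rfl
theorem mk_mem (r : A) (s : ZMod 2) (a : A) : mk s a (eps a) (s • J + a * r) ∈ CA r := ⟨by rw [La_mk]; rfl, by rw [La_mk, Ra_mk]; rfl⟩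

theorem sum_Q {M : Type} [AddCommMonoid M] (f : Q → M) : ∑ q, f q =
    (f (Sum.inl none) + ∑ i, f (Sum.inl (some i))) + (f (Sum.inr none) + ∑ i, f (Sum.inr (some i))) := by
  rw [Fintype.sum_sum_type, Fintype.sum_option, Fintype.sum_option]
theorem z2val (x : ZMod 2) : (if x ≠ 0 then 1 else 0) = x.val := by revert x; decide
theorem ham_eq (w : W) : hammingNorm w = ((w (Sum.inl none)).val + wt (La w)) + ((w (Sum.inr none)).val + wt (Ra w)) := by
  unfold hammingNorm wt
  rw [Finset.card_filter, sum_Q, Finset.card_filter, Finset.card_filter, z2val, z2val]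
  rfl

theorem Wit_PP {r : A} (h : Wit r) : PP (CA r) := by
  intro _ hm
  obtain ⟨a, s, ha, hw⟩ := h
  exfalso
  have := hm.2 _ (mk_mem r s a) (by
    intro h0
    apply ha
    rw [← La_mk s (eps a) a (s • J + a * r), h0]; exact A_ext fun _ => rfl)
  rw [ham_eq, La_mk, Ra_mk] at this
  change 16 ≤ (s.val + wt a) + ((eps a).val + wt (s • J + a * r)) at this
  rw [add_comm (s • J)] at this
  omega

/-- dot of two words -/
theorem dot_mk (s t s' t' : ZMod 2) (a c a' c' : A) : dot (mk s a t c) (mk s' a' t' c') =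
    (s * s' + (a * st a').coeff 0) + (t * t' + (c * st c').coeff 0) := by
  have : ∀ x y : A, ∑ i, x.coeff i * y.coeff i = (x * st y).coeff 0 := by
    intro x y
    rw [coeff_mulA]
    refine Finset.sum_congr rfl fun i _ => ?_
    rw [st_coeff, zero_sub, neg_neg]
  unfold dot
  rw [sum_Q, ← this a a', ← this c c']
  rfl

theorem Hr_of_sd {r : A} (h : IsSelfDual (CA r)) : Hr r := by
  have key : ∀ x ∈ CA r, ∀ y ∈ CA r, dot x y = 0 := fun x hx => (h x).mp hx
  refine ⟨?_, ?_⟩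
  · apply A_ext
    intro k
    have := key _ (mk_mem r 0 1) _ (mk_mem r 0 (X k))
    rw [dot_mk, zero_smul, zero_add, zero_add, one_mul, map_mul, mu_X, one_mul, eps_one, eps_X, zero_mul, zero_add, one_mul,
      mul_left_comm, X_mul_coeff, X_coeff, neg_one_mul, zero_sub, neg_neg] at this
    rw [AddMonoidAlgebra.coeff_add, Finsupp.add_apply, show J.coeff k = 1 from rfl, ← X_zero, X_coeff]
    have e : (if (0 : ZMod 45) = k then (1 : ZMod 2) else 0) = if -k = 0 then 1 else 0 := by
      congr 1; rw [neg_eq_zero]; exact propext eq_comm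
    rw [e]
    revert this
    generalize (if -k = 0 then (1 : ZMod 2) else 0) = u
    generalize (r * st r).coeff k = v
    revert u v; decide
  · have := key _ (mk_mem r 1 0) _ (mk_mem r 0 1)
    rw [dot_mk, zero_smul, zero_add, zero_mul, one_smul, one_mul, zero_mul, add_zero] at this
    have e2 : eps 0 = 0 := by simp [eps]
    rw [e2, zero_mul, J_mul] at this
    have e3 : eps (st r) = eps r := by rw [eps_wt, wt_st, ← eps_wt]
    rw [one_mul r, e3] at this
    rw [J_mul]
    rcases z2 (eps r) with h | h
    · rw [h, zero_smul]
    · rw [h, one_smul] at this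
      exact absurd this (by change ¬ ((0 : ZMod 2) + 0 + (0 + 1) = 0); decide)

/-- relabelling -/
theorem PP_X (k : ZMod 45) (r : A) (h : PP (CA (X k * r))) : PP (CA r) := by
  refine PP_transfer (Equiv.sumCongr (Equiv.refl _) (Equiv.optionCongr (Equiv.addRight k))) _ _ ?_ h
  intro w
  have h1 : Ra w = X k * Ra (w ∘ (Equiv.sumCongr (Equiv.refl (Option (ZMod 45))) (Equiv.optionCongr (Equiv.addRight k)))) := by
    apply A_ext; intro i; rw [X_mul_coeff]
    change w (Sum.inr (some i)) = w (Sum.inr (some (i - k + k)))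
    rw [sub_add_cancel]
  rw [mem_CA, mem_CA, h1]
  change _ ∧ _ = w (Sum.inl none) • J + La w * (X k * r) ↔ _ ∧ _ = w (Sum.inl none) • J + La w * r
  refine and_congr Iff.rfl ?_
  constructor
  · intro h
    have := congrArg (fun x => X (-k) * x) h
    change X (-k) * _ = X (-k) * _ at this
    rw [← mul_assoc, mul_comm (X (-k)), X_neg, one_mul] at this
    rw [this, mul_add, mul_smul_comm, X_mul_J, mul_left_comm (La w), ← mul_assoc, mul_comm (X (-k)), X_neg, one_mul]
  · intro h
    rw [h, mul_add, mul_smul_comm, X_mul_J, mul_left_comm]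
theorem PP_mu (u v : ZMod 45) (huv : u * v = 1) (r : A) (h : PP (CA (mu u r))) : PP (CA r) := by
  let e : ZMod 45 ≃ ZMod 45 := ⟨fun i => u * i, fun i => v * i, fun i => by
    change v * (u * i) = i
    rw [← mul_assoc, mul_comm v, huv, one_mul], fun i => by
    change u * (v * i) = i
    rw [← mul_assoc, huv, one_mul]⟩
  refine PP_transfer (Equiv.sumCongr (Equiv.optionCongr e) (Equiv.optionCongr e)) _ _ ?_ h
  intro w
  set w' := w ∘ (Equiv.sumCongr (Equiv.optionCongr e) (Equiv.optionCongr e)) with hw'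
  have hvu : v * u = 1 := by rw [mul_comm, huv]
  have h1 : La w' = mu v (La w) := by
    apply A_ext; intro i; rw [mu_coeff v u hvu]; rfl
  have h2 : Ra w' = mu v (Ra w) := by
    apply A_ext; intro i; rw [mu_coeff v u hvu]; rfl
  have hJ := mu_J v u hvu
  have he : eps (mu v (La w)) = eps (La w) := by
    rw [eps_wt, eps_wt, wt_perm e (fun i => by rw [mu_coeff v u hvu]; rfl)]
  rw [mem_CA, mem_CA, h1, h2, he]
  refine and_congr Iff.rfl ?_
  change _ ↔ _ = w (Sum.inl none) • J + _
  constructor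
  · intro h
    rw [h, map_add, map_mul, mu_mu, hvu, mu_one, mu_smul, hJ]
  · intro h
    have := congrArg (mu u) h
    rw [mu_mu, huv, mu_one, map_add, mu_smul, mu_J u v huv, map_mul, mu_mu, huv, mu_one] at this
    exact this

/-- the bordered code -/
theorem bordered_PP (B : Matrix (Fin 46) (Fin 46) (ZMod 2)) (hB : IsBorderMatrix (n := 45) B)
    (h : ∀ r, PP (CA r)) : PP (borderedDCC (n := 45) B) := by
  obtain ⟨h00, h0j, hi0, R', ⟨v, rfl⟩, hR⟩ := hB
  let r : A := fromFn fun k => v (-k)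
  let π : Fin 46 ⊕ Fin 46 ≃ Q := Equiv.sumCongr (finSuccEquiv 45) (finSuccEquiv 45)
  refine PP_transfer π _ _ ?_ (h r)
  have hl0 : π (Sum.inl 0) = Sum.inl none := rfl
  have hr0 : π (Sum.inr 0) = Sum.inr none := rfl
  have hls : ∀ i : ZMod 45, π (Sum.inl (Fin.succ (n := 45) i)) = Sum.inl (some i) := fun i =>
    congrArg Sum.inl (finSuccEquiv_succ i)
  have hrs : ∀ i : ZMod 45, π (Sum.inr (Fin.succ (n := 45) i)) = Sum.inr (some i) := fun i =>
    congrArg Sum.inr (finSuccEquiv_succ i)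
  let row : Fin 46 → (Fin 46 ⊕ Fin 46 → ZMod 2) := fun i =>
    Sum.elim (fun j => if j = i then (1 : ZMod 2) else 0) (B i)
  -- rows as words
  have hrow0 : row 0 = mk 1 0 (eps 0) ((1 : ZMod 2) • J + 0 * r) ∘ π := by
    funext q
    rcases q with q | q
    · refine Fin.cases ?_ (fun (i : ZMod 45) => ?_) q
      · rfl
      · rw [Function.comp_apply, hls]
        change (if (Fin.succ (n := 45) i) = 0 then (1 : ZMod 2) else 0) = 0
        rw [if_neg (Fin.succ_ne_zero i)]
    · refine Fin.cases ?_ (fun (i : ZMod 45) => ?_) q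
      · rw [Function.comp_apply, hr0]
        change B 0 0 = eps 0
        rw [h00]; simp [eps]
      · rw [Function.comp_apply, hrs]
        change B 0 (Fin.succ (n := 45) i) = ((1 : ZMod 2) • J + 0 * r).coeff i
        rw [h0j _ (Fin.succ_ne_zero i), one_smul, zero_mul, add_zero]; rfl
  have hrowi : ∀ i : ZMod 45, row (Fin.succ (n := 45) i) = mk 0 (X i) (eps (X i)) ((0 : ZMod 2) • J + X i * r) ∘ π := by
    intro i
    funext q
    rcases q with q | q
    · refine Fin.cases ?_ (fun (j : ZMod 45) => ?_) q
      · rw [Function.comp_apply, hl0]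
        change (if 0 = (Fin.succ (n := 45) i) then (1 : ZMod 2) else 0) = 0
        rw [if_neg (Fin.succ_ne_zero i).symm]
      · rw [Function.comp_apply, hls]
        change (if (Fin.succ (n := 45) j) = (Fin.succ (n := 45) i) then (1 : ZMod 2) else 0) = (X i).coeff j
        rw [X_coeff]
        by_cases hij : i = j
        · subst hij; simp
        · rw [if_neg hij, if_neg (fun h => hij (Fin.succ_injective _ h).symm)]
    · refine Fin.cases ?_ (fun (j : ZMod 45) => ?_) q
      · rw [Function.comp_apply, hr0]
        change B (Fin.succ (n := 45) i) 0 = eps (X i)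
        rw [hi0 _ (Fin.succ_ne_zero i), eps_X]
      · rw [Function.comp_apply, hrs]
        change B (Fin.succ (n := 45) i) (Fin.succ (n := 45) j) = ((0 : ZMod 2) • J + X i * r).coeff j
        refine (hR i j).trans ?_
        rw [zero_smul, zero_add, X_mul_coeff]
        change v (i - j : ZMod 45) = v (-(j - i : ZMod 45))
        rw [neg_sub]
  have hrow_mem : ∀ i, row i ∘ π.symm ∈ CA r := by
    intro i
    refine Fin.cases ?_ (fun (j : ZMod 45) => ?_) i
    · rw [hrow0]
      have := mk_mem r 1 0
      convert this using 1
      funext q; simp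
    · rw [hrowi]
      have := mk_mem r 0 (X j)
      convert this using 1
      funext q; simp
  have hsub : ∀ x ∈ borderedDCC (n := 45) B, x ∘ π.symm ∈ CA r := by
    intro x hx
    unfold borderedDCC at hx
    induction hx using Submodule.span_induction with
    | mem x hx => obtain ⟨i, rfl⟩ := hx; exact hrow_mem i
    | zero => exact (CA r).zero_mem
    | add x y _ _ hx hy => exact (CA r).add_mem hx hy
    | smul a x _ hx => exact (CA r).smul_mem a hx
  intro w
  constructor
  · intro hw
    let u : Fin 46 ⊕ Fin 46 → ZMod 2 := ∑ i : Fin 46, w (π (Sum.inl i)) • row i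
    have hu : u ∈ borderedDCC (n := 45) B :=
      Submodule.sum_mem _ fun i _ => Submodule.smul_mem _ _ (Submodule.subset_span ⟨i, rfl⟩)
    have hul : ∀ j, u (Sum.inl j) = w (π (Sum.inl j)) := by
      intro j
      simp only [u, Finset.sum_apply, Pi.smul_apply, smul_eq_mul, row, Sum.elim_inl]
      simp
    have hd := (CA r).sub_mem hw (hsub u hu)
    set d := w - u ∘ π.symm with hdd
    have hdl : ∀ o, d (Sum.inl o) = 0 := by
      intro o
      obtain ⟨j, rfl⟩ := (finSuccEquiv 45).surjective o
      change w (Sum.inl (finSuccEquiv 45 j)) - u (Sum.inl ((finSuccEquiv 45).symm (finSuccEquiv 45 j))) = 0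
      rw [Equiv.symm_apply_apply, hul]; exact sub_self _
    have hLa : La d = 0 := A_ext fun i => hdl _
    have h2 := hd.2
    have h1 := hd.1
    rw [hLa, hdl, zero_smul, zero_mul, add_zero] at h2
    rw [hLa] at h1
    have hd0 : d = 0 := by
      funext q
      rcases q with o | (_ | i)
      · exact hdl o
      · rw [h1]; simp [eps]
      · change (Ra d).coeff i = 0
        rw [h2]; rfl
    have : w ∘ π = u := by
      have := sub_eq_zero.mp hd0
      rw [this]; funext q; simp
    rw [this]; exact hu
  · intro hw
    have := hsub _ hw
    convert this using 1
    funext q; simp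

end DC

namespace DC

theorem Au_of {C : Submodule (ZMod 2) W} {σ τ : Equiv.Perm Q} (hτ : ∀ q, σ (τ q) = q)
    (h1 : ∀ w ∈ C, w ∘ σ ∈ C) (h2 : ∀ w ∈ C, w ∘ τ ∈ C) : Au C σ := by
  intro w
  refine ⟨h1 w, fun h => ?_⟩
  have := h2 _ h
  have e : (w ∘ σ) ∘ τ = w := by funext q; simp [hτ]
  rwa [e] at this

/-- shift -/
def sh (k : ZMod 45) : Equiv.Perm Q :=
  Equiv.sumCongr (Equiv.optionCongr (Equiv.addRight k)) (Equiv.optionCongr (Equiv.addRight k))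
theorem sh_l (k i : ZMod 45) : sh k (Sum.inl (some i)) = Sum.inl (some (i + k)) := rfl
theorem sh_r (k i : ZMod 45) : sh k (Sum.inr (some i)) = Sum.inr (some (i + k)) := rfl
theorem sh_l0 (k : ZMod 45) : sh k (Sum.inl none) = Sum.inl none := rfl
theorem sh_r0 (k : ZMod 45) : sh k (Sum.inr none) = Sum.inr none := rfl
theorem sh_mem {r : A} (k : ZMod 45) (w : W) (h : w ∈ CA r) : w ∘ sh k ∈ CA r := by
  have h1 : La (w ∘ sh k) = X (-k) * La w := by
    apply A_ext; intro i; rw [X_mul_coeff, sub_neg_eq_add]; rfl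
  have h2 : Ra (w ∘ sh k) = X (-k) * Ra w := by
    apply A_ext; intro i; rw [X_mul_coeff, sub_neg_eq_add]; rfl
  obtain ⟨ha, hb⟩ := h
  refine ⟨?_, ?_⟩
  · rw [h1, eps_mul, eps_X, one_mul]; exact ha
  · rw [h1, h2, hb, mul_add, mul_smul_comm, X_mul_J, mul_assoc]; rfl
theorem sh_Au (r : A) (k : ZMod 45) : Au (CA r) (sh k) := by
  refine Au_of (τ := sh (-k)) ?_ (sh_mem k) (sh_mem (-k))
  rintro ((_ | i) | (_ | i))
  · rfl
  · rw [sh_l, sh_l, neg_add_cancel_right]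
  · rfl
  · rw [sh_r, sh_r, neg_add_cancel_right]

def tw : Equiv.Perm Q where
  toFun := Sum.elim (fun o => Sum.inr (o.map Neg.neg)) (fun o => Sum.inl (o.map Neg.neg))
  invFun := Sum.elim (fun o => Sum.inr (o.map Neg.neg)) (fun o => Sum.inl (o.map Neg.neg))
  left_inv := by rintro ((_ | i) | (_ | i)) <;> simp
  right_inv := by rintro ((_ | i) | (_ | i)) <;> simp
theorem tw_l (i : ZMod 45) : tw (Sum.inl (some i)) = Sum.inr (some (-i)) := rfl
theorem tw_r (i : ZMod 45) : tw (Sum.inr (some i)) = Sum.inl (some (-i)) := rfl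
theorem tw_mem {r : A} (hr : Hr r) (w : W) (h : w ∈ CA r) : w ∘ tw ∈ CA r := by
  have h1 : La (w ∘ tw) = st (Ra w) := by
    apply A_ext; intro i; rw [st_coeff]; rfl
  have h2 : Ra (w ∘ tw) = st (La w) := by
    apply A_ext; intro i; rw [st_coeff]; rfl
  have e0 : ∀ x : A, eps (st x) = eps x := fun x => by rw [eps_wt, wt_st, ← eps_wt]
  obtain ⟨ha, hb⟩ := h
  refine ⟨?_, ?_⟩
  · rw [h1, e0, hb, eps_add, eps_smul, eps_J, eps_mul, Hr_eps hr, mul_zero, add_zero, mul_one]; rfl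
  · rw [h1, h2, hb, map_add, map_mul, mu_smul, st_J, add_mul, mul_assoc, mul_comm (st r), hr.1, smul_mul_assoc, hr.2,
      smul_zero, zero_add, mul_add, mul_one, mul_comm (st (La w)), J_mul, e0]
    change _ = w (Sum.inr none) • J + _
    rw [ha, add_left_comm, A_two, add_zero]
theorem tw_Au {r : A} (hr : Hr r) : Au (CA r) tw :=
  Au_of (τ := tw) (by rintro ((_ | i) | (_ | i)) <;> simp [tw]) (tw_mem hr) (tw_mem hr)

/-! weights modulo 4 -/
theorem ham_add (x y : W) (h : dot x y = 0) : (hammingNorm (x + y)) % 4 = (hammingNorm x + hammingNorm y) % 4 := by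
  have h1 : hammingNorm (x + y) + 2 * (∑ q, if x q ≠ 0 ∧ y q ≠ 0 then 1 else 0) = hammingNorm x + hammingNorm y := by
    unfold hammingNorm
    rw [Finset.card_filter, Finset.card_filter, Finset.card_filter, Finset.mul_sum, ← Finset.sum_add_distrib, ← Finset.sum_add_distrib]
    refine Finset.sum_congr rfl fun q _ => ?_
    rw [Pi.add_apply]
    rcases z2 (x q) with hx | hx <;> rcases z2 (y q) with hy | hy <;> simp [hx, hy, show (1 + 1 : ZMod 2) = 0 from rfl]
  have h2 : (((∑ q, if x q ≠ 0 ∧ y q ≠ 0 then 1 else 0) : ℕ) : ZMod 2) = 0 := by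
    rw [Nat.cast_sum]
    refine Eq.trans ?_ h
    unfold dot
    refine Finset.sum_congr rfl fun q _ => ?_
    rcases z2 (x q) with hx | hx <;> rcases z2 (y q) with hy | hy <;> simp [hx, hy, show (1 + 1 : ZMod 2) = 0 from rfl]
  rw [ZMod.natCast_eq_zero_iff] at h2
  omega

def DQ (w : W) : Prop := (hammingNorm w + 2 * (w (Sum.inl none)).val + 2 * (w (Sum.inr none)).val) % 4 = 0
theorem DQ_add (x y : W) (h : dot x y = 0) (hx : DQ x) (hy : DQ y) : DQ (x + y) := by
  have h1 := ham_add x y h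
  have h2 : ∀ a b : ZMod 2, (a + b).val % 2 = (a.val + b.val) % 2 := by decide
  have h3 := h2 (x (Sum.inl none)) (y (Sum.inl none))
  have h4 := h2 (x (Sum.inr none)) (y (Sum.inr none))
  unfold DQ at *
  rw [Pi.add_apply, Pi.add_apply]
  omega

noncomputable def GW (r a : A) : W := mk 0 a (eps a) (a * r)
theorem GW_mem (r a : A) : GW r a ∈ CA r := by
  have := mk_mem r 0 a
  rwa [zero_smul, zero_add] at this
theorem mk_add (s a t c s' a' t' c') : mk s a t c + mk s' a' t' c' = mk (s + s') (a + a') (t + t') (c + c') := by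
  funext q; rcases q with (_ | i) | (_ | i) <;> rfl
theorem GW_add (r a b : A) : GW r (a + b) = GW r a + GW r b := by
  unfold GW; rw [mk_add, eps_add, add_mul, zero_add]
theorem wt_X1 (k : ZMod 45) : wt (X k) = 1 := by
  unfold wt
  rw [Finset.card_eq_one]
  refine ⟨k, ?_⟩
  ext i; rw [Finset.mem_filter, X_coeff, Finset.mem_singleton]
  by_cases h : k = i
  · subst h; simp
  · simp [h, Ne.symm h]
theorem eps_zero : eps 0 = 0 := by simp [eps]
theorem wt_zero : wt 0 = 0 := by simp [wt]
theorem wt_J : wt J = 45 := by simp [wt, J]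
theorem DQ_all {r : A} (hsd : IsSelfDual (CA r)) (h4 : wt r % 4 = 0) (w : W) (hw : w ∈ CA r) : DQ w := by
  have key : ∀ x ∈ CA r, ∀ y ∈ CA r, dot x y = 0 := fun x hx => (hsd x).mp hx
  have hG : ∀ a, DQ (GW r a) := by
    intro a
    rw [eq_sum_X a]
    refine Finset.sum_induction _ (fun a => DQ (GW r a)) ?_ ?_ ?_
    · intro a b ha hb
      rw [GW_add]
      exact DQ_add _ _ (key _ (GW_mem r a) _ (GW_mem r b)) ha hb
    · unfold DQ GW
      rw [ham_eq, La_mk, Ra_mk, zero_mul, wt_zero]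
      change (((0 : ZMod 2).val + 0) + ((eps 0).val + 0) + 2 * (0 : ZMod 2).val + 2 * (eps 0).val) % 4 = 0
      rw [eps_zero]; rfl
    · intro i _
      rcases z2 (a.coeff i) with h | h
      · rw [h, zero_smul]
        unfold DQ GW
        rw [ham_eq, La_mk, Ra_mk, zero_mul, wt_zero]
        change (((0 : ZMod 2).val + 0) + ((eps 0).val + 0) + 2 * (0 : ZMod 2).val + 2 * (eps 0).val) % 4 = 0
        rw [eps_zero]; rfl
      · rw [h, one_smul]
        unfold DQ GW
        rw [ham_eq, La_mk, Ra_mk, wt_X, wt_X1]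
        change (((0 : ZMod 2).val + 1) + ((eps (X i)).val + wt r) + 2 * (0 : ZMod 2).val + 2 * (eps (X i)).val) % 4 = 0
        rw [eps_X]
        change ((0 + 1) + (1 + wt r) + 2 * 0 + 2 * 1) % 4 = 0
        omega
  have h0 : mk 1 0 0 J ∈ CA r := by
    have := mk_mem r 1 0
    rwa [one_smul, zero_mul, add_zero, eps_zero] at this
  have hD0 : DQ (mk 1 0 0 J) := by
    unfold DQ
    rw [ham_eq, La_mk, Ra_mk, wt_zero, wt_J]
    rfl
  have hwe : w = mk (w (Sum.inl none)) (La w) (eps (La w)) (w (Sum.inl none) • J + La w * r) := by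
    rw [← hw.1, ← hw.2, mk_eta]
  rcases z2 (w (Sum.inl none)) with h | h
  · rw [h, zero_smul, zero_add] at hwe
    rw [hwe]; exact hG _
  · rw [h, one_smul] at hwe
    have : w = mk 1 0 0 J + GW r (La w) := by
      rw [hwe]; unfold GW; rw [mk_add, La_mk, add_zero, zero_add, zero_add]
    rw [this]
    exact DQ_add _ _ (key _ h0 _ (GW_mem r _)) hD0 (hG _)

theorem inf_inv {r : A} (hsd : IsSelfDual (CA r)) (hm : MinWeightIs (CA r) 16) (h4 : wt r % 4 = 0)
    {σ : Equiv.Perm Q} (hσ : Au (CA r) σ) :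
    (σ (Sum.inl none) = Sum.inl none ∧ σ (Sum.inr none) = Sum.inr none) ∨
    (σ (Sum.inl none) = Sum.inr none ∧ σ (Sum.inr none) = Sum.inl none) := by
  have hd : ∀ (p : Q) (w : W), dot (Pi.single p 1) w = w p := by
    intro p w; unfold dot
    rw [Finset.sum_eq_single p]
    · simp
    · intro q _ hq; rw [Pi.single_eq_of_ne hq, zero_mul]
    · intro h; exact absurd (Finset.mem_univ p) h
  have hda : ∀ x y w : W, dot (x + y) w = dot x w + dot y w := by
    intro x y w; unfold dot; rw [← Finset.sum_add_distrib]
    refine Finset.sum_congr rfl fun q _ => ?_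
    rw [Pi.add_apply, add_mul]
  set u : W := Pi.single (Sum.inl none) 1 + Pi.single (Sum.inr none) 1 + Pi.single (σ (Sum.inl none)) 1 +
    Pi.single (σ (Sum.inr none)) 1 with hu
  have huC : u ∈ CA r := by
    rw [hsd]
    intro w hw
    rw [hu, hda, hda, hda, hd, hd, hd, hd]
    have h1 := DQ_all hsd h4 w hw
    have h2 := DQ_all hsd h4 _ ((hσ w).mp hw)
    unfold DQ at h1 h2
    rw [ham_comp (ι := Q) (κ := Q) σ w] at h2
    rw [Function.comp_apply, Function.comp_apply] at h2
    generalize w (σ (Sum.inl none)) = a at *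
    generalize w (σ (Sum.inr none)) = b at *
    generalize w (Sum.inl none) = c at *
    generalize w (Sum.inr none) = d at *
    have h3 : (2 * c.val + 2 * d.val + 2 * a.val + 2 * b.val) % 4 = 0 := by omega
    clear h1 h2
    revert a b c d; decide
  have hu0 : u = 0 := by
    by_contra hne
    have h16 := hm.2 u huC hne
    have hle : hammingNorm u ≤ 4 := by
      unfold hammingNorm
      refine le_trans (Finset.card_le_card (t := {Sum.inl none, Sum.inr none, σ (Sum.inl none), σ (Sum.inr none)}) ?_) Finset.card_le_four
      intro q hq
      by_contra hn
      simp only [Finset.mem_insert, Finset.mem_singleton, not_or] at hn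
      apply (Finset.mem_filter.mp hq).2
      rw [hu]
      simp only [Pi.add_apply]
      rw [Pi.single_eq_of_ne hn.1, Pi.single_eq_of_ne hn.2.1, Pi.single_eq_of_ne hn.2.2.1, Pi.single_eq_of_ne hn.2.2.2]
      rfl
    omega
  have hne : σ (Sum.inl none) ≠ σ (Sum.inr none) := fun h => by
    have := σ.injective h; simp at this
  have hA : σ (Sum.inl none) = Sum.inl none ∨ σ (Sum.inl none) = Sum.inr none := by
    by_contra hn
    rw [not_or] at hn
    have := congrFun hu0 (σ (Sum.inl none))
    rw [hu] at this
    simp only [Pi.add_apply] at this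
    rw [Pi.single_eq_of_ne hn.1, Pi.single_eq_of_ne hn.2, Pi.single_eq_same, Pi.single_eq_of_ne hne] at this
    rw [Pi.zero_apply] at this
    exact absurd this (by decide)
  have hB : σ (Sum.inr none) = Sum.inl none ∨ σ (Sum.inr none) = Sum.inr none := by
    by_contra hn
    rw [not_or] at hn
    have := congrFun hu0 (σ (Sum.inr none))
    rw [hu] at this
    simp only [Pi.add_apply] at this
    rw [Pi.single_eq_of_ne hn.1, Pi.single_eq_of_ne hn.2, Pi.single_eq_same, Pi.single_eq_of_ne hne.symm] at this
    rw [Pi.zero_apply] at this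
    exact absurd this (by decide)
  rcases hA with h1 | h1 <;> rcases hB with h2 | h2
  · exact absurd (h1.trans h2.symm) hne
  · exact Or.inl ⟨h1, h2⟩
  · exact Or.inr ⟨h1, h2⟩
  · exact absurd (h1.trans h2.symm) hne

end DC

namespace DC

open Classical in
/-- number of weight 16 words through the two border points and two given points -/
noncomputable def lam (r : A) (p q : Q) : ℕ :=
  (Finset.univ.filter fun w : W => w ∈ CA r ∧ hammingNorm w = 16 ∧ (w (Sum.inl none) = 1 ∧ w (Sum.inr none) = 1) ∧ w p = 1 ∧ w q = 1).card

theorem lam_inv {r : A} {σ : Equiv.Perm Q} (hσ : Au (CA r) σ)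
    (hi : (σ (Sum.inl none) = Sum.inl none ∧ σ (Sum.inr none) = Sum.inr none) ∨
    (σ (Sum.inl none) = Sum.inr none ∧ σ (Sum.inr none) = Sum.inl none)) (p q : Q) :
    lam r (σ p) (σ q) = lam r p q := by
  classical
  unfold lam
  refine Finset.card_equiv (Equiv.arrowCongr σ.symm (Equiv.refl (ZMod 2))) ?_
  intro w
  have e : (Equiv.arrowCongr σ.symm (Equiv.refl (ZMod 2))) w = w ∘ σ := by funext x; simp
  rw [e, Finset.mem_filter, Finset.mem_filter, ← hσ w, ham_comp (ι := Q) (κ := Q) σ w]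
  simp only [Function.comp_apply, Finset.mem_univ, true_and]
  rcases hi with ⟨h1, h2⟩ | ⟨h1, h2⟩
  · rw [h1, h2]
  · rw [h1, h2, and_comm (a := w (Sum.inr none) = 1)]

def pt (p : ℕ) : Q := if p < 45 then Sum.inl (some (p : ZMod 45)) else Sum.inr (some ((p - 45 : ℕ) : ZMod 45))

theorem idN_tb (a c i : ℕ) : (idN a c).testBit i = (a.testBit i || (decide (45 ≤ i) && c.testBit (i - 45))) := by
  change (a ||| (c <<< 45)).testBit i = _
  rw [Nat.testBit_or, Nat.testBit_shiftLeft]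
theorem tb_big {a i : ℕ} (ha : a < 2^45) (hi : 45 ≤ i) : a.testBit i = false :=
  Nat.testBit_lt_two_pow (lt_of_lt_of_le ha (Nat.pow_le_pow_right (by norm_num) hi))
theorem toA_idN (a c : ℕ) : toA (idN a c) = toA a := by
  apply A_ext; intro i
  have := ZMod.val_lt i
  rw [toA_coeff, toA_coeff, idN_tb, decide_eq_false (by omega), Bool.false_and, Bool.or_false]
theorem toA_idN' {a : ℕ} (c : ℕ) (ha : a < 2^45) : toA ((idN a c) >>> 45) = toA c := by
  apply A_ext; intro i
  rw [toA_coeff, toA_coeff, Nat.testBit_shiftRight, idN_tb, tb_big ha (by omega), decide_eq_true (by omega),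
    Bool.true_and, Bool.false_or, Nat.add_sub_cancel_left]
theorem pt_val {a c p : ℕ} (ha : a < 2^45) (hp : p < 90) :
    mk 1 (toA a) 1 (toA c) (pt p) = 1 ↔ (idN a c).testBit p = true := by
  unfold pt
  rw [idN_tb]
  split_ifs with h
  · change (toA a).coeff (p : ZMod 45) = 1 ↔ _
    rw [← tb_iff, ZMod.val_natCast, Nat.mod_eq_of_lt h, decide_eq_false (by omega), Bool.false_and, Bool.or_false]
  · change (toA c).coeff ((p - 45 : ℕ) : ZMod 45) = 1 ↔ _
    rw [← tb_iff, ZMod.val_natCast, Nat.mod_eq_of_lt (by omega), decide_eq_true (by omega), Bool.true_and, tb_big ha (by omega),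
      Bool.false_or]

theorem lam_TT {n : ℕ} (hn : n < 2^45) (hH : Hr (toA n)) {p : ℕ} (hp : p < 90) :
    lam (toA n) (Sum.inl (some 0)) (pt p) = TT n p := by
  classical
  symm
  unfold TT lam
  have one_val : (1 : ZMod 2).val = 1 := rfl
  refine Finset.card_bij (fun z _ => mk 1 (toA z) 1 (toA (z >>> 45))) ?_ ?_ ?_
  · intro z hz
    rw [Finset.mem_filter, List.mem_toFinset, blocks_mem hn hH] at hz
    obtain ⟨⟨a, ha, c, hc, rfl, hB, h0⟩, htb⟩ := hz
    rw [toA_idN, toA_idN' c ha, Finset.mem_filter]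
    refine ⟨Finset.mem_univ _, ?_, ?_, ⟨rfl, rfl⟩, ?_, (pt_val ha hp).mpr htb⟩
    · have := mk_mem (toA n) 1 (toA a)
      rwa [hB.2.1, one_smul, ← hB.1] at this
    · rw [ham_eq, La_mk, Ra_mk]
      change ((1 : ZMod 2).val + wt (toA a)) + ((1 : ZMod 2).val + wt (toA c)) = 16
      have := hB.2.2
      rw [one_val]; omega
    · have := (tb_iff a 0).mp h0
      exact this
  · intro z hz z' hz' he
    rw [Finset.mem_filter, List.mem_toFinset, blocks_mem hn hH] at hz hz'
    obtain ⟨⟨a, ha, c, hc, rfl, hB, h0⟩, htb⟩ := hz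
    obtain ⟨⟨a', ha', c', hc', rfl, hB', h0'⟩, htb'⟩ := hz'
    rw [toA_idN, toA_idN' c ha, toA_idN, toA_idN' c' ha'] at he
    have h1 := congrArg La he
    have h2 := congrArg Ra he
    rw [La_mk, La_mk] at h1
    rw [Ra_mk, Ra_mk] at h2
    rw [toA_inj ha ha' h1, toA_inj hc hc' h2]
  · intro w hw
    rw [Finset.mem_filter] at hw
    obtain ⟨_, hC, h16, ⟨hs, ht⟩, h0, hpw⟩ := hw
    obtain ⟨a, ha, hLa⟩ := toA_surj (La w)
    obtain ⟨c, hc, hRa⟩ := toA_surj (Ra w)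
    have hwe : w = mk 1 (toA a) 1 (toA c) := by
      rw [hLa, hRa, ← hs]; conv_rhs => rw [hs, ← ht]
      conv_lhs => rw [← mk_eta w]
      rw [hs, ht]
    refine ⟨idN a c, ?_, ?_⟩
    · rw [Finset.mem_filter, List.mem_toFinset, blocks_mem hn hH]
      refine ⟨⟨a, ha, c, hc, rfl, ⟨?_, ?_, ?_⟩, ?_⟩, ?_⟩
      · rw [hLa, hRa, hC.2, hs, one_smul]
      · rw [hLa, ← hC.1, ht]
      · rw [ham_eq, hs, ht, one_val] at h16
        rw [hLa, hRa]; omega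
      · have := (tb_iff a 0).mpr (by rw [hLa]; exact h0)
        exact this
      · rw [hwe] at hpw
        exact (pt_val ha hp).mp hpw
    · rw [toA_idN, toA_idN' c ha]; exact hwe.symm

theorem sh_lam {r : A} (k : ZMod 45) (p q : Q) : lam r (sh k p) (sh k q) = lam r p q :=
  lam_inv (sh_Au r k) (Or.inl ⟨rfl, rfl⟩) p q
theorem tw_lam {r : A} (hr : Hr r) (p q : Q) : lam r (tw p) (tw q) = lam r p q :=
  lam_inv (tw_Au hr) (Or.inr ⟨rfl, rfl⟩) p q

theorem pt_lt {p : ℕ} (h : p < 45) : pt p = Sum.inl (some (p : ZMod 45)) := if_pos h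
theorem pt_ge {p : ℕ} (h : 45 ≤ p) : pt p = Sum.inr (some (p : ZMod 45)) := by
  unfold pt
  rw [if_neg (by omega), Nat.cast_sub h, show ((45 : ℕ) : ZMod 45) = 0 from rfl, sub_zero]
theorem pt_mod (m : ℕ) : pt (m % 45) = Sum.inl (some (m : ZMod 45)) := by
  rw [pt_lt (Nat.mod_lt _ (by norm_num)), ZMod.natCast_mod]
theorem pt_mod' (m : ℕ) : pt (45 + m % 45) = Sum.inr (some (m : ZMod 45)) := by
  rw [pt_ge (by omega), Nat.cast_add, ZMod.natCast_mod, show ((45 : ℕ) : ZMod 45) = 0 from rfl, zero_add]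

theorem lam_ll (r : A) (i j : ZMod 45) : lam r (Sum.inl (some i)) (Sum.inl (some j)) = lam r (Sum.inl (some 0)) (Sum.inl (some (j - i))) := by
  rw [← sh_lam (-i), sh_l, sh_l, add_neg_cancel, sub_eq_add_neg]
theorem lam_lr (r : A) (i j : ZMod 45) : lam r (Sum.inl (some i)) (Sum.inr (some j)) = lam r (Sum.inl (some 0)) (Sum.inr (some (j - i))) := by
  rw [← sh_lam (-i), sh_l, sh_r, add_neg_cancel, sub_eq_add_neg]
theorem lam_rl {r : A} (hr : Hr r) (i j : ZMod 45) : lam r (Sum.inr (some i)) (Sum.inl (some j)) = lam r (Sum.inl (some 0)) (Sum.inr (some (i - j))) := by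
  rw [← tw_lam hr, tw_l, tw_r, lam_lr, neg_sub_neg]
theorem lam_rr {r : A} (hr : Hr r) (i j : ZMod 45) : lam r (Sum.inr (some i)) (Sum.inr (some j)) = lam r (Sum.inl (some 0)) (Sum.inl (some (i - j))) := by
  rw [← tw_lam hr, tw_r, tw_r, lam_ll, neg_sub_neg]

theorem idx_eq (y z : ℕ) : idx y z = if 45 ≤ y then (if 45 ≤ z then (y + 45 - z) % 45 else 45 + (y - z) % 45)
    else (if 45 ≤ z then 45 + (z - y) % 45 else (z + 45 - y) % 45) := by
  unfold idx
  simp only [bi_eq, Nat.ble_eq]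
  rfl

theorem c45 : ((45 : ℕ) : ZMod 45) = 0 := rfl
theorem idx_lt (y z : ℕ) : idx y z < 90 := by
  rw [idx_eq]; split_ifs <;> omega
theorem lam_idx {r : A} (hr : Hr r) {y z : ℕ} (hy : y < 90) (hz : z < 90) :
    lam r (pt y) (pt z) = lam r (Sum.inl (some 0)) (pt (idx y z)) := by
  rw [idx_eq]
  split_ifs with h1 h2 h2
  · rw [pt_ge h1, pt_ge h2, pt_mod, lam_rr hr, Nat.cast_sub (by omega), Nat.cast_add, c45, add_zero]
  · rw [pt_ge h1, pt_lt (by omega), pt_mod', lam_rl hr, Nat.cast_sub (by omega)]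
  · rw [pt_lt (by omega), pt_ge h2, pt_mod', lam_lr, Nat.cast_sub (by omega)]
  · rw [pt_lt (by omega), pt_lt (by omega), pt_mod, lam_ll, Nat.cast_sub (by omega), Nat.cast_add, c45, add_zero]

/-! invariants -/
def fin (q : Q) : Prop := q ≠ Sum.inl none ∧ q ≠ Sum.inr none
theorem fin_iff {σ : Equiv.Perm Q} (hi : (σ (Sum.inl none) = Sum.inl none ∧ σ (Sum.inr none) = Sum.inr none) ∨
    (σ (Sum.inl none) = Sum.inr none ∧ σ (Sum.inr none) = Sum.inl none)) (p : Q) : fin (σ p) ↔ fin p := by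
  unfold fin
  rcases hi with ⟨h1, h2⟩ | ⟨h1, h2⟩
  · have e1 : σ p ≠ Sum.inl none ↔ p ≠ Sum.inl none := by rw [← σ.injective.ne_iff (x := p), h1]
    have e2 : σ p ≠ Sum.inr none ↔ p ≠ Sum.inr none := by rw [← σ.injective.ne_iff (x := p), h2]
    rw [e1, e2]
  · have e1 : σ p ≠ Sum.inr none ↔ p ≠ Sum.inl none := by rw [← σ.injective.ne_iff (x := p), h1]
    have e2 : σ p ≠ Sum.inl none ↔ p ≠ Sum.inr none := by rw [← σ.injective.ne_iff (x := p), h2]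
    rw [e1, e2, and_comm]
open Classical in
noncomputable def Sv (r : A) (v : ℕ) (q : Q) : ℕ :=
  ∑ p : Q, if fin p ∧ lam r (Sum.inl (some 0)) p = v then lam r q p else 0

theorem Sv_inv {r : A} {σ : Equiv.Perm Q} (hσ : Au (CA r) σ)
    (hi : (σ (Sum.inl none) = Sum.inl none ∧ σ (Sum.inr none) = Sum.inr none) ∨
    (σ (Sum.inl none) = Sum.inr none ∧ σ (Sum.inr none) = Sum.inl none))
    (h0 : σ (Sum.inl (some 0)) = Sum.inl (some 0)) (v : ℕ) (q : Q) : Sv r v (σ q) = Sv r v q := by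
  unfold Sv
  rw [← Equiv.sum_comp σ]
  refine Finset.sum_congr rfl fun p _ => ?_
  have hf : fin (σ p) ↔ fin p := fin_iff hi p
  have hl : lam r (Sum.inl (some 0)) (σ p) = lam r (Sum.inl (some 0)) p := by
    rw [← lam_inv hσ hi (Sum.inl (some 0)) p, h0]
  rw [lam_inv hσ hi, hl, hf]

theorem sum_range45 (g : ZMod 45 → ℕ) : ∑ z ∈ Finset.range 45, g (z : ZMod 45) = ∑ i, g i := by
  rw [Finset.sum_range]
  refine Finset.sum_congr rfl fun i _ => ?_
  exact congrArg g (ZMod.natCast_zmod_val (n := 45) i)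

theorem Sv_eq (r : A) (v : ℕ) (q : Q) : Sv r v q =
    ∑ z ∈ Finset.range 90, if lam r (Sum.inl (some 0)) (pt z) = v then lam r q (pt z) else 0 := by
  classical
  unfold Sv
  have a1 : ¬ (fin (Sum.inl none) ∧ lam r (Sum.inl (some 0)) (Sum.inl none) = v) := fun h => h.1.1 rfl
  have a2 : ¬ (fin (Sum.inr none) ∧ lam r (Sum.inl (some 0)) (Sum.inr none) = v) := fun h => h.1.2 rfl
  rw [sum_Q, if_neg a1, if_neg a2, zero_add, zero_add]
  refine Eq.trans ?_ (Finset.sum_range_add _ 45 45).symm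
  refine congrArg₂ (· + ·) ((sum_range45 _).symm.trans ?_) ((sum_range45 _).symm.trans ?_)
  · refine Finset.sum_congr rfl fun z hz => ?_
    rw [pt_lt (Finset.mem_range.mp hz)]
    simp [fin]
  · refine Finset.sum_congr rfl fun z hz => ?_
    rw [pt_ge (by omega), Nat.cast_add, c45, zero_add]
    simp [fin]

theorem sumL_zl (pl : List ℕ) (v y : ℕ) : ∀ n, sumL pl y (zl pl v n) =
    ∑ z ∈ Finset.range n, if valP pl z = v then valP pl (idx y z) else 0 := by
  intro n
  induction n with
  | zero => rfl
  | succ n ih =>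
    rw [Finset.sum_range_succ, ← ih]
    change sumL pl y (bi (Nat.beq (valP pl n) v) (n :: zl pl v n) (zl pl v n)) = _
    rw [bi_eq]
    by_cases h : valP pl n = v
    · rw [if_pos h, if_pos (Nat.beq_eq.mpr h)]
      exact Nat.add_comm _ _
    · rw [if_neg h, if_neg (fun hh => h (Nat.beq_eq.mp hh))]; rfl

theorem neAll_spec {x : ℕ} {f : ℕ → ℕ} {F : ℕ → List ℕ} (hF : ∀ n, F (n + 1) = f n :: F n) :
    ∀ n, neAll x (F n) = true → ∀ y < n, x ≠ f y := by
  intro n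
  induction n with
  | zero => intro _ y hy; omega
  | succ n ih =>
    intro h y hy
    rw [hF] at h
    have h' : bi (Nat.beq x (f n)) false (neAll x (F n)) = true := h
    rw [bi_eq] at h'
    split_ifs at h' with hh
    rcases Nat.lt_succ_iff_lt_or_eq.mp hy with h1 | h1
    · exact ih h' y h1
    · subst h1; intro he; exact hh (Nat.beq_eq.mpr he)
theorem nodup_spec {f : ℕ → ℕ} {F : ℕ → List ℕ} (hF : ∀ n, F (n + 1) = f n :: F n) :
    ∀ n, nodupB (F n) = true → ∀ y < n, ∀ y' < y, f y ≠ f y' := by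
  intro n
  induction n with
  | zero => intro _ y hy; omega
  | succ n ih =>
    intro h y hy
    rw [hF] at h
    have h' : bi (neAll (f n) (F n)) (nodupB (F n)) false = true := h
    rw [bi_eq] at h'
    split_ifs at h' with hh
    rcases Nat.lt_succ_iff_lt_or_eq.mp hy with h1 | h1
    · exact ih h' y h1
    · subst h1; exact neAll_spec hF _ hh

theorem f2_congr (pl : List ℕ) (y y' : ℕ) (vs : List ℕ) (h : ∀ v, sumL pl y (zl pl v 90) = sumL pl y' (zl pl v 90)) :
    f2 pl y (vs.map (fun v => zl pl v 90)) = f2 pl y' (vs.map (fun v => zl pl v 90)) := by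
  induction vs with
  | nil => rfl
  | cons v vs ih =>
    change Nat.add (sumL pl y (zl pl v 90)) (Nat.mul 4096 (f2 pl y (vs.map (fun v => zl pl v 90)))) =
      Nat.add (sumL pl y' (zl pl v 90)) (Nat.mul 4096 (f2 pl y' (vs.map (fun v => zl pl v 90))))
    rw [h, ih]

theorem pt_surj {q : Q} (h : fin q) : ∃ y < 90, pt y = q := by
  rcases q with (_ | i) | (_ | i)
  · exact absurd rfl h.1
  · refine ⟨i.val, by have := ZMod.val_lt i; omega, ?_⟩
    rw [pt_lt (ZMod.val_lt i), ZMod.natCast_zmod_val]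
  · exact absurd rfl h.2
  · refine ⟨45 + i.val, by have := ZMod.val_lt i; omega, ?_⟩
    rw [pt_ge (by omega), Nat.cast_add, c45, zero_add, ZMod.natCast_zmod_val]

/-- an automorphism fixing one finite point fixes all of them -/
theorem fix_fin {n : ℕ} (hn : n < 2^45) (hH : Hr (toA n)) {vs : List ℕ} (hc : chk n vs = true)
    {σ : Equiv.Perm Q} (hσ : Au (CA (toA n)) σ)
    (hi : (σ (Sum.inl none) = Sum.inl none ∧ σ (Sum.inr none) = Sum.inr none) ∨
    (σ (Sum.inl none) = Sum.inr none ∧ σ (Sum.inr none) = Sum.inl none))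
    (h0 : σ (Sum.inl (some 0)) = Sum.inl (some 0)) (q : Q) (hq : fin q) : σ q = q := by
  unfold chk at hc
  rw [bi_eq] at hc
  split_ifs at hc with hs
  have hT := TT_spec hs
  generalize cnt8 (blocks n) [0,0,0,0,0,0,0,0] = pl at hc hT
  unfold chk2 at hc
  have hnd := nodup_spec (f := fun y => f2 pl y (vs.map (fun v => zl pl v 90)))
    (F := f2s pl (vs.map (fun v => zl pl v 90))) (fun _ => rfl) 90 hc
  have hS : ∀ y < 90, ∀ v, Sv (toA n) v (pt y) = sumL pl y (zl pl v 90) := by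
    intro y hy v
    rw [Sv_eq, sumL_zl]
    refine Finset.sum_congr rfl fun z hz => ?_
    have hz' := Finset.mem_range.mp hz
    rw [lam_idx hH hy hz', lam_TT hn hH hz', lam_TT hn hH (idx_lt y z), hT, hT]
  have hf : fin (σ q) := (fin_iff hi q).mpr hq
  obtain ⟨y, hy, rfl⟩ := pt_surj hq
  obtain ⟨y', hy', hyy⟩ := pt_surj hf
  have he : f2 pl y (vs.map (fun v => zl pl v 90)) = f2 pl y' (vs.map (fun v => zl pl v 90)) := by
    apply f2_congr
    intro v
    rw [← hS y hy, ← hS y' hy', hyy, Sv_inv hσ hi h0]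
  rcases Nat.lt_trichotomy y y' with h | h | h
  · exact absurd he.symm (hnd y' hy' y h)
  · rw [← hyy, h]
  · exact absurd he (hnd y hy y' h)

theorem good_PP {n : ℕ} (hn : n < 2^45) (h4 : wt (toA n) % 4 = 0) {vs : List ℕ} (hc : chk n vs = true) : PP (CA (toA n)) := by
  intro hsd hm
  have hH := Hr_of_sd hsd
  have hone : ∀ σ, Au (CA (toA n)) σ → σ (Sum.inl (some 0)) = Sum.inl (some 0) → σ = 1 := by
    intro σ hσ h0
    have hi := inf_inv hsd hm h4 hσ
    have hf := fix_fin hn hH hc hσ hi h0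
    have hi' : σ (Sum.inl none) = Sum.inl none ∧ σ (Sum.inr none) = Sum.inr none := by
      rcases hi with h | h
      · exact h
      · exfalso
        have hw : mk 1 0 0 J ∈ CA (toA n) := by
          have := mk_mem (toA n) 1 0
          rwa [one_smul, zero_mul, add_zero, eps_zero] at this
        have := ((hσ _).mp hw).1
        have hL : La (mk 1 0 0 J ∘ σ) = 0 := by
          apply A_ext; intro i
          change mk 1 0 0 J (σ (Sum.inl (some i))) = _
          rw [hf _ ⟨by simp, by simp⟩]; rfl
        rw [hL, eps_zero, Function.comp_apply, h.2] at this
        exact absurd this (by change ¬ ((1 : ZMod 2) = 0); decide)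
    apply Equiv.ext
    intro q
    by_cases h1 : q = Sum.inl none
    · rw [h1]; exact hi'.1
    by_cases h2 : q = Sum.inr none
    · rw [h2]; exact hi'.2
    exact hf q ⟨h1, h2⟩
  let F : ZMod 45 ⊕ ZMod 45 → {σ : Equiv.Perm Q // Submodule.map (LinearMap.funLeft (ZMod 2) (ZMod 2) ⇑σ) (CA (toA n)) = CA (toA n)} :=
    Sum.elim (fun i => ⟨sh i, (Au_iff _ _).mpr (sh_Au _ i)⟩) (fun i => ⟨sh i * tw, (Au_iff _ _).mpr (Au_mul (sh_Au _ i) (tw_Au hH))⟩)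
  have hFl : ∀ i, (F (Sum.inl i)).1 (Sum.inl (some 0)) = Sum.inl (some i) := by
    intro i
    change sh i (Sum.inl (some 0)) = _
    rw [sh_l, zero_add]
  have hFr : ∀ i, (F (Sum.inr i)).1 (Sum.inl (some 0)) = Sum.inr (some i) := by
    intro i
    change sh i (tw (Sum.inl (some 0))) = _
    rw [tw_l, sh_r, neg_zero, zero_add]
  have hb : Function.Bijective F := by
    constructor
    · intro x y hxy
      have := congrArg (fun s => s.1 (Sum.inl (some 0))) hxy
      rcases x with i | i <;> rcases y with j | j
      · simp only [hFl] at this; simpa using this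
      · simp only [hFl, hFr] at this; simp at this
      · simp only [hFl, hFr] at this; simp at this
      · simp only [hFr] at this; simpa using this
    · rintro ⟨σ, hs⟩
      have hσ := (Au_iff _ _).mp hs
      have key : ∃ x, (F x).1 (Sum.inl (some 0)) = σ (Sum.inl (some 0)) := by
        have hi := inf_inv hsd hm h4 hσ
        rcases hq : σ (Sum.inl (some 0)) with (_ | i) | (_ | i)
        · exfalso
          rcases hi with h | h
          · have := σ.injective (hq.trans h.1.symm); simp at this
          · have := σ.injective (hq.trans h.2.symm); simp at this
        · exact ⟨Sum.inl i, hFl i⟩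
        · exfalso
          rcases hi with h | h
          · have := σ.injective (hq.trans h.2.symm); simp at this
          · have := σ.injective (hq.trans h.1.symm); simp at this
        · exact ⟨Sum.inr i, hFr i⟩
      obtain ⟨x, hx⟩ := key
      refine ⟨x, Subtype.ext ?_⟩
      have hx' := (Au_iff _ _).mp (F x).2
      have h1 := hone ((F x).1⁻¹ * σ) (Au_mul (Au_inv hx') hσ) (by
        rw [Equiv.Perm.mul_apply, ← hx]; exact Equiv.symm_apply_apply _ _)
      exact inv_mul_eq_one.mp h1
  unfold autGroupOrder
  rw [← Nat.card_congr (Equiv.ofBijective F hb), Nat.card_eq_fintype_card, Fintype.card_sum, ZMod.card]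

theorem good_side : allB (fun n => bi (Nat.blt n 35184372088832) (Nat.beq (Nat.mod (pc n) 4) 0) false) goodR = true := by
  decide +kernel
theorem good_PP' {vs : List ℕ} (n : ℕ) (hm : n ∈ goodR) (hc : PLift (chk n vs = true)) : PP (CA (toA n)) := by
  have := allB_spec good_side n hm
  rw [bi_eq] at this
  split_ifs at this with h
  refine good_PP ?_ ?_ hc.down
  · have := Nat.blt_eq.mp h
    norm_num
    exact this
  · rw [← pc_eq]; exact Nat.beq_eq.mp this

theorem all_PP (h : ∀ n ∈ goodR, PP (CA (toA n))) (r : A) : PP (CA r) := by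
  intro hsd
  exact classify (fun r => PP (CA r)) PP_X (fun u v huv r => PP_mu u v huv r) (fun r hw => Wit_PP hw) h r (Hr_of_sd hsd) hsd

end DC

namespace DC
theorem gc {a : ℕ} {l : List ℕ} (vs : List ℕ) (hl : ∀ n ∈ l, ∃ vs, chk n vs = true)
    (h : chk a vs = true := by decide +kernel) :
    ∀ n ∈ a :: l, ∃ vs, chk n vs = true := fun n hn => by
  rcases List.mem_cons.1 hn with rfl | hn
  exacts [⟨vs, h⟩, hl n hn]
set_option maxHeartbeats 20000000 in
theorem all_good : ∀ n ∈ goodR, ∃ vs, chk n vs = true :=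
  gc [7, 10, 12, 29, 30] <| gc [6, 14, 25] <| gc [13, 31, 35, 39] <| gc [5, 7, 8, 9, 25] <| gc [8, 11, 13] <| gc [19, 20, 21] <|
  gc [7, 9, 11] <| gc [12, 13, 14, 16] <| gc [4, 17, 19, 21] <| gc [10, 28, 29, 31] <| gc [24, 28, 31, 34] <| gc [12, 32, 38, 154] <|
  gc [14, 23, 26] <| gc [8, 12, 13] <| gc [14, 17, 18, 21] <| gc [9, 11, 32, 34] <| gc [5, 25, 26, 28] <| gc [8, 11, 28, 31, 34] <|
  gc [26, 34, 36, 119] <| gc [0, 5, 21, 28] <| gc [11, 14, 15, 17] <| gc [8, 11, 24] <| gc [25, 26, 28, 29] <| gc [27, 28, 119, 9] <|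
  gc [9, 22, 91, 7, 8] <| gc [8, 10, 26, 30] <| gc [4, 18, 22, 23] <| gc [6, 7, 22] <| gc [6, 8, 11, 12] <| gc [5, 8, 11, 21] <|
  gc [5, 21, 29] <| gc [2, 5, 21, 23] <| gc [5, 7, 11, 12] <| gc [6, 21, 22, 23, 24] <| gc [26, 30, 32, 38, 40] <| gc [20, 24, 112] <|
  gc [6, 9, 23] <| gc [19, 20, 21, 23, 24] <| gc [29, 31, 33] <| gc [8, 14, 25, 26] <| gc [36, 38, 39, 42] <| gc [8, 9, 24, 29] <|
  gc [2, 4, 21] <| gc [14, 25, 29, 30] <| gc [10, 14, 34, 133] <| gc [7, 25, 26] <| gc [9, 12, 25, 28] <| gc [8, 11, 29, 126] <|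
  gc [18, 32, 33] <| gc [9, 12, 25, 28] <| gc [2, 17, 21, 77] <| gc [105, 8, 9] <| gc [19, 23, 84, 4] <| gc [11, 35, 154, 13] <|
  gc [8, 26, 27, 28] <| gc [5, 63, 14, 15, 4] <| gc [13, 23, 24] <| gc [5, 25, 32, 119] <| gc [11, 16, 21, 39, 40] <| gc [6, 7, 21, 26, 105] <|
  gc [7, 30, 105, 8] <| gc [16, 70, 4, 17] <| gc [7, 10, 25, 26] <| gc [11, 13, 14, 33] <| gc [6, 21, 91, 7, 9] <| gc [8, 9, 11] <|
  gc [10, 13, 35] <| gc [14, 33, 39, 40] <| gc [11, 21, 31, 32] <| gc [7, 8, 22, 23] <| gc [10, 16, 27] <| gc [7, 26, 105, 12] <|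
  gc [4, 6, 10, 26] <| gc [7, 8, 11, 20] <| gc [12, 26, 27, 28] <| gc [13, 25, 27, 28] <| gc [7, 21, 22, 98] <| gc [13, 14, 21, 30] <|
  gc [8, 10, 12, 15] <| gc [11, 20, 28, 32, 133, 9] <| gc [9, 13, 25, 31] <| gc [9, 13, 25, 31] <| gc [3, 5, 9, 30, 112] <| gc [9, 14, 15, 17] <|
  gc [16, 19, 23] <| gc [19, 21, 182, 18] <| gc [9, 15, 29, 35] <| gc [24, 25, 27] <| gc [6, 9, 13, 25] <| gc [17, 18, 36, 43] <|
  gc [8, 28, 119] <| gc [11, 13, 15, 17] <| gc [11, 16, 18, 27] <| gc [8, 24, 26, 30] <| gc [11, 29, 30, 34] <| gc [8, 24, 26, 30] <|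
  gc [5, 7, 24, 91] <| gc [3, 4, 5, 19, 21] <| gc [6, 8, 22, 29] <| gc [30, 31, 34] <| gc [4, 8, 10] <| gc [9, 10, 13, 27] <|
  gc [14, 16, 32] <| gc [13, 19, 30, 32] <| gc [16, 63, 4, 13] <| gc [8, 30, 39, 147] <| gc [2, 3, 4, 5] <| gc [35, 37, 42, 182] <|
  gc [9, 11, 27, 29] <| gc [6, 7, 25, 27] <| gc [13, 14, 18, 20] <| gc [24, 25, 26, 105, 7] <| gc [24, 25, 26, 105, 7] <| gc [7, 9, 20, 23, 112] <|
  gc [5, 19, 22, 84] <| gc [5, 7, 10, 26] <| gc [6, 22, 30, 38] <| gc [6, 8, 24] <| gc [5, 21, 22, 84] <| gc [3, 7, 20, 21] <|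
  gc [12, 13, 29, 33] <| gc [6, 10, 11, 28] <| gc [5, 11, 27] <| gc [6, 8, 9] <| gc [4, 6, 7, 20] <| gc [23, 24, 27, 28] <|
  gc [12, 34, 36, 175] <| gc [4, 20, 25, 77, 6] <| gc [30, 35, 38] <| gc [12, 14, 16] <| gc [9, 12, 27, 29, 33, 126] <| gc [9, 11, 29] <|
  gc [4, 10, 23, 91] <| gc [6, 24, 25, 26] <| gc [6, 7, 22, 98] <| gc [14, 15, 18, 41] <| gc [0, 3, 4, 70] <| gc [10, 11, 22, 105, 8] <|
  gc [9, 24, 27] <| gc [6, 9, 29, 105] <| gc [6, 7, 14, 28] <| gc [9, 13, 23, 25] <| gc [6, 9, 10, 19] <| gc [5, 20, 24, 84] <|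
  gc [27, 28, 119, 9, 11] <| gc [13, 16, 28] <| gc [6, 7, 25, 32] <| gc [6, 7, 25, 32] <| gc [8, 31, 140] <| gc [8, 31, 140] <|
  gc [8, 31, 140] <| gc [6, 7, 25, 32] <| gc [8, 31, 140] <| gc [6, 7, 25, 32] <| gc [3, 4, 19, 20] <| gc [9, 10, 25, 26] <|
  gc [7, 10, 27, 29] <| gc [4, 6, 21, 22] <| gc [9, 10, 23, 112] <| gc [6, 10, 17, 25] <| gc [8, 10, 26, 27] <| gc [5, 98, 6, 20] <|
  gc [8, 11, 12] <| gc [12, 21, 24, 27] <| gc [6, 21, 84] <| gc [14, 15, 30, 31] <|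
  fun n hn => absurd hn List.not_mem_nil
theorem all_good_PP : ∀ n ∈ goodR, PP (CA (toA n)) := fun n hn =>
  let ⟨_, h⟩ := all_good n hn
  good_PP' n hn ⟨h⟩
end DC

theorem aut_group_bordered_dcc_92 (B : Matrix (Fin 46) (Fin 46) (ZMod 2))
    (hB : IsBorderMatrix (n := 45) B) (hsd : IsSelfDual (borderedDCC (n := 45) B))
    (hmin : MinWeightIs (borderedDCC (n := 45) B) 16) :
    autGroupOrder (borderedDCC (n := 45) B) = 90 := by
  exact DC.bordered_PP B hB (DC.all_PP DC.all_good_PP) hsd hmin
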